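/- Fix ε>0 and set K=(1/8−ε)N, R=N/4, Q=N/8. For all sufficiently large N and every θ ∈ T, |Σ_{f∈G_N} (Ψ(f) − Ψ'(f)) e(fθ)| ≤ (1/3)·2^{N−K}. -/

import Mathlib

open Polynomial
open scoped Classical

noncomputable section

abbrev F2 := ZMod 2
abbrev Kinf := LaurentSeries F2
def polyToK (f : F2[X]) : Kinf :=
  ∑ i ∈ f.support, HahnSeries.single (-(i : ℤ)) (f.coeff i)
def ordK (a : Kinf) : WithBot ℤ := if a = 0 then ⊥ else (↑(-a.order) : WithBot ℤ)
def eKr (a : Kinf) : ℝ := (-1 : ℝ) ^ ((a.coeff 1).val)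
def eK (a : Kinf) : ℂ := ((eKr a : ℝ) : ℂ)
def InT (θ : Kinf) : Prop := ordK θ ≤ ((-1 : ℤ) : WithBot ℤ)
def GN (N : ℕ) : Finset F2[X] :=
  Set.Finite.toFinset (s := {f : F2[X] | f.degree < (N : ℕ)}) (by
    have h : {f : F2[X] | f.degree < (N : ℕ)} = ↑(Polynomial.degreeLT F2 N) := by
      ext f
      simp [Polynomial.mem_degreeLT]
    rw [h]
    have : Finite (Polynomial.degreeLT F2 N) :=
      Finite.of_equiv _ (Polynomial.degreeLTEquiv F2 N).symm.toEquiv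
    exact (Polynomial.degreeLT F2 N : Set F2[X]).toFinite)
def ratK (u s : F2[X]) : Kinf := polyToK u * (polyToK s)⁻¹

/-- τ(f): the number of divisors of `f`. -/
def tau (f : F2[X]) : ℕ := ((GN (f.natDegree + 1)).filter (fun g => g ∣ f)).card

/-- φ(f): the number of invertible residues modulo `f`. -/
def phi (f : F2[X]) : ℕ := ((GN f.natDegree).filter (fun g => IsCoprime g f)).card

/-- ω(f): the number of (irreducible nonconstant, i.e. prime) divisors of `f`. -/
def omegaP (f : F2[X]) : ℕ :=
  ((GN (f.natDegree + 1)).filter (fun r => Irreducible r ∧ r ∣ f)).card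

/-- The Möbius function on `F₂[x]`. -/
def mu (f : F2[X]) : ℤ := if Squarefree f then (-1) ^ (omegaP f) else 0

/-- The set of invertible residues modulo `s` (canonical representatives of
`(F₂[x]/(s))^×`, i.e. polynomials of degree `< deg s` coprime to `s`). -/
def residues (s : F2[X]) : Finset F2[X] := (GN s.natDegree).filter (fun t => IsCoprime t s)

/-- `α(s) = μ(s)/φ(s)`. -/
def alphaA (s : F2[X]) : ℝ := (mu s : ℝ) / (phi s : ℝ)

/-- `α'(s) = ∏_{r | s prime} 3/(2^{deg r}+3)` for `s` squarefree, `0` otherwise. -/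
def alphaB (s : F2[X]) : ℝ :=
  if Squarefree s then
    ∏ r ∈ (GN (s.natDegree + 1)).filter (fun r => Irreducible r ∧ r ∣ s),
      (3 : ℝ) / ((2 : ℝ) ^ r.natDegree + 3)
  else 0

/-- `Λ_M(f) = Σ_{s ∈ G_M} α(s) Σ_{t ∈ (F₂[x]/(s))^×} e(f t s⁻¹)`. -/
def LambdaM (M : ℕ) (f : F2[X]) : ℝ :=
  ∑ s ∈ GN M, alphaA s * ∑ t ∈ residues s, eKr (polyToK f * ratK t s)

/-- `H_M(f) = Σ_{s ∈ G_M} α'(s) Σ_{t ∈ (F₂[x]/(s))^×} e(f t s⁻¹)`. -/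
def HM (M : ℕ) (f : F2[X]) : ℝ :=
  ∑ s ∈ GN M, alphaB s * ∑ t ∈ residues s, eKr (polyToK f * ratK t s)

/-- `Λ'(f) = deg f` if `f` is prime, `0` otherwise. -/
def LambdaP (f : F2[X]) : ℝ := if Irreducible f then (f.natDegree : ℝ) else 0

/-- `Ψ(f) = Λ'(f+1) H_Q(f) 1_{f ∈ G_N}`. -/
def Psi (N Q : ℕ) (f : F2[X]) : ℝ :=
  LambdaP (f + 1) * HM Q f * (if f ∈ GN N then 1 else 0)

/-- `Ψ'(f) = Λ_R(f+1) H_Q(f) 1_{f ∈ G_N}`. -/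
def Psi' (N R Q : ℕ) (f : F2[X]) : ℝ :=
  LambdaM R (f + 1) * HM Q f * (if f ∈ GN N then 1 else 0)

/-- `Λ_r(f)` for a single prime `r`. -/
def Lambda_r (r f : F2[X]) : ℝ :=
  if r ∣ f then 0 else (2 : ℝ) ^ r.natDegree / ((2 : ℝ) ^ r.natDegree - 1)

/-- `τ²_r(f)` for a single prime `r`. -/
def tauSq_r (r f : F2[X]) : ℝ :=
  if r ∣ f then 4 * (2 : ℝ) ^ r.natDegree / ((2 : ℝ) ^ r.natDegree + 3)
  else (2 : ℝ) ^ r.natDegree / ((2 : ℝ) ^ r.natDegree + 3)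

/-- `˜Λ_M(f) = ∏_{r ∈ G_M prime} Λ_r(f)`. -/
def LambdaTilde (M : ℕ) (f : F2[X]) : ℝ :=
  ∏ r ∈ (GN M).filter (fun r => Irreducible r), Lambda_r r f

/-- `˜H_M(f) = ∏_{r ∈ G_M prime} τ²_r(f)`. -/
def HTilde (M : ℕ) (f : F2[X]) : ℝ :=
  ∏ r ∈ (GN M).filter (fun r => Irreducible r), tauSq_r r f

/-- The element of `K∞` determined by a rational function (with `x ↦ t⁻¹`). -/
def ratToK (l : RatFunc F2) : Kinf := polyToK l.num * (polyToK l.denom)⁻¹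

/-- `c : F₂(x)/F₂[x] → ℝ` (encoded on the canonical representatives
`λ = num/denom` in lowest terms with `deg num < deg denom`) is the system of Fourier
coefficients of `F : F₂[x] → ℝ`, i.e. `F(f) = Σ_λ c(λ) e(λ f)`. -/
def IsFourierCoeffs (F : F2[X] → ℝ) (c : RatFunc F2 → ℝ) : Prop :=
  (Function.support c).Finite ∧
  (∀ l : RatFunc F2, c l ≠ 0 → (l.num).degree < (l.denom).degree) ∧
  ∀ f : F2[X], F f = ∑ᶠ l : RatFunc F2, c l * eKr (ratToK l * polyToK f)

/-- The canonical representative (mod `F₂[x]`) of a rational function. -/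
def fracRat (l : RatFunc F2) : RatFunc F2 :=
  l - algebraMap F2[X] (RatFunc F2) (l.num / l.denom)

/-- `c(n, η)` from the statement of the exponential sum estimate for `Λ'`. -/
def cFun (n : ℕ) (η : Kinf) : ℝ :=
  if ordK η < ((-(n : ℤ) - 1 : ℤ) : WithBot ℤ) then 1
  else if ordK η = ((-(n : ℤ) - 1 : ℤ) : WithBot ℤ) then -1
  else 0

/-- The class `C_B(X)` (with explicit implied constant `Cst`): functions whose Fourier
coefficients are supported on `λ` with squarefree denominator of degree `≤ X` and satisfy
`|c(λ)| ≤ Cst · τ(denom λ)^B / 2^{deg (denom λ)}`. -/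
def InClassC (B X : ℕ) (Cst : ℝ) (F : F2[X] → ℝ) : Prop :=
  ∃ c : RatFunc F2 → ℝ, IsFourierCoeffs F c ∧
    (∀ l : RatFunc F2, c l ≠ 0 → Squarefree l.denom ∧ (l.denom).natDegree ≤ X) ∧
    (∀ l : RatFunc F2, |c l| ≤ Cst * (tau l.denom : ℝ) ^ B / 2 ^ (l.denom).natDegree)

/-- The fractional part `‖θ‖` of `θ ∈ K∞`: keep exactly the coefficients of `x^{-n}`, `n ≥ 1`. -/
def fracK (θ : Kinf) : Kinf :=
  ⟨fun n => if 1 ≤ n then θ.coeff n else 0, by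
    apply θ.isPWO_support'.mono
    intro n hn
    simp only [Function.mem_support, ne_eq] at hn ⊢
    intro h
    apply hn
    split_ifs
    · exact h
    · rfl⟩

set_option linter.all false

namespace S8

section Step
variable {κ A Ω ι : Type*} [Field κ] [CommRing A] [IsDomain A] [Algebra κ[X] A] [Algebra κ A]
  [IsScalarTower κ κ[X] A] [Fintype ι] [Field Ω] [Algebra κ Ω]

/-- elements whose coordinates have degree `< D`. -/
def LL (b : Module.Basis ι κ[X] A) (D : ℕ) : Submodule κ A where
  carrier := {x | ∀ i, b.repr x i ∈ degreeLT κ D}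
  add_mem' := by
    intro x y hx hy i
    simpa using Submodule.add_mem _ (hx i) (hy i)
  zero_mem' := by intro i; simp
  smul_mem' := by
    intro c x hx i
    have h : c • x = (C c : κ[X]) • x := by
      rw [← algebraMap_smul κ[X] c x]; rfl
    rw [h, map_smul, Finsupp.smul_apply, smul_eq_mul, ← smul_eq_C_mul]
    exact Submodule.smul_mem _ _ (hx i)

lemma mem_LL {b : Module.Basis ι κ[X] A} {D : ℕ} {x : A} :
    x ∈ LL b D ↔ ∀ i, b.repr x i ∈ degreeLT κ D := Iff.rfl

lemma LL_mono (b : Module.Basis ι κ[X] A) {D E : ℕ} (h : D ≤ E) : LL b D ≤ LL b E :=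
  fun _ hx i => degreeLT_mono h (hx i)

lemma mul_mem_degreeLT {p q : κ[X]} {D E F : ℕ} (hp : p ∈ degreeLT κ D) (hq : q ∈ degreeLT κ E)
    (h : D + E ≤ F + 1) : p * q ∈ degreeLT κ F := by
  rw [mem_degreeLT] at *
  by_cases hp0 : p = 0
  · simp [hp0, WithBot.bot_lt_coe]
  by_cases hq0 : q = 0
  · simp [hq0, WithBot.bot_lt_coe]
  rw [degree_eq_natDegree hp0] at hp
  rw [degree_eq_natDegree hq0] at hq
  rw [degree_mul, degree_eq_natDegree hp0, degree_eq_natDegree hq0]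
  norm_cast at *
  omega

lemma smul_mem_LL (b : Module.Basis ι κ[X] A) {p : κ[X]} {x : A} {D E F : ℕ}
    (hp : p ∈ degreeLT κ D) (hx : x ∈ LL b E) (h : D + E ≤ F + 1) : p • x ∈ LL b F := by
  intro i
  simpa using mul_mem_degreeLT hp (hx i) h

lemma exists_LL (b : Module.Basis ι κ[X] A) {α : Type*} [Finite α] (f : α → A) :
    ∃ c, ∀ j, f j ∈ LL b c := by
  have := Fintype.ofFinite α
  refine ⟨∑ j, ∑ i, ((b.repr (f j) i).natDegree + 1), fun j i => ?_⟩
  rw [mem_degreeLT]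
  refine lt_of_le_of_lt degree_le_natDegree ?_
  norm_cast
  have h1 := Finset.single_le_sum (f := fun i => ((b.repr (f j) i).natDegree + 1)) (fun _ _ => Nat.zero_le _) (Finset.mem_univ i)
  have h2 := Finset.single_le_sum (f := fun j => ∑ i, ((b.repr (f j) i).natDegree + 1)) (fun _ _ => Nat.zero_le _) (Finset.mem_univ j)
  omega

/-- `c` is a good structure constant. -/
def GoodC (b : Module.Basis ι κ[X] A) (c : ℕ) : Prop := ∀ i j, b i * b j ∈ LL b c

lemma LL_mul (b : Module.Basis ι κ[X] A) {c D E : ℕ} (hc : GoodC b c) {x y : A}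
    (hx : x ∈ LL b D) (hy : y ∈ LL b E) : x * y ∈ LL b (D + E + c) := by
  rw [← b.sum_repr x, ← b.sum_repr y, Finset.sum_mul_sum]
  refine Submodule.sum_mem _ fun i _ => Submodule.sum_mem _ fun j _ => ?_
  rw [smul_mul_smul_comm]
  refine smul_mem_LL b (D := D + E) (mul_mem_degreeLT (hx i) (hy j) (by omega)) (hc i j) (by omega)

lemma LL_pow (b : Module.Basis ι κ[X] A) {c D : ℕ} (hc : GoodC b c) {x : A}
    (hx : x ∈ LL b D) (n : ℕ) : x ^ (n + 1) ∈ LL b ((n + 1) * (D + c)) := by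
  induction n with
  | zero => simpa using LL_mono b (by omega) hx
  | succ n ih =>
    rw [pow_succ]
    exact LL_mono b (by ring_nf; omega) (LL_mul b hc ih hx)

lemma b_mem_LL (b : Module.Basis ι κ[X] A) (i : ι) : b i ∈ LL b 1 := by
  intro j
  rw [mem_degreeLT, b.repr_self]
  rw [Finsupp.single_apply]
  split_ifs <;> simp

lemma natDegree_norm_le (b : Module.Basis ι κ[X] A) {c E : ℕ} (hc : GoodC b c) {h : A}
    (hh : h ∈ LL b E) : (Algebra.norm κ[X] h).natDegree ≤ Fintype.card ι * (E + c) := by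
  rw [Algebra.norm_eq_matrix_det b, Matrix.det_apply]
  refine natDegree_sum_le_of_forall_le _ _ fun σ _ => ?_
  refine (natDegree_smul_le _ _).trans ?_
  refine (natDegree_prod_le _ _).trans ?_
  rw [Fintype.card, ← smul_eq_mul]
  refine Finset.sum_le_card_nsmul _ _ _ fun i _ => ?_
  rw [Algebra.leftMulMatrix_eq_repr_mul]
  have := LL_mul b hc hh (b_mem_LL b i) (σ i)
  rw [mem_degreeLT] at this
  by_cases h0 : b.repr (h * b i) (σ i) = 0
  · simp [h0]
  · rw [degree_eq_natDegree h0] at this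
    norm_cast at this
    omega

lemma dvd_algebraMap_norm (b : Module.Basis ι κ[X] A) (h : A) :
    h ∣ algebraMap κ[X] A (Algebra.norm κ[X] h) := by
  have : Module.Free κ[X] A := Module.Free.of_basis b
  have : Module.Finite κ[X] A := Module.Finite.of_basis b
  rw [Algebra.norm_apply, LinearMap.det_eq_sign_charpoly_coeff, map_mul]
  refine Dvd.dvd.mul_left ?_ _
  have h1 := LinearMap.aeval_self_charpoly (Algebra.lmul κ[X] A h : A →ₗ[κ[X]] A)
  have h2 : aeval h (LinearMap.charpoly (Algebra.lmul κ[X] A h : A →ₗ[κ[X]] A)) = 0 := by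
    have h3 : aeval (Algebra.lmul κ[X] A h) (LinearMap.charpoly (Algebra.lmul κ[X] A h : A →ₗ[κ[X]] A)) = 0 := h1
    rw [aeval_algHom_apply] at h3
    exact (Algebra.lmul_injective (R := κ[X]) (A := A)) (by rw [h3, map_zero])
  rw [← divX_mul_X_add (LinearMap.charpoly (Algebra.lmul κ[X] A h : A →ₗ[κ[X]] A))] at h2
  simp only [map_add, map_mul, aeval_X, aeval_C] at h2
  exact ⟨_, (neg_eq_of_add_eq_zero_right h2).symm.trans (by rw [mul_comm, ← mul_neg])⟩

lemma finite_quot (b : Module.Basis ι κ[X] A) {h : A} (h0 : h ≠ 0) :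
    Module.Finite κ (A ⧸ Ideal.span ({h} : Set A)) := by
  have hI := Ideal.span_singleton_eq_bot.not.2 h0
  exact Module.Finite.equiv (Ideal.quotientEquivDirectSum κ b hI).symm

lemma zeros_le (b : Module.Basis ι κ[X] A) {c E : ℕ} (hc : GoodC b c) {h : A}
    (h0 : h ≠ 0) (hh : h ∈ LL b E) (Z : Finset (A →ₐ[κ] Ω)) (hZ : ∀ x ∈ Z, x h = 0) :
    Z.card ≤ Fintype.card ι * (E + c) := by
  refine le_trans ?_ (natDegree_norm_le b hc hh)
  rw [← finrank_quotient_span_eq_natDegree_norm b h0]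
  have := finite_quot b h0
  let I := Ideal.span ({h} : Set A)
  let f : Z → ((A ⧸ I) →ₗ[κ] Ω) := fun x => (Ideal.Quotient.liftₐ I x.1 (by
    intro a ha
    obtain ⟨z, rfl⟩ := Ideal.mem_span_singleton.1 ha
    rw [map_mul, hZ x.1 x.2, zero_mul])).toLinearMap
  have hli : LinearIndependent Ω f := by
    have h1 : LinearIndependent Ω (fun x : Z => (fun a : A => x.1 a)) := by
      have := linearIndependent_monoidHom A Ω
      exact this.comp (fun x : Z => (x.1 : A →* Ω)) (by
        intro x y hxy
        ext a
        exact DFunLike.congr_fun hxy a)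
    let g : ((A ⧸ I) →ₗ[κ] Ω) →ₗ[Ω] (A → Ω) :=
      { toFun := fun φ a => φ (Ideal.Quotient.mk I a)
        map_add' := fun _ _ => rfl
        map_smul' := fun _ _ => rfl }
    exact LinearIndependent.of_comp g h1
  have h2 := hli.fintype_card_le_finrank
  rw [Fintype.card_coe] at h2
  refine h2.trans ?_
  rw [Module.finrank_linearMap_self]

end Step
end S8

namespace S8

section Step2
variable {κ A Ω ι : Type*} [Field κ] [CommRing A] [IsDomain A] [Algebra κ[X] A] [Algebra κ A]
  [IsScalarTower κ κ[X] A] [Fintype ι] [Field Ω] [Algebra κ Ω]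

lemma norm_ne_zero' (b : Module.Basis ι κ[X] A) {h : A} (h0 : h ≠ 0) :
    Algebra.norm κ[X] h ≠ 0 := by
  have : Module.Free κ[X] A := Module.Free.of_basis b
  have : Module.Finite κ[X] A := Module.Finite.of_basis b
  exact Algebra.norm_ne_zero_iff.2 h0

lemma map_ne_zero' (b : Module.Basis ι κ[X] A) (j : A →ₐ[κ[X]] PowerSeries κ) {h : A}
    (h0 : h ≠ 0) : j h ≠ 0 := by
  intro h1
  have h2 := map_dvd j (dvd_algebraMap_norm b h)
  rw [h1, zero_dvd_iff, AlgHom.commutes] at h2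
  exact norm_ne_zero' b h0 (Polynomial.coe_eq_zero_iff.1 h2)

lemma not_pow_dvd (b : Module.Basis ι κ[X] A) (j : A →ₐ[κ[X]] PowerSeries κ) {c E n : ℕ}
    (hc : GoodC b c) {h : A} (h0 : h ≠ 0) (hh : h ∈ LL b E)
    (hn : Fintype.card ι * (E + c) < n) : ¬ (PowerSeries.X ^ n ∣ j h) := by
  intro hd
  have h2 := hd.trans (map_dvd j (dvd_algebraMap_norm b h))
  rw [AlgHom.commutes] at h2
  have h3 : (PowerSeries.X : PowerSeries κ) ^ n ∣ ((Algebra.norm κ[X] h : κ[X]) : PowerSeries κ) := h2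
  rw [PowerSeries.X_pow_dvd_iff] at h3
  refine norm_ne_zero' b h0 ?_
  ext m
  by_cases hm : m < n
  · simpa using h3 m hm
  · rw [coeff_zero]
    refine coeff_eq_zero_of_natDegree_lt ?_
    have := natDegree_norm_le b hc hh
    omega

/-- the standard basis vectors of `LL b D` -/
def vv (b : Module.Basis ι κ[X] A) (D : ℕ) (k : ι × Fin D) : A := (X ^ (k.2 : ℕ) : κ[X]) • b k.1

lemma vv_mem (b : Module.Basis ι κ[X] A) (D : ℕ) (k : ι × Fin D) : vv b D k ∈ LL b D := by
  refine smul_mem_LL b (D := D) (E := 1) ?_ (b_mem_LL b _) (by omega)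
  rw [mem_degreeLT, degree_X_pow]
  exact_mod_cast k.2.2

lemma vv_indep (b : Module.Basis ι κ[X] A) (D : ℕ) (w : ι × Fin D → κ)
    (h : ∑ k, w k • vv b D k = 0) : w = 0 := by
  have h1 : ∑ i, (∑ d : Fin D, C (w (i, d)) * X ^ (d : ℕ)) • b i = 0 := by
    rw [← h, Fintype.sum_prod_type]
    refine Finset.sum_congr rfl fun i _ => ?_
    rw [Finset.sum_smul]
    refine Finset.sum_congr rfl fun d _ => ?_
    rw [vv, mul_smul, ← algebraMap_smul κ[X] (w (i, d))]
    rfl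
  have h2 := Fintype.linearIndependent_iff.1 b.linearIndependent _ h1
  ext ⟨i, d⟩
  have h3 := congrArg (fun p => coeff p d) (h2 i)
  simp only [finset_sum_coeff, coeff_C_mul, coeff_X_pow, coeff_zero] at h3
  rw [Finset.sum_eq_single d] at h3
  · simpa using h3
  · intro d' _ hd
    rw [if_neg, mul_zero]
    intro h; exact hd (Fin.ext h.symm)
  · simp

lemma inj_core [CharP κ 2] (b : Module.Basis ι κ[X] A) (j : A →ₐ[κ[X]] PowerSeries κ) {c D μ : ℕ}
    (hc : GoodC b c) (hD : Fintype.card ι * (D + c) < 2 ^ μ) (z : ι × Fin D → A)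
    (hz : z ≠ 0) : ∑ k, vv b D k * z k ^ (2 ^ μ) ≠ 0 := by
  intro h0
  have : CharP (PowerSeries κ) 2 := charP_of_injective_algebraMap (algebraMap κ (PowerSeries κ)).injective 2
  have hex : ∃ n, ∃ k, PowerSeries.coeff n (j (z k)) ≠ 0 := by
    obtain ⟨k, hk⟩ := Function.ne_iff.1 hz
    by_contra! hcon
    refine map_ne_zero' b j hk ?_
    ext n
    simpa using hcon n k
  let n := Nat.find hex
  have hn : ∀ k, ∃ W, j (z k) = PowerSeries.X ^ n * W := by
    intro k
    have : PowerSeries.X ^ n ∣ j (z k) := by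
      rw [PowerSeries.X_pow_dvd_iff]
      intro m hm
      have := Nat.find_min hex hm
      push Not at this
      exact this k
    exact this
  choose W hW using hn
  have h1 : ∑ k, j (vv b D k) * W k ^ (2 ^ μ) = 0 := by
    have h2 := congrArg j h0
    rw [map_sum, map_zero] at h2
    have h3 : (PowerSeries.X ^ n) ^ (2 ^ μ) * ∑ k, j (vv b D k) * W k ^ (2 ^ μ) = 0 := by
      rw [← h2, Finset.mul_sum]
      refine Finset.sum_congr rfl fun k _ => ?_
      rw [map_mul, map_pow, hW, mul_pow]; ring
    exact (mul_eq_zero.1 h3).resolve_left (pow_ne_zero _ (pow_ne_zero _ PowerSeries.X_ne_zero))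
  let w : ι × Fin D → κ := fun k => (PowerSeries.constantCoeff (W k)) ^ (2 ^ μ)
  have hw : ∀ k, ∃ U, W k ^ (2 ^ μ) = PowerSeries.C (w k) + PowerSeries.X ^ (2 ^ μ) * U := by
    intro k
    have : PowerSeries.X ∣ W k - PowerSeries.C (PowerSeries.constantCoeff (W k)) := by
      rw [PowerSeries.X_dvd_iff]; simp
    obtain ⟨U, hU⟩ := this
    refine ⟨U ^ (2 ^ μ), ?_⟩
    rw [← mul_pow, ← hU, sub_pow_char_pow]
    simp [w]
  choose U hU using hw
  have hne : ∑ k, w k • vv b D k ≠ 0 := by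
    intro h
    have h5 := vv_indep b D w h
    obtain ⟨k, hk⟩ := Nat.find_spec hex
    apply hk
    have h6 := congrFun h5 k
    have h7 : PowerSeries.constantCoeff (W k) = 0 := by
      simpa [w] using h6
    change PowerSeries.coeff n (j (z k)) = 0
    rw [hW k]
    have := PowerSeries.coeff_X_pow_mul (W k) n 0
    rw [zero_add] at this
    rw [this, PowerSeries.coeff_zero_eq_constantCoeff_apply, h7]
  refine not_pow_dvd b j (n := 2 ^ μ) hc hne
    (Submodule.sum_mem _ fun k _ => Submodule.smul_mem _ _ (vv_mem b D k)) hD ?_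
  have h8 : j (∑ k, w k • vv b D k) = ∑ k, j (vv b D k) * PowerSeries.C (w k) := by
    rw [map_sum]
    refine Finset.sum_congr rfl fun k _ => ?_
    have : w k • vv b D k = (C (w k) : κ[X]) • vv b D k := by
      rw [← algebraMap_smul κ[X] (w k)]; rfl
    rw [this, map_smul, Algebra.smul_def, mul_comm]
    congr 1
    exact Polynomial.coe_C _
  rw [h8]
  have h9 : ∑ k, j (vv b D k) * PowerSeries.C (w k) =
      - (PowerSeries.X ^ (2 ^ μ) * ∑ k, j (vv b D k) * U k) := by
    rw [eq_neg_iff_add_eq_zero, ← h1, Finset.mul_sum, ← Finset.sum_add_distrib]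
    refine Finset.sum_congr rfl fun k _ => ?_
    rw [hU]; ring
  rw [h9]
  exact (Dvd.intro _ rfl).neg_right

/-- coordinates of `LL`. -/
def LLequiv (b : Module.Basis ι κ[X] A) (D : ℕ) : LL b D ≃ₗ[κ] (ι → degreeLT κ D) where
  toFun x i := ⟨b.repr x.1 i, x.2 i⟩
  invFun p := ⟨b.equivFun.symm (fun i => (p i).1), by
    intro i
    have := congrFun (b.equivFun.apply_symm_apply (fun i => (p i).1)) i
    rw [Module.Basis.equivFun_apply] at this
    rw [this]; exact (p i).2⟩
  left_inv x := by
    apply Subtype.ext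
    exact b.equivFun.symm_apply_apply x.1
  right_inv p := by
    ext1 i
    apply Subtype.ext
    exact congrFun (b.equivFun.apply_symm_apply (fun i => (p i).1)) i
  map_add' x y := by
    ext1 i; apply Subtype.ext; simp
  map_smul' c x := by
    ext1 i; apply Subtype.ext
    have h : c • x.1 = (C c : κ[X]) • x.1 := by
      rw [← algebraMap_smul κ[X] c x.1]; rfl
    simp [h, smul_eq_C_mul]

lemma finite_LL (b : Module.Basis ι κ[X] A) (D : ℕ) : Module.Finite κ (LL b D) := by
  have : Module.Finite κ (degreeLT κ D) := Module.Finite.equiv (degreeLTEquiv κ D).symm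
  exact Module.Finite.equiv (LLequiv b D).symm

lemma finrank_LL (b : Module.Basis ι κ[X] A) (D : ℕ) :
    Module.finrank κ (LL b D) = Fintype.card ι * D := by
  have : Module.Finite κ (degreeLT κ D) := Module.Finite.equiv (degreeLTEquiv κ D).symm
  rw [(LLequiv b D).finrank_eq, Module.finrank_pi_fintype]
  simp [(degreeLTEquiv κ D).finrank_eq]

theorem stepanov_core [CharP κ 2] (b : Module.Basis ι κ[X] A) (j : A →ₐ[κ[X]] PowerSeries κ)
    {c D I μ : ℕ} (σ : A ≃ₐ[κ[X]] A)
    (hc : GoodC b c) (hσ : ∀ i, σ.symm (b i) ∈ LL b c)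
    (hD : Fintype.card ι * (D + c) < 2 ^ μ)
    (hI : 2 ^ μ * (D + c) + I + c < Fintype.card ι * D * I)
    (Z : Finset (A →ₐ[κ] Ω)) (hZ : ∀ x ∈ Z, ∀ u, x (σ u) = x u ^ (2 ^ μ * 2 ^ μ)) :
    Z.card ≤ Fintype.card ι * (D + 2 ^ μ * (I + 2 * c) + 2 * c) := by
  have := finite_LL b I
  have := finite_LL b (2 ^ μ * (D + c) + I + c)
  have hPpos : 2 ^ μ = (2 ^ μ - 1) + 1 := by have := Nat.one_le_two_pow (n := μ); omega
  have hpow : ∀ {x : A} {E : ℕ}, x ∈ LL b E → x ^ (2 ^ μ) ∈ LL b (2 ^ μ * (E + c)) := by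
    intro x E hx
    rw [hPpos]; exact LL_pow b hc hx _
  let φ : ((ι × Fin D) → LL b I) →ₗ[κ] LL b (2 ^ μ * (D + c) + I + c) :=
    { toFun := fun u => ⟨∑ k, vv b D k ^ (2 ^ μ) * (u k).1,
        Submodule.sum_mem _ fun k _ => LL_mul b hc (hpow (vv_mem b D k)) (u k).2⟩
      map_add' := by
        intro u v; apply Subtype.ext; simp [mul_add, Finset.sum_add_distrib]
      map_smul' := by
        intro r u; apply Subtype.ext; simp [Finset.smul_sum] }
  have hker : ¬ Function.Injective φ := by
    intro hinj
    have h1 := LinearMap.finrank_le_finrank_of_injective hinj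
    rw [Module.finrank_pi_fintype, finrank_LL] at h1
    simp only [finrank_LL, Finset.sum_const, Finset.card_univ, Fintype.card_prod, Fintype.card_fin,
      smul_eq_mul] at h1
    have hr : 0 < Fintype.card ι := by
      rcases Nat.eq_zero_or_pos (Fintype.card ι) with h | h
      · rw [h] at hI; omega
      · exact h
    have h2 : Fintype.card ι * D * (Fintype.card ι * I) = Fintype.card ι * (Fintype.card ι * D * I) := by ring
    rw [h2] at h1
    exact absurd (Nat.le_of_mul_le_mul_left h1 hr) (by omega)
  obtain ⟨u, hu, hu0⟩ : ∃ u, φ u = 0 ∧ u ≠ 0 := by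
    by_contra! hcon
    exact hker ((injective_iff_map_eq_zero φ).2 hcon)
  have hu' : ∑ k, vv b D k ^ (2 ^ μ) * (u k).1 = 0 := congrArg Subtype.val hu
  let z : ι × Fin D → A := fun k => σ.symm (u k).1
  have hz : z ≠ 0 := by
    intro hz
    apply hu0
    ext1 k
    apply Subtype.ext
    have := congrFun hz k
    simpa [z] using this
  have hne := inj_core b j hc hD z hz
  have hmem : ∑ k, vv b D k * z k ^ (2 ^ μ) ∈ LL b (D + 2 ^ μ * (I + 2 * c) + c) := by
    refine Submodule.sum_mem _ fun k _ => ?_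
    have h1 : z k ∈ LL b (I + c) := by
      have : z k = ∑ i, b.repr (u k).1 i • σ.symm (b i) := by
        simp only [z]
        conv_lhs => rw [← b.sum_repr (u k).1]
        rw [map_sum]
        simp only [map_smul]
      rw [this]
      exact Submodule.sum_mem _ fun i _ => smul_mem_LL b ((u k).2 i) (hσ i) (by omega)
    have h2 := hpow h1
    rw [show I + c + c = I + 2 * c by ring] at h2
    exact LL_mul b hc (vv_mem b D k) h2
  have hcard := zeros_le b hc hne hmem Z (by
    intro x hx
    have hchar : CharP Ω 2 := charP_of_injective_algebraMap (algebraMap κ Ω).injective 2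
    have h1 : (x (∑ k, vv b D k * z k ^ (2 ^ μ))) ^ (2 ^ μ) = 0 := by
      rw [map_sum, sum_pow_char_pow]
      have h2 := congrArg x hu'
      rw [map_sum, map_zero] at h2
      rw [← h2]
      refine Finset.sum_congr rfl fun k _ => ?_
      have h3 := hZ x hx (z k)
      simp only [z, AlgEquiv.apply_symm_apply] at h3
      rw [map_mul, map_mul, map_pow, map_pow, mul_pow, ← pow_mul, h3]
    exact pow_eq_zero_iff (by positivity) |>.1 h1)
  refine hcard.trans (le_of_eq (by ring))

end Step2
end S8

namespace S8

section Step3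
variable {κ A Ω ι : Type*} [Field κ] [CommRing A] [IsDomain A] [Algebra κ[X] A] [Algebra κ A]
  [IsScalarTower κ κ[X] A] [Fintype ι] [Field Ω] [Algebra κ Ω]

theorem stepanov [CharP κ 2] (b : Module.Basis ι κ[X] A) (j : A →ₐ[κ[X]] PowerSeries κ)
    (σ : A ≃ₐ[κ[X]] A) : ∃ K μ₀ : ℕ, ∀ μ, μ₀ ≤ μ → 
    ∀ (Z : Finset (A →ₐ[κ] Ω)), (∀ x ∈ Z, ∀ u, x (σ u) = x u ^ (2 ^ μ * 2 ^ μ)) →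
    Z.card ≤ 2 ^ μ * 2 ^ μ + K * 2 ^ μ := by
  obtain ⟨c1, hc1⟩ := exists_LL b (fun p : ι × ι => b p.1 * b p.2)
  obtain ⟨c2, hc2⟩ := exists_LL b (fun i => σ.symm (b i))
  obtain ⟨c, hc⟩ : ∃ c, c = c1 + c2 := ⟨_, rfl⟩
  have hg : GoodC b c := fun i j => LL_mono b (by omega) (hc1 (i, j))
  have hs : ∀ i, σ.symm (b i) ∈ LL b c := fun i => LL_mono b (by omega) (hc2 i)
  have hr : 0 < Fintype.card ι := by
    have : Nonempty ι := by
      by_contra h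
      rw [not_nonempty_iff] at h
      have := b.repr.toEquiv.subsingleton
      exact not_subsingleton A this
    exact Fintype.card_pos
  obtain ⟨r, hrr⟩ : ∃ r, r = Fintype.card ι := ⟨_, rfl⟩
  rw [← hrr] at hr
  refine ⟨1 + r * (2 * c + 5) + 4 * c * r, 2 * (r + r * c) + 3 * c + 6, fun μ hμ Z hZ => ?_⟩
  obtain ⟨P, hP⟩ : ∃ P, P = 2 ^ μ := ⟨_, rfl⟩
  have hPl : 2 * (r + r * c) + 3 * c + 6 ≤ P := by
    rw [hP]; exact hμ.trans Nat.lt_two_pow_self.le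
  obtain ⟨a, ha⟩ : ∃ a, a = (P - 1) / r := ⟨_, rfl⟩
  have ha1 : r * a ≤ P - 1 := by rw [ha]; exact Nat.mul_div_le _ _
  have ha2 : P ≤ r * a + r := by
    have := Nat.lt_mul_div_succ (P - 1) hr
    rw [← ha] at this
    rw [mul_add, mul_one] at this
    omega
  obtain ⟨q, hq⟩ : ∃ q, q = P / r := ⟨_, rfl⟩
  have hq1 : r * q ≤ P := by rw [hq]; exact Nat.mul_div_le _ _
  have hq2 : P < r * q + r := by
    have := Nat.lt_mul_div_succ P hr
    rw [← hq] at this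
    rwa [mul_add, mul_one] at this
  have hca : c ≤ a := by
    by_contra hcon
    have : r * a ≤ r * c := Nat.mul_le_mul_left _ (by omega)
    omega
  obtain ⟨D, rfl⟩ := Nat.exists_eq_add_of_le' hca
  have hqP : q ≤ P := le_trans (Nat.le_mul_of_pos_left _ hr) hq1
  have h1 := stepanov_core (Ω := Ω) b j (c := c) (D := D) (I := q + (2 * c + 5)) (μ := μ) σ hg hs
    (by rw [← hrr, ← hP]; omega) (by
      rw [← hrr, ← hP]
      have e1 : D * P + D * r * (2 * c + 4) ≤ r * D * (q + (2 * c + 5)) := by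
        have : D * P ≤ D * (r * q + r) := Nat.mul_le_mul_left _ hq2.le
        nlinarith
      have e2 : P ≤ 2 * (D * r) := by nlinarith
      have e3 : P * (c + 2) ≤ D * r * (2 * c + 4) := by nlinarith
      nlinarith) Z (by rw [← hP]; rw [← hP] at hZ; exact hZ)
  refine h1.trans ?_
  rw [← hrr, ← hP]
  have e1 : r * D ≤ P := by
    have : r * D ≤ r * (D + c) := Nat.mul_le_mul_left _ (by omega)
    omega
  have e2 : P * (r * q) ≤ P * P := Nat.mul_le_mul_left _ hq1
  have e3 : 2 * c * r ≤ 2 * c * r * P := Nat.le_mul_of_pos_right _ (by omega)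
  nlinarith

end Step3
end S8

namespace S8

section PS
variable {κ ι : Type*} [Field κ] [Fintype ι] [CharP κ 2]

lemma exists_ps_solution (M : Matrix ι ι κ[X]) (hM : M.map (eval 0) = 1) (E : ℕ) (hE : 1 ≤ E)
    (v : ι → κ) (hv : ∀ i, v i ^ (2 ^ E) = v i) :
    ∃ y : ι → PowerSeries κ, (∀ i, y i ^ (2 ^ E) = ∑ j, (M i j) • y j) ∧
      ∀ i, PowerSeries.constantCoeff (y i) = v i := by
  have : CharP (PowerSeries κ) 2 := charP_of_injective_algebraMap (algebraMap κ (PowerSeries κ)).injective 2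
  let Mp : Matrix ι ι (PowerSeries κ) := M.map (fun p => (p : PowerSeries κ))
  have hMc : Mp.map (PowerSeries.constantCoeff (R := κ)) = 1 := by
    rw [← hM]
    ext i j
    simp [Mp, Polynomial.coeff_zero_eq_eval_zero]
  have hdet : IsUnit Mp.det := by
    rw [PowerSeries.isUnit_iff_constantCoeff, RingHom.map_det]
    have : (PowerSeries.constantCoeff (R := κ)).mapMatrix Mp = 1 := hMc
    rw [this]; simp
  let N := Mp⁻¹
  have hMN : Mp * N = 1 := Matrix.mul_nonsing_inv _ hdet
  have hNM : N * Mp = 1 := Matrix.nonsing_inv_mul _ hdet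
  let Y : ℕ → ι → PowerSeries κ := fun n => Nat.rec (fun i => PowerSeries.C (v i))
    (fun _ Y => N.mulVec (fun i => Y i ^ (2 ^ E))) n
  have hY0 : ∀ i, Y 0 i = PowerSeries.C (v i) := fun _ => rfl
  have hY1 : ∀ n, Y (n + 1) = N.mulVec (fun i => Y n i ^ (2 ^ E)) := fun _ => rfl
  have hq2 : 2 ≤ 2 ^ E := by
    calc 2 = 2 ^ 1 := by norm_num
      _ ≤ 2 ^ E := Nat.pow_le_pow_right (by norm_num) hE
  have hMY : ∀ n, Mp.mulVec (Y (n + 1)) = fun i => Y n i ^ (2 ^ E) := by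
    intro n
    rw [hY1, Matrix.mulVec_mulVec, hMN, Matrix.one_mulVec]
  have hc1 : ∀ i, PowerSeries.constantCoeff (Y 1 i) = v i := by
    intro i
    have h1 := congrArg PowerSeries.constantCoeff (congrFun (hMY 0) i)
    rw [Matrix.mulVec, dotProduct, map_sum] at h1
    have h2 : ∀ j, PowerSeries.constantCoeff (Mp i j) = (1 : Matrix ι ι κ) i j := by
      intro j; rw [← hMc]; rfl
    simp only [map_mul, h2, Matrix.one_apply, ite_mul, one_mul, zero_mul, Finset.sum_ite_eq,
      Finset.mem_univ, if_true] at h1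
    have h1' : PowerSeries.constantCoeff (Y 1 i) = _ := h1
    rw [h1', hY0]; simp [hv]
  have hdiff : ∀ n i, PowerSeries.X ^ (n + 1) ∣ Y (n + 1) i - Y n i := by
    intro n
    induction n with
    | zero =>
      intro i
      rw [zero_add, pow_one, PowerSeries.X_dvd_iff, map_sub, hc1, hY0]; simp
    | succ n ih =>
      intro i
      have : Y (n + 1 + 1) i - Y (n + 1) i = ∑ j, N i j * (Y (n + 1) j - Y n j) ^ (2 ^ E) := by
        rw [hY1 (n + 1)]
        conv_lhs => rw [hY1 n]
        simp only [Matrix.mulVec, dotProduct]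
        rw [← Finset.sum_sub_distrib]
        refine Finset.sum_congr rfl fun j _ => ?_
        rw [sub_pow_char_pow, mul_sub]
        rfl
      rw [this]
      refine Finset.dvd_sum fun j _ => Dvd.dvd.mul_left ?_ _
      refine (pow_dvd_pow PowerSeries.X ?_).trans (by
        have := pow_dvd_pow_of_dvd (ih j) (2 ^ E)
        rwa [← pow_mul] at this)
      nlinarith
  have hst : ∀ n m i, n ≤ m → PowerSeries.coeff n (Y m i) = PowerSeries.coeff n (Y n i) := by
    intro n m i h
    induction m, h using Nat.le_induction with
    | base => rfl
    | succ m hm ih =>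
      rw [← ih]
      have := PowerSeries.X_pow_dvd_iff.1 (hdiff m i) n (by omega)
      rw [map_sub, sub_eq_zero] at this
      exact this
  let y : ι → PowerSeries κ := fun i => PowerSeries.mk (fun n => PowerSeries.coeff n (Y n i))
  have hy : ∀ n i, PowerSeries.X ^ (n + 1) ∣ y i - Y n i := by
    intro n i
    rw [PowerSeries.X_pow_dvd_iff]
    intro m hm
    rw [map_sub, PowerSeries.coeff_mk, hst m n i (by omega), sub_self]
  refine ⟨y, fun i => ?_, fun i => ?_⟩
  · rw [← sub_eq_zero]
    ext n
    have h1 : PowerSeries.X ^ (n + 1) ∣ y i ^ (2 ^ E) - ∑ j, (M i j) • y j := by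
      have e1 : y i ^ (2 ^ E) - ∑ j, (M i j) • y j =
          (y i - Y n i) ^ (2 ^ E) - ∑ j, Mp i j * (y j - Y (n + 1) j) := by
        rw [sub_pow_char_pow]
        have := congrFun (hMY n) i
        simp only [← this, Matrix.mulVec, dotProduct]
        simp only [mul_sub, Finset.sum_sub_distrib]
        have : ∀ j, M i j • y j = Mp i j * y j := fun j => by
          rw [Algebra.smul_def]; rfl
        simp only [this]
        ring
      rw [e1]
      refine dvd_sub ((hy n i).trans (dvd_pow_self _ (by positivity)))
        (Finset.dvd_sum fun j _ => Dvd.dvd.mul_left ?_ _)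
      exact (pow_dvd_pow _ (by omega)).trans (hy (n + 1) j)
    exact PowerSeries.X_pow_dvd_iff.1 h1 n (by omega)
  · have : PowerSeries.constantCoeff (y i) = PowerSeries.coeff 0 (Y 0 i) := by
      rw [← PowerSeries.coeff_zero_eq_constantCoeff_apply, PowerSeries.coeff_mk]
    rw [this, hY0]; simp

end PS

section Fin
variable {R S ι : Type*} [CommRing R] [CommRing S] [Algebra R S] [Fintype ι]

lemma finite_adjoin (y : ι → S) (q : ℕ) (hq : 2 ≤ q) (M : Matrix ι ι R)
    (hy : ∀ i, y i ^ q = ∑ j, M i j • y j) :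
    Module.Finite R (Algebra.adjoin R (Set.range y)) := by
  let m : (ι → Fin q) → S := fun e => ∏ i, y i ^ (e i : ℕ)
  let N : Submodule R S := Submodule.span R (Set.range m)
  have hmon : ∀ d, ∀ e : ι → ℕ, ∑ i, e i = d → ∏ i, y i ^ e i ∈ N := by
    intro d
    induction d using Nat.strong_induction_on with
    | _ d ih =>
      intro e he
      by_cases hlt : ∀ i, e i < q
      · exact Submodule.subset_span ⟨fun i => ⟨e i, hlt i⟩, rfl⟩
      · push Not at hlt
        obtain ⟨i, hi⟩ := hlt
        have h1 : ∏ k, y k ^ e k = ∑ j, M i j • ∏ k, y k ^ ((Function.update e i (e i - q)) k + (if k = j then 1 else 0)) := by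
          have h2 : ∀ j, ∏ k, y k ^ ((Function.update e i (e i - q)) k + (if k = j then 1 else 0)) =
              (∏ k, y k ^ (Function.update e i (e i - q)) k) * y j := by
            intro j
            simp only [pow_add, Finset.prod_mul_distrib]
            congr 1
            simp [Finset.prod_pow_eq_pow_sum]
          simp only [h2]
          simp only [← mul_smul_comm]
          rw [← Finset.mul_sum, ← hy]
          rw [← Finset.mul_prod_erase _ _ (Finset.mem_univ i), ← Finset.mul_prod_erase _ (fun k => y k ^ (Function.update e i (e i - q)) k) (Finset.mem_univ i)]
          rw [Function.update_self]
          have h3 : ∏ k ∈ Finset.univ.erase i, y k ^ (Function.update e i (e i - q)) k = ∏ k ∈ Finset.univ.erase i, y k ^ e k := by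
            refine Finset.prod_congr rfl fun k hk => ?_
            rw [Function.update_of_ne (Finset.ne_of_mem_erase hk)]
          rw [h3]
          conv_lhs => rw [show e i = (e i - q) + q by omega, pow_add]
          ring
        rw [h1]
        refine Submodule.sum_mem _ fun j _ => Submodule.smul_mem _ _ (ih _ ?_ _ rfl)
        rw [← he, Finset.sum_add_distrib]
        rw [← Finset.add_sum_erase _ e (Finset.mem_univ i), ← Finset.add_sum_erase _ (Function.update e i (e i - q)) (Finset.mem_univ i)]
        rw [Function.update_self]
        have h3 : ∑ k ∈ Finset.univ.erase i, (Function.update e i (e i - q)) k = ∑ k ∈ Finset.univ.erase i, e k := by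
            refine Finset.sum_congr rfl fun k hk => ?_
            rw [Function.update_of_ne (Finset.ne_of_mem_erase hk)]
        rw [h3]
        simp
        omega
  have hle : Subalgebra.toSubmodule (Algebra.adjoin R (Set.range y)) = N := by
    apply le_antisymm
    · rw [Algebra.adjoin_eq_span]
      refine Submodule.span_le.2 fun z hz => ?_
      have : ∃ e : ι → ℕ, z = ∏ i, y i ^ e i := by
        induction hz using Submonoid.closure_induction with
        | mem x hx =>
          obtain ⟨i, rfl⟩ := hx
          refine ⟨fun k => if k = i then 1 else 0, ?_⟩
          simp [Finset.prod_pow_eq_pow_sum]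
        | one => exact ⟨0, by simp⟩
        | mul a b _ _ ha hb =>
          obtain ⟨e, rfl⟩ := ha
          obtain ⟨f, rfl⟩ := hb
          exact ⟨e + f, by simp [pow_add, Finset.prod_mul_distrib]⟩
      obtain ⟨e, rfl⟩ := this
      exact hmon _ e rfl
    · refine Submodule.span_le.2 ?_
      rintro _ ⟨e, rfl⟩
      exact Subalgebra.prod_mem _ fun i _ => Subalgebra.pow_mem _ (Algebra.subset_adjoin (Set.mem_range_self i)) _
  have hfg : (Subalgebra.toSubmodule (Algebra.adjoin R (Set.range y))).FG := by
    rw [hle]; exact Submodule.fg_span (Set.finite_range m)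
  exact Module.Finite.iff_fg.2 hfg

end Fin
end S8

namespace S8

section Point
variable {κ A Ω ι : Type*} [Field κ] [CommRing A] [Nontrivial A] [Algebra κ[X] A] [Algebra κ A]
  [IsScalarTower κ κ[X] A] [Fintype ι] [Field Ω] [IsAlgClosed Ω] [Algebra κ Ω]

lemma exists_point (b : Module.Basis ι κ[X] A) (t : Ω) :
    ∃ x : A →ₐ[κ] Ω, x (algebraMap κ[X] A X) = t := by
  letI : Algebra κ[X] Ω := (aeval t : κ[X] →ₐ[κ] Ω).toRingHom.toAlgebra
  have hmap : ∀ p : κ[X], algebraMap κ[X] Ω p = aeval t p := fun _ => rfl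
  have hne : Nonempty ι := b.index_nonempty
  let B := TensorProduct κ[X] Ω A
  let bB : Module.Basis ι Ω B := Algebra.TensorProduct.basis Ω b
  haveI : Nontrivial B := bB.repr.toEquiv.nontrivial
  haveI : Module.Finite Ω B := Module.Finite.of_basis bB
  obtain ⟨I, hI⟩ := Ideal.exists_maximal B
  letI : Field (B ⧸ I) := Ideal.Quotient.field I
  haveI : Algebra.IsAlgebraic Ω (B ⧸ I) := inferInstance
  let ψ : (B ⧸ I) →ₐ[Ω] Ω := IsAlgClosed.lift
  let x0 : A →+* Ω := (ψ.toRingHom.comp (Ideal.Quotient.mk I)).comp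
    (Algebra.TensorProduct.includeRight : A →ₐ[κ[X]] B).toRingHom
  have h0 : ∀ p : κ[X], x0 (algebraMap κ[X] A p) = aeval t p := by
    intro p
    have : (Algebra.TensorProduct.includeRight : A →ₐ[κ[X]] B) (algebraMap κ[X] A p) =
        algebraMap Ω B (aeval t p) := by
      rw [AlgHom.commutes, IsScalarTower.algebraMap_apply κ[X] Ω B]; rfl
    change ψ (Ideal.Quotient.mk I ((Algebra.TensorProduct.includeRight : A →ₐ[κ[X]] B) (algebraMap κ[X] A p))) = _
    rw [this]
    exact ψ.commutes (aeval t p)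
  refine ⟨{ x0 with commutes' := ?_ }, ?_⟩
  · intro r
    have := h0 (algebraMap κ κ[X] r)
    rw [← IsScalarTower.algebraMap_apply] at this
    refine this.trans ?_
    simp
  · have := h0 X
    simpa using this

end Point
end S8

namespace S8

section Tw
variable {R ι : Type*} [CommRing R] [Algebra F2 R] [Fintype ι] (bR : Module.Basis ι F2 R)

def BS (S : Type*) [CommRing S] [Algebra F2 S] : R →+* Matrix ι ι S :=
  ((algebraMap F2 S).mapMatrix).comp (Algebra.leftMulMatrix bR).toRingHom

lemma BS_map {S T : Type*} [CommRing S] [Algebra F2 S] [CommRing T] [Algebra F2 T]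
    (f : S →+* T) (r : R) : (BS bR S r).map f = BS bR T r := by
  have h : f.comp (algebraMap F2 S) = algebraMap F2 T := Subsingleton.elim _ _
  ext i j
  simp only [BS, RingHom.comp_apply, RingHom.mapMatrix_apply, Matrix.map_apply]
  rw [← h]; rfl

lemma BS_one_mulVec (S : Type*) [CommRing S] [Algebra F2 S] (r : R) (i : ι) :
    ((BS bR S r).mulVec (fun i => algebraMap F2 S (bR.repr 1 i))) i =
      algebraMap F2 S (bR.repr r i) := by
  have h := Algebra.leftMulMatrix_mulVec_repr bR r 1
  rw [mul_one] at h
  have h2 := congrFun h i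
  rw [← h2]
  simp only [BS, RingHom.comp_apply, RingHom.mapMatrix_apply, Matrix.mulVec, dotProduct, map_sum,
    map_mul]
  rfl

variable (c0 c1 : R)

def NM (S : Type*) [CommRing S] [Algebra F2 S] (a : S) : ℕ → Matrix ι ι S
  | 0 => 1
  | k + 1 => (BS bR S c0 + a ^ (2 ^ k) • BS bR S c1) * NM S a k

lemma NM_map {S T : Type*} [CommRing S] [Algebra F2 S] [CommRing T] [Algebra F2 T]
    (f : S →+* T) (a : S) (k : ℕ) : (NM bR c0 c1 S a k).map f = NM bR c0 c1 T (f a) k := by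
  induction k with
  | zero => simp [NM]
  | succ k ih =>
    rw [NM, NM, Matrix.map_mul, ih, ← BS_map bR f c0, ← BS_map bR f c1]
    congr 1
    ext i j
    simp

lemma NM_commute {S : Type*} [CommRing S] [Algebra F2 S] (a : S) (k : ℕ) (g : R) :
    BS bR S g * NM bR c0 c1 S a k = NM bR c0 c1 S a k * BS bR S g := by
  induction k with
  | zero => simp [NM]
  | succ k ih =>
    rw [NM, mul_assoc, ← ih, ← mul_assoc, ← mul_assoc]
    congr 1
    rw [mul_add, add_mul, ← map_mul, ← map_mul, mul_comm g c0, mul_smul_comm, smul_mul_assoc,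
      ← map_mul, ← map_mul, mul_comm g c1]

lemma NM_add {S : Type*} [CommRing S] [Algebra F2 S] (a : S) (j k : ℕ) :
    NM bR c0 c1 S a (j + k) = NM bR c0 c1 S (a ^ (2 ^ j)) k * NM bR c0 c1 S a j := by
  induction k with
  | zero => simp [NM]
  | succ k ih =>
    rw [← add_assoc, NM, ih, NM, mul_assoc, ← pow_mul, ← pow_add]

lemma NM_mul {S : Type*} [CommRing S] [Algebra F2 S] (a : S) (d : ℕ) (g : R)
    (ha : a ^ (2 ^ d) = a) (hg : NM bR c0 c1 S a d = BS bR S g) (n : ℕ) :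
    NM bR c0 c1 S a (d * n) = BS bR S (g ^ n) := by
  induction n with
  | zero => simp [NM]
  | succ n ih =>
    rw [Nat.mul_succ, add_comm, NM_add, ha, ih, hg, ← map_mul, pow_succ]

lemma pow_iter {S : Type*} [CommRing S] (a : S) (q : ℕ) (ha : a ^ q = a) (n : ℕ) :
    a ^ (q ^ n) = a := by
  induction n with
  | zero => simp
  | succ n ih => rw [pow_succ, pow_mul, ih, ha]

/-- Frobenius iterates on solutions. -/
lemma frob_iter {S : Type*} [CommRing S] [Algebra F2 S] [CharP S 2] (a : S) (z : ι → S) (E : ℕ)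
    (hz : ∀ i, z i ^ (2 ^ E) = ((NM bR c0 c1 S a E).mulVec z) i) (n : ℕ) :
    ∀ i, z i ^ (2 ^ (E * n)) = ((NM bR c0 c1 S a (E * n)).mulVec z) i := by
  induction n with
  | zero => intro i; simp [NM]
  | succ n ih =>
    intro i
    rw [Nat.mul_succ, pow_add, pow_mul, ih i, Nat.add_comm (E * n) E, NM_add]
    rw [← Matrix.mulVec_mulVec]
    have h1 : (NM bR c0 c1 S a E).mulVec z = fun i => z i ^ (2 ^ E) := by
      ext i; exact (hz i).symm
    rw [h1]
    have h2 : NM bR c0 c1 S (a ^ 2 ^ E) (E * n) =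
        (NM bR c0 c1 S a (E * n)).map (iterateFrobenius S 2 E) := by
      rw [NM_map]; simp [iterateFrobenius_def]
    rw [h2]
    simp only [Matrix.mulVec, dotProduct]
    rw [← iterateFrobenius_def, map_sum]
    simp [iterateFrobenius_def, mul_pow]

end Tw
end S8

namespace S8

section Tw
variable {R ι : Type*} [CommRing R] [Algebra F2 R] [Fintype ι] (bR : Module.Basis ι F2 R)
variable (c0 c1 : R)
variable {κ A Ω : Type*} [Field κ] [CommRing A] [Algebra κ[X] A] [Algebra κ A]
  [IsScalarTower κ κ[X] A] [Algebra F2 κ] [Algebra F2 A] [Field Ω] [IsAlgClosed Ω] [Algebra κ Ω]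
  [Algebra F2 Ω]

/-- translated vector -/
def gy (y : ι → A) (g : R) : ι → A := (BS bR A g).mulVec y

lemma gy_one (y : ι → A) : gy bR y (1 : R) = y := by simp [gy]
lemma gy_mul (y : ι → A) (g h : R) : gy bR (gy bR y g) h = gy bR y (g * h) := by
  rw [gy, gy, gy, Matrix.mulVec_mulVec, ← map_mul, mul_comm]
lemma map_gy {T : Type*} [CommRing T] [Algebra F2 T] (f : A →+* T) (y : ι → A) (g : R) (i : ι) :
    f (gy bR y g i) = gy bR (fun i => f (y i)) g i := by
  simp only [gy, Matrix.mulVec, dotProduct, map_sum, map_mul]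
  refine Finset.sum_congr rfl fun j _ => ?_
  rw [← BS_map bR f g]; rfl

/-- the group of symmetries -/
def HH (y : ι → A) : Subgroup Rˣ where
  carrier := {g | ∃ σ : A ≃ₐ[κ[X]] A, ∀ i, σ (y i) = gy bR y (g : R) i}
  one_mem' := ⟨AlgEquiv.refl, fun i => by simp [gy_one]⟩
  mul_mem' := by
    rintro g h ⟨σ, hσ⟩ ⟨τ, hτ⟩
    refine ⟨τ.trans σ, fun i => ?_⟩
    rw [AlgEquiv.trans_apply, hτ]
    have := map_gy bR (σ : A →+* A) y (h : R) i
    refine this.trans ?_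
    have e : (fun i => (σ : A →+* A) (y i)) = gy bR y (g : R) := funext hσ
    rw [e, gy_mul]; rfl
  inv_mem' := by
    rintro g ⟨σ, hσ⟩
    refine ⟨σ.symm, fun i => ?_⟩
    rw [AlgEquiv.symm_apply_eq]
    have := map_gy bR (σ : A →+* A) y ((g⁻¹ : Rˣ) : R) i
    refine Eq.trans ?_ this.symm
    have e : (fun i => (σ : A →+* A) (y i)) = gy bR y (g : R) := funext hσ
    rw [e, gy_mul]; simp [gy_one]

variable (y : ι → A)

/-- twisted points -/
def IsTw (x : A →ₐ[κ] Ω) (k : ℕ) (g : R) : Prop :=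
  x (algebraMap κ[X] A X) ^ (2 ^ k) = x (algebraMap κ[X] A X) ∧
  (∀ c : κ, c ^ (2 ^ k) = c) ∧ ∀ i, x (y i) ^ (2 ^ k) = x (gy bR y g i)

lemma tw_all [CharP Ω 2] {x : A →ₐ[κ] Ω} {k : ℕ} {g : R} (h : IsTw bR y x k g)
    (p : MvPolynomial ι κ[X]) :
    x (MvPolynomial.aeval (gy bR y g) p) = (x (MvPolynomial.aeval y p)) ^ (2 ^ k) := by
  obtain ⟨h1, h2, h3⟩ := h
  have key : (x : A →+* Ω).comp (MvPolynomial.aeval (R := κ[X]) (gy bR y g)).toRingHom =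
      ((iterateFrobenius Ω 2 k).comp (x : A →+* Ω)).comp (MvPolynomial.aeval (R := κ[X]) y).toRingHom := by
    apply MvPolynomial.ringHom_ext
    · intro r
      simp only [RingHom.comp_apply, AlgHom.toRingHom_eq_coe, RingHom.coe_coe, MvPolynomial.aeval_C,
        iterateFrobenius_def]
      have : (x : A →+* Ω).comp (algebraMap κ[X] A) =
          ((iterateFrobenius Ω 2 k).comp (x : A →+* Ω)).comp (algebraMap κ[X] A) := by
        apply Polynomial.ringHom_ext
        · intro c
          simp only [RingHom.comp_apply, RingHom.coe_coe, iterateFrobenius_def]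
          rw [← map_pow, ← map_pow, ← C_pow, h2]
        · simp only [RingHom.comp_apply, RingHom.coe_coe, iterateFrobenius_def]
          exact h1.symm
      have := RingHom.congr_fun this r
      simpa [iterateFrobenius_def] using this
    · intro i
      simp [iterateFrobenius_def, h3]
  have := RingHom.congr_fun key p
  simpa [iterateFrobenius_def] using this

lemma tw_sigma [CharP Ω 2] {x : A →ₐ[κ] Ω} {k : ℕ} {g : R} (h : IsTw bR y x k g)
    (hy : Algebra.adjoin κ[X] (Set.range y) = ⊤)
    (σ : A ≃ₐ[κ[X]] A) (hσ : ∀ i, σ (y i) = gy bR y g i) (u : A) :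
    x (σ u) = x u ^ (2 ^ k) := by
  have hu : u ∈ Algebra.adjoin κ[X] (Set.range y) := by rw [hy]; trivial
  rw [Algebra.adjoin_range_eq_range_aeval] at hu
  obtain ⟨p, rfl⟩ := hu
  change x (σ (MvPolynomial.aeval y p)) = x (MvPolynomial.aeval y p) ^ (2 ^ k)
  rw [← tw_all bR y h p]
  congr 1
  have e : ((σ : A →ₐ[κ[X]] A).comp (MvPolynomial.aeval y)) = MvPolynomial.aeval (gy bR y g) := by
    apply MvPolynomial.algHom_ext
    intro i
    simp [hσ]
  exact AlgHom.congr_fun e p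

lemma tw_notmem [CharP Ω 2] [IsNoetherianRing A] [Module.Finite κ[X] A] (hy : Algebra.adjoin κ[X] (Set.range y) = ⊤) (g : Rˣ)
    (hg : g ∉ HH (κ := κ) bR y) :
    ∃ u : A, u ≠ 0 ∧ ∀ (x : A →ₐ[κ] Ω) (k : ℕ), IsTw bR y x k (g : R) → x u = 0 := by
  by_contra hcon
  push Not at hcon
  apply hg
  have hker : ∀ p : MvPolynomial ι κ[X], MvPolynomial.aeval y p = 0 →
      MvPolynomial.aeval (gy bR y (g : R)) p = 0 := by
    intro p hp
    by_contra hne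
    obtain ⟨x, k, hx, hxu⟩ := hcon _ hne
    apply hxu
    rw [tw_all bR y hx, hp, map_zero, zero_pow (by positivity)]
  have hsurj : Function.Surjective (MvPolynomial.aeval y : MvPolynomial ι κ[X] →ₐ[κ[X]] A) := by
    rw [← AlgHom.range_eq_top, ← Algebra.adjoin_range_eq_range_aeval, hy]
  let σ0 : A →ₐ[κ[X]] A := AlgHom.liftOfSurjective (R := κ[X])
    (MvPolynomial.aeval y : MvPolynomial ι κ[X] →ₐ[κ[X]] A) hsurj
    (MvPolynomial.aeval (gy bR y (g : R))) (fun p hp => hker p hp)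
  have hσ0 : ∀ p : MvPolynomial ι κ[X], σ0 (MvPolynomial.aeval y p) = MvPolynomial.aeval (gy bR y (g : R)) p := by
    intro p
    exact AlgHom.liftOfSurjective_apply (R := κ[X]) _ _ _ _ _
  have hσy : ∀ i, σ0 (y i) = gy bR y (g : R) i := by
    intro i
    have := hσ0 (MvPolynomial.X i)
    simpa using this
  have hs : Function.Surjective σ0 := by
    rw [← AlgHom.range_eq_top, eq_top_iff, ← hy, Algebra.adjoin_le_iff]
    rintro _ ⟨i, rfl⟩
    refine ⟨gy bR y ((g⁻¹ : Rˣ) : R) i, ?_⟩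
    have := map_gy bR (σ0 : A →+* A) y ((g⁻¹ : Rˣ) : R) i
    refine this.trans ?_
    have e : (fun i => (σ0 : A →+* A) (y i)) = gy bR y (g : R) := funext hσy
    rw [e, gy_mul]; simp [gy_one]
  have hi : Function.Injective σ0 :=
    IsNoetherian.injective_of_surjective_endomorphism (R := κ[X]) σ0.toLinearMap hs
  exact ⟨AlgEquiv.ofBijective σ0 ⟨hi, hs⟩, fun i => hσy i⟩

end Tw
end S8

namespace S8

section Ek
variable (Ω : Type*) [Field Ω] [IsAlgClosed Ω] [CharP Ω 2]

def Ek (k : ℕ) : Finset Ω := (X ^ (2 ^ k) - X : Polynomial Ω).roots.toFinset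

variable {Ω}
lemma mem_Ek {k : ℕ} (hk : 1 ≤ k) (a : Ω) : a ∈ Ek Ω k ↔ a ^ (2 ^ k) = a := by
  have h2 : 1 < 2 ^ k := Nat.one_lt_two_pow (by omega)
  have : (X ^ (2 ^ k) - X : Polynomial Ω) ≠ 0 := FiniteField.X_pow_card_sub_X_ne_zero Ω h2
  simp [Ek, mem_roots this, sub_eq_zero]

lemma card_Ek {k : ℕ} (hk : 1 ≤ k) : (Ek Ω k).card = 2 ^ k := by
  have h2 : 1 < 2 ^ k := Nat.one_lt_two_pow (by omega)
  have hsep : (X ^ (2 ^ k) - X : Polynomial Ω).Separable :=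
    galois_poly_separable 2 (2 ^ k) (dvd_pow_self _ (by omega))
  rw [Ek, Multiset.toFinset_card_of_nodup (nodup_roots hsep)]
  rw [← (IsAlgClosed.splits (X ^ (2 ^ k) - X : Polynomial Ω)).natDegree_eq_card_roots,
    FiniteField.X_pow_card_sub_X_natDegree_eq Ω h2]
end Ek

section Tw
variable {R ι : Type*} [CommRing R] [Algebra F2 R] [Fintype ι] (bR : Module.Basis ι F2 R)
variable (c0 c1 : R)

def cnt (Ω : Type*) [Field Ω] [Algebra F2 Ω] (k : ℕ) (g : R) : ℕ :=
  ((Ek Ω k).filter (fun a => NM bR c0 c1 Ω a k = BS bR Ω g)).card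

variable {κ A Ω ιA : Type*} [Field κ] [CommRing A] [IsDomain A] [Algebra κ[X] A] [Algebra κ A]
  [IsScalarTower κ κ[X] A] [Algebra F2 κ] [Algebra F2 A] [Field Ω] [IsAlgClosed Ω] [Algebra κ Ω]
  [Algebra F2 Ω] [CharP Ω 2] [CharP κ 2] [Fintype ιA] (y : ι → A)

lemma point_tw
    (b : Module.Basis ιA κ[X] A)
    (E : ℕ)
    (hκ : ∀ c : κ, c ^ (2 ^ E) = c) (a0 : κ)
    (hyE : ∀ i, y i ^ (2 ^ E) = (NM bR c0 c1 A (algebraMap κ[X] A (C a0 + X)) E).mulVec y i)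
    {n : ℕ} (a : Ω) (g : R) (ha : a ^ (2 ^ (E * n)) = a)
    (hg : NM bR c0 c1 Ω a (E * n) = BS bR Ω g) :
    ∃ x : A →ₐ[κ] Ω, x (algebraMap κ[X] A X) = a - algebraMap κ Ω a0 ∧ IsTw bR y x (E * n) g := by
  obtain ⟨x, hx⟩ := exists_point (Ω := Ω) b (a - algebraMap κ Ω a0)
  have hκ' : ∀ c : κ, c ^ (2 ^ (E * n)) = c := fun c => by
    rw [pow_mul]; exact pow_iter c _ (hκ c) n
  refine ⟨x, hx, ?_, hκ', ?_⟩
  · rw [hx, sub_pow_char_pow, ha, ← map_pow, hκ']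
  · have hxa : x (algebraMap κ[X] A (C a0 + X)) = a := by
      rw [map_add, map_add, hx]
      have : algebraMap κ[X] A (C a0) = algebraMap κ A a0 := by
        rw [IsScalarTower.algebraMap_apply κ κ[X] A]; rfl
      rw [this, AlgHom.commutes]; ring
    have h1 : ∀ i, x (y i) ^ (2 ^ E) = ((NM bR c0 c1 Ω a E).mulVec (fun i => x (y i))) i := by
      intro i
      rw [← map_pow, hyE]
      have e := NM_map bR c0 c1 (x : A →+* Ω) (algebraMap κ[X] A (C a0 + X)) E
      have e2 : (x : A →+* Ω) (algebraMap κ[X] A (C a0 + X)) = a := hxa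
      rw [e2] at e
      rw [← e]
      simp [Matrix.mulVec, dotProduct]
    have h2 := frob_iter bR c0 c1 a (fun i => x (y i)) E h1 n
    intro i
    rw [h2, hg]
    exact (map_gy bR (x : A →+* Ω) y g i).symm

lemma claimB [IsNoetherianRing A] [Module.Finite κ[X] A]
    (b : Module.Basis ιA κ[X] A)
    (hy : Algebra.adjoin κ[X] (Set.range y) = ⊤)
    (E : ℕ) (hE : 1 ≤ E)
    (hκ : ∀ c : κ, c ^ (2 ^ E) = c) (a0 : κ)
    (hyE : ∀ i, y i ^ (2 ^ E) = (NM bR c0 c1 A (algebraMap κ[X] A (C a0 + X)) E).mulVec y i)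
    (g : Rˣ) (hg : g ∉ HH (κ := κ) bR y) :
    ∃ C : ℕ, ∀ n, 1 ≤ n → cnt bR c0 c1 Ω (E * n) (g : R) ≤ C := by
  obtain ⟨u, hu0, hu⟩ := tw_notmem (Ω := Ω) bR y hy g hg
  obtain ⟨c, hc'⟩ := exists_LL b (fun p : ιA × ιA => b p.1 * b p.2)
  have hc : GoodC b c := fun i j => hc' (i, j)
  obtain ⟨D, hD⟩ := exists_LL b (fun _ : Unit => u)
  replace hD := hD ()
  refine ⟨Fintype.card ιA * (D + c), fun n hn => ?_⟩
  have hk : 1 ≤ E * n := Nat.mul_pos hE hn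
  have hp : ∀ a ∈ (Ek Ω (E * n)).filter (fun a => NM bR c0 c1 Ω a (E * n) = BS bR Ω (g : R)),
      ∃ x : A →ₐ[κ] Ω, x (algebraMap κ[X] A X) = a - algebraMap κ Ω a0 ∧ IsTw bR y x (E * n) (g : R) := by
    intro a ha
    rw [Finset.mem_filter, mem_Ek hk] at ha
    exact point_tw bR c0 c1 y b E hκ a0 hyE a g ha.1 ha.2
  haveI : Nonempty (A →ₐ[κ] Ω) := ⟨(exists_point (Ω := Ω) b 0).choose⟩
  choose! x hx1 hx2 using hp
  rw [cnt, ← Finset.card_image_of_injOn (f := x)]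
  · refine zeros_le b hc hu0 hD _ fun z hz => ?_
    obtain ⟨a, ha, rfl⟩ := Finset.mem_image.1 hz
    exact hu _ _ (hx2 a ha)
  · intro a ha a' ha' h
    have h1 := hx1 a ha
    have h2 := hx1 a' ha'
    have h3 : x a = x a' := h
    rw [h3, h2] at h1
    exact (sub_left_injective h1).symm

lemma claimA [Finite R]
    (b : Module.Basis ιA κ[X] A)
    (hy : Algebra.adjoin κ[X] (Set.range y) = ⊤)
    (E : ℕ) (hE : 1 ≤ E)
    (hκ : ∀ c : κ, c ^ (2 ^ E) = c) (a0 : κ)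
    (hyE : ∀ i, y i ^ (2 ^ E) = (NM bR c0 c1 A (algebraMap κ[X] A (C a0 + X)) E).mulVec y i)
    (hfree : ∀ g : R, gy bR y g = y → g = 1)
    (j : A →ₐ[κ[X]] PowerSeries κ) (g : Rˣ) (hg : g ∈ HH (κ := κ) bR y) :
    ∃ C n0 : ℕ, ∀ n, n0 ≤ n → 1 ≤ n → Nat.card (HH (κ := κ) bR y) * cnt bR c0 c1 Ω (E * (2 * n)) (g : R) ≤
      2 ^ (E * (2 * n)) + C * 2 ^ (E * n) := by
  obtain ⟨σ, hσ⟩ := hg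
  obtain ⟨c, hc'⟩ := exists_LL b (fun p : ιA × ιA => b p.1 * b p.2)
  have hc : GoodC b c := fun i j => hc' (i, j)
  obtain ⟨K, μ₀, hst⟩ := stepanov (Ω := Ω) b j σ
  let H := HH (κ := κ) bR y
  haveI : Fintype H := Fintype.ofFinite _
  have hτ : ∀ h : H, ∃ τ : A ≃ₐ[κ[X]] A, ∀ i, τ (y i) = gy bR y ((h : Rˣ) : R) i := fun h => h.2
  choose τ hτ using hτ
  have hd : ∀ p : H × H, ∃ u : A, ∃ D, (p.1 ≠ p.2 → u ≠ 0 ∧ u ∈ LL b D ∧ ∀ x : A →ₐ[κ] Ω,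
      (∀ v, x (τ p.1 v) = x (τ p.2 v)) → x u = 0) := by
    rintro ⟨h, h'⟩
    by_cases hne : h = h'
    · exact ⟨0, 0, fun h => absurd hne h⟩
    have : ∃ i, gy bR y ((h : Rˣ) : R) i ≠ gy bR y ((h' : Rˣ) : R) i := by
      by_contra hcon
      push Not at hcon
      apply hne
      have e := congrArg (fun z => gy bR z (((h' : Rˣ)⁻¹ : Rˣ) : R)) (funext hcon)
      simp only [gy_mul] at e
      rw [Units.mul_inv, gy_one] at e
      have := hfree _ e
      have : (h : Rˣ) * (h' : Rˣ)⁻¹ = 1 := by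
        apply Units.ext; simpa using this
      exact Subtype.ext (mul_inv_eq_one.1 this)
    obtain ⟨i, hi⟩ := this
    obtain ⟨D, hD⟩ := exists_LL b (fun _ : Unit => gy bR y ((h : Rˣ) : R) i - gy bR y ((h' : Rˣ) : R) i)
    replace hD := hD ()
    refine ⟨_, D, fun _ => ⟨sub_ne_zero.2 hi, hD, fun x hx => ?_⟩⟩
    rw [map_sub, sub_eq_zero, ← hτ, ← hτ]
    exact hx _
  choose u D hu using hd
  let C1 := ∑ p : H × H, Fintype.card ιA * (D p + c)
  refine ⟨K + Nat.card H * C1, μ₀, fun n hn hn1 => ?_⟩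
  have hk : 1 ≤ E * (2 * n) := Nat.mul_pos hE (by omega)
  have hp : ∀ a ∈ (Ek Ω (E * (2 * n))).filter (fun a => NM bR c0 c1 Ω a (E * (2 * n)) = BS bR Ω (g : R)),
      ∃ x : A →ₐ[κ] Ω, x (algebraMap κ[X] A X) = a - algebraMap κ Ω a0 ∧ IsTw bR y x (E * (2 * n)) (g : R) := by
    intro a ha
    rw [Finset.mem_filter, mem_Ek hk] at ha
    exact point_tw bR c0 c1 y b E hκ a0 hyE a g ha.1 ha.2
  haveI : Nonempty (A →ₐ[κ] Ω) := ⟨(exists_point (Ω := Ω) b 0).choose⟩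
  choose! x hx1 hx2 using hp
  set S := (Ek Ω (E * (2 * n))).filter (fun a => NM bR c0 c1 Ω a (E * (2 * n)) = BS bR Ω (g : R)) with hS
  have hxinj : Set.InjOn x (S : Set Ω) := by
    intro a ha a' ha' h
    have h1 := hx1 a ha
    have h2 := hx1 a' ha'
    have h3 : x a = x a' := h
    rw [h3, h2] at h1
    exact (sub_left_injective h1).symm
  let badp : H × H → Finset Ω := fun p => if p.1 = p.2 then ∅ else
    S.filter (fun a => ∀ v, x a (τ p.1 v) = x a (τ p.2 v))
  let bad : Finset Ω := Finset.univ.biUnion badp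
  have hbad : bad.card ≤ C1 := by
    refine Finset.card_biUnion_le.trans (Finset.sum_le_sum fun p _ => ?_)
    by_cases hpp : p.1 = p.2
    · simp [badp, hpp]
    simp only [badp, if_neg hpp]
    obtain ⟨h1, h2, h3⟩ := hu p hpp
    rw [← Finset.card_image_of_injOn (f := x) (hxinj.mono (fun z hz => (Finset.mem_filter.1 (Finset.mem_coe.1 hz)).1))]
    refine zeros_le b hc h1 h2 _ fun z hz => ?_
    obtain ⟨a, ha, rfl⟩ := Finset.mem_image.1 hz
    exact h3 _ (Finset.mem_filter.1 ha).2
  let G := S \ bad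
  let pt : Ω × H → (A →ₐ[κ] Ω) := fun p => (x p.1).comp ((τ p.2 : A →ₐ[κ[X]] A).restrictScalars κ)
  have hptX : ∀ p : Ω × H, pt p (algebraMap κ[X] A X) = x p.1 (algebraMap κ[X] A X) := by
    intro p
    change x p.1 (τ p.2 (algebraMap κ[X] A X)) = _
    rw [AlgEquiv.commutes]
  have hinj : Set.InjOn pt ((G ×ˢ (Finset.univ : Finset H) : Finset (Ω × H)) : Set (Ω × H)) := by
    rintro ⟨a, h⟩ hm ⟨a', h'⟩ hm' heq
    simp only [Finset.coe_product, Set.mem_prod, Finset.mem_coe, G, Finset.mem_sdiff] at hm hm'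
    have h1 := hptX (a, h)
    have h2 := hptX (a', h')
    rw [heq, h2] at h1
    have haa : a' = a := by
      have e1 := hx1 a hm.1.1
      have e2 := hx1 a' hm'.1.1
      simp only at h1
      rw [h1, e1] at e2
      exact (sub_left_injective e2).symm
    subst haa
    by_cases hh : h = h'
    · rw [hh]
    exfalso
    apply hm.1.2
    refine Finset.mem_biUnion.2 ⟨(h, h'), Finset.mem_univ _, ?_⟩
    simp only [badp, if_neg hh]
    refine Finset.mem_filter.2 ⟨hm.1.1, fun v => ?_⟩
    exact AlgHom.congr_fun heq v
  have htw : ∀ p ∈ G ×ˢ (Finset.univ : Finset H), IsTw bR y (pt p) (E * (2 * n)) (g : R) := by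
    rintro ⟨a, h⟩ hm
    have ha : a ∈ S := (Finset.mem_sdiff.1 (Finset.mem_product.1 hm).1).1
    obtain ⟨t1, t2, t3⟩ := hx2 a ha
    refine ⟨?_, t2, ?_⟩
    · rw [hptX]; exact t1
    · have e0 : ∀ i, pt (a, h) (y i) = gy bR (fun i => x a (y i)) ((h : Rˣ) : R) i := by
        intro i
        change x a (τ h (y i)) = _
        rw [hτ]
        exact map_gy bR (x a : A →+* Ω) y _ i
      intro i
      have e1 := map_gy bR (pt (a, h) : A →+* Ω) y (g : R) i
      have e2 : pt (a, h) (gy bR y (g : R) i) = gy bR (fun i => pt (a, h) (y i)) (g : R) i := e1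
      rw [e2, funext e0, gy_mul, mul_comm ((h : Rˣ) : R) (g : R), ← gy_mul, e0]
      have e3 : gy bR (fun i => x a (y i)) (g : R) = fun i => x a (y i) ^ 2 ^ (E * (2 * n)) := by
        ext i
        rw [t3]
        exact (map_gy bR (x a : A →+* Ω) y (g : R) i).symm
      rw [e3]
      have := map_gy bR (iterateFrobenius Ω 2 (E * (2 * n))) (fun i => x a (y i)) ((h : Rˣ) : R) i
      simpa [iterateFrobenius_def] using this
  have hZ := hst (E * n) (hn.trans (Nat.le_mul_of_pos_left _ hE)) ((G ×ˢ (Finset.univ : Finset H)).image pt) (by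
    intro z hz v
    obtain ⟨p, hp, rfl⟩ := Finset.mem_image.1 hz
    rw [tw_sigma bR y (htw p hp) hy σ hσ v, ← pow_add]
    congr 2; ring)
  rw [Finset.card_image_of_injOn hinj, Finset.card_product, Finset.card_univ, ← pow_add] at hZ
  have e : E * n + E * n = E * (2 * n) := by ring
  rw [e] at hZ
  have hG : S.card ≤ G.card + C1 := by
    have := Finset.le_card_sdiff bad S
    have : S.card ≤ G.card + bad.card := by
      simp only [G]; omega
    omega
  rw [cnt, ← hS, Nat.card_eq_fintype_card]
  have hp1 : 1 ≤ 2 ^ (E * n) := Nat.one_le_two_pow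
  calc Fintype.card H * S.card ≤ Fintype.card H * (G.card + C1) := Nat.mul_le_mul_left _ hG
    _ = G.card * Fintype.card H + Fintype.card H * C1 * 1 := by ring
    _ ≤ (2 ^ (E * (2 * n)) + K * 2 ^ (E * n)) + Fintype.card H * C1 * 2 ^ (E * n) :=
        Nat.add_le_add hZ (Nat.mul_le_mul_left _ hp1)
    _ = _ := by ring

end Tw
end S8

namespace S8

section Tw
variable {R ι : Type*} [CommRing R] [Algebra F2 R] [Fintype ι] (bR : Module.Basis ι F2 R)
variable (c0 c1 : R)
variable {Ω : Type*} [Field Ω] [IsAlgClosed Ω] [Algebra F2 Ω] [CharP Ω 2]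

lemma gy_const_one {κ : Type*} [Field κ] [Algebra F2 κ] (g : R)
    (h : gy bR (fun i => algebraMap F2 κ (bR.repr 1 i)) g = fun i => algebraMap F2 κ (bR.repr 1 i)) :
    g = 1 := by
  apply bR.repr.injective
  ext i
  have := congrFun h i
  rw [gy, BS_one_mulVec] at this
  exact (algebraMap F2 κ).injective this

theorem weil_group [Finite R] (a0 : Ω) (d : ℕ) (hd : 1 ≤ d) (ha0 : a0 ^ (2 ^ d) = a0) (g0 : Rˣ)
    (hg0 : NM bR c0 c1 Ω a0 d = BS bR Ω (g0 : R)) :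
    ∃ (H : Subgroup Rˣ) (E C n0 : ℕ), 1 ≤ E ∧ ∀ n, n0 ≤ n →
      (∀ g ∈ H, Nat.card H * cnt bR c0 c1 Ω (E * (2 * n)) (g : R) ≤ 2 ^ (E * (2 * n)) + C * 2 ^ (E * n)) ∧
      (∀ g ∉ H, cnt bR c0 c1 Ω (E * (2 * n)) (g : R) ≤ C) := by
  haveI : Finite Rˣ := inferInstance
  haveI : Fintype Rˣ := Fintype.ofFinite _
  let κ := IntermediateField.adjoin F2 {a0}
  let E := d * orderOf g0
  have hE : 1 ≤ E := Nat.mul_pos hd (orderOf_pos g0)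
  haveI : CharP κ 2 := charP_of_injective_algebraMap (algebraMap F2 κ).injective 2
  have ha0E : a0 ^ (2 ^ E) = a0 := by
    simp only [E]; rw [pow_mul]; exact pow_iter a0 _ ha0 _
  have hκ : ∀ c : κ, c ^ (2 ^ E) = c := by
    rintro ⟨c, hc⟩
    apply Subtype.ext
    change c ^ (2 ^ E) = c
    induction hc using IntermediateField.adjoin_induction with
    | mem x hx => rw [Set.mem_singleton_iff.1 hx]; exact ha0E
    | algebraMap x =>
      rw [← map_pow]
      have : x ^ (2 ^ E) = x := by
        have h2 : x ^ 2 = x := by revert x; decide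
        exact pow_iter x 2 h2 E
      rw [this]
    | add x y _ _ hx hy => rw [add_pow_char_pow, hx, hy]
    | inv x _ hx => rw [inv_pow, hx]
    | mul x y _ _ hx hy => rw [mul_pow, hx, hy]
  let α0 : κ := ⟨a0, IntermediateField.mem_adjoin_simple_self F2 a0⟩
  have hNE : NM bR c0 c1 κ α0 E = 1 := by
    have h1 : NM bR c0 c1 Ω a0 E = 1 := by
      rw [NM_mul bR c0 c1 a0 d (g0 : R) ha0 hg0, ← Units.val_pow_eq_pow_val, pow_orderOf_eq_one]
      simp
    have h2 := NM_map bR c0 c1 (algebraMap κ Ω) α0 E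
    have h3 : algebraMap κ Ω α0 = a0 := rfl
    rw [h3, h1] at h2
    have h4 : (1 : Matrix ι ι Ω) = (1 : Matrix ι ι κ).map (algebraMap κ Ω) :=
      (Matrix.map_one _ (map_zero _) (map_one _)).symm
    rw [h4] at h2
    exact Matrix.map_injective (algebraMap κ Ω).injective h2
  letI : Algebra F2 κ[X] := inferInstance
  obtain ⟨y0, hy0, hv⟩ := exists_ps_solution (NM bR c0 c1 κ[X] (C α0 + X) E) (by
    have := NM_map bR c0 c1 (evalRingHom (0 : κ)) (C α0 + X) E
    rw [coe_evalRingHom] at this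
    rw [this]
    simpa using hNE) E hE (fun i => algebraMap F2 κ (bR.repr 1 i)) (fun i => hκ _)
  have hq2 : 2 ≤ 2 ^ E := by
    calc 2 = 2 ^ 1 := by norm_num
      _ ≤ 2 ^ E := Nat.pow_le_pow_right (by norm_num) hE
  haveI hfin := finite_adjoin y0 (2 ^ E) hq2 _ hy0
  let A := Algebra.adjoin κ[X] (Set.range y0)
  letI : Algebra F2 A := ((algebraMap κ A).comp (algebraMap F2 κ)).toAlgebra
  let y : ι → A := fun i => ⟨y0 i, Algebra.subset_adjoin (Set.mem_range_self i)⟩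
  haveI : Module.Finite κ[X] A := hfin
  have hinj : Function.Injective (algebraMap κ[X] (PowerSeries κ)) := by
    have : (algebraMap κ[X] (PowerSeries κ) : κ[X] → PowerSeries κ) = fun p : κ[X] => Polynomial.toPowerSeries p := by
      ext p : 1
      rw [PowerSeries.algebraMap_apply']; simp
    rw [this]; exact Polynomial.coe_injective κ
  haveI : FaithfulSMul κ[X] (PowerSeries κ) := (faithfulSMul_iff_algebraMap_injective _ _).2 hinj
  haveI : IsNoetherianRing A := IsNoetherianRing.of_finite κ[X] A
  haveI : Module.IsTorsionFree κ[X] A := by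
    rw [Module.isTorsionFree_iff_algebraMap_injective]
    intro p q hpq
    exact hinj (congrArg Subtype.val hpq)
  haveI : Module.Free κ[X] A := inferInstance
  let b := Module.Free.chooseBasis κ[X] A
  have hy : Algebra.adjoin κ[X] (Set.range y) = ⊤ := by
    rw [eq_top_iff]
    rintro ⟨z, hz⟩ -
    have : Set.range y = ((↑) : A → PowerSeries κ) ⁻¹' Set.range y0 := by
      ext w
      constructor
      · rintro ⟨i, rfl⟩; exact ⟨i, rfl⟩
      · rintro ⟨i, hi⟩; exact ⟨i, Subtype.ext hi⟩
    rw [this, Algebra.adjoin_adjoin_coe_preimage]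
    trivial
  have hyE : ∀ i, y i ^ (2 ^ E) = (NM bR c0 c1 A (algebraMap κ[X] A (C α0 + X)) E).mulVec y i := by
    intro i
    rw [← NM_map bR c0 c1 (algebraMap κ[X] A)]
    apply Subtype.ext
    refine (hy0 i).trans ?_
    simp only [Matrix.mulVec, dotProduct, Matrix.map_apply]
    rw [AddSubmonoidClass.coe_finset_sum]
    refine Finset.sum_congr rfl fun k _ => ?_
    rw [Algebra.smul_def]; rfl
  have hfree : ∀ g : R, gy bR y g = y → g = 1 := by
    intro g hg
    apply gy_const_one (κ := κ) bR g
    let f : A →+* κ := (PowerSeries.constantCoeff (R := κ)).comp A.val.toRingHom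
    have hf : ∀ i, f (y i) = algebraMap F2 κ (bR.repr 1 i) := fun i => hv i
    ext i : 1
    have := map_gy bR f y g i
    rw [hg, hf, funext hf] at this
    exact this.symm
  have hA := fun g hg => claimA (Ω := Ω) bR c0 c1 y b hy E hE hκ α0 hyE hfree A.val g hg
  have hB := fun g hg => claimB (Ω := Ω) bR c0 c1 y b hy E hE hκ α0 hyE g hg
  choose! CA nA hA using hA
  choose! CB hB using hB
  refine ⟨HH (κ := κ) bR y, E, ∑ g, CA g + ∑ g, CB g, 1 + ∑ g, nA g, hE, fun n hn => ⟨fun g hg => ?_, fun g hg => ?_⟩⟩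
  · have h1 := Finset.single_le_sum (f := nA) (fun _ _ => Nat.zero_le _) (Finset.mem_univ g)
    have h2 := Finset.single_le_sum (f := CA) (fun _ _ => Nat.zero_le _) (Finset.mem_univ g)
    refine (hA g hg n (by omega) (by omega)).trans ?_
    gcongr
    omega
  · have h2 := Finset.single_le_sum (f := CB) (fun _ _ => Nat.zero_le _) (Finset.mem_univ g)
    have := hB g hg (2 * n) (by omega)
    omega

end Tw
end S8

namespace S8

lemma char_norm {G : Type*} [Group G] [Finite G] (χ : G →* ℂ) (g : G) : ‖χ g‖ = 1 := by
  haveI : Fintype G := Fintype.ofFinite _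
  have h : (χ g) ^ (orderOf g) = 1 := by rw [← map_pow, pow_orderOf_eq_one, map_one]
  exact Complex.norm_eq_one_of_pow_eq_one h (orderOf_pos g).ne'

lemma group_arith {G : Type*} [CommGroup G] [Fintype G] (H : Subgroup G) (c : G → ℕ) (Q P C C0 : ℕ)
    (hP : 1 ≤ P)
    (h1 : ∀ g ∈ H, Nat.card H * c g ≤ Q + C * P) (h2 : ∀ g ∉ H, c g ≤ C)
    (h3 : Q ≤ ∑ g, c g + C0) (χ : G →* ℂ) :
    -((2 * C + 2 * Fintype.card G * C + C0 : ℕ) : ℝ) * P ≤ (∑ g, χ g * c g).re := by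
  have hcard : Nat.card H = (Finset.univ.filter (fun g => g ∈ H)).card := by
    rw [Nat.card_eq_fintype_card, Fintype.card_subtype]
  set h : ℕ := Nat.card H with hh
  have hpos : 0 < h := Nat.card_pos
  set S := Finset.univ.filter (fun g => g ∈ H) with hS
  set S' := Finset.univ.filter (fun g => ¬ g ∈ H) with hS'
  have hsplitc : ∑ g, c g = ∑ g ∈ S, c g + ∑ g ∈ S', c g :=
    (Finset.sum_filter_add_sum_filter_not _ _ _).symm
  have hsplit : ∑ g, χ g * c g = ∑ g ∈ S, χ g * c g + ∑ g ∈ S', χ g * c g :=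
    (Finset.sum_filter_add_sum_filter_not _ _ _).symm
  have hS'c : ∑ g ∈ S', c g ≤ Fintype.card G * C := by
    calc ∑ g ∈ S', c g ≤ ∑ g ∈ S', C := Finset.sum_le_sum fun g hg => h2 g (Finset.mem_filter.1 hg).2
      _ = S'.card * C := by simp
      _ ≤ _ := Nat.mul_le_mul_right _ (Finset.card_le_univ _)
  have hre' : -((Fintype.card G * C : ℕ) : ℝ) ≤ (∑ g ∈ S', χ g * c g).re := by
    have : ‖∑ g ∈ S', χ g * c g‖ ≤ ((Fintype.card G * C : ℕ) : ℝ) := by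
      refine (norm_sum_le _ _).trans ?_
      refine le_trans (le_of_eq ?_) (Nat.cast_le.2 hS'c)
      push_cast
      refine Finset.sum_congr rfl fun g _ => ?_
      rw [norm_mul, char_norm, one_mul, Complex.norm_natCast]
    have h4 := Complex.abs_re_le_norm (∑ g ∈ S', χ g * c g)
    have := neg_abs_le (∑ g ∈ S', χ g * c g).re
    linarith
  have hχH : 0 ≤ (∑ g ∈ S, χ g).re := by
    have e : ∑ g ∈ S, χ g = ∑ g : H, (χ.comp H.subtype) g := by
      rw [hS, Finset.sum_subtype (Finset.univ.filter (fun g => g ∈ H)) (p := fun g => g ∈ H) (by simp)]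
      rfl
    rw [e, sum_hom_units]
    split_ifs
    · simp
    · simp
  have hd : ∑ g ∈ S, |(h : ℝ) * c g - Q| ≤ 2 * h * C * P + h * ((Fintype.card G * C : ℕ) + C0) := by
    have e1 : ∀ g ∈ S, |(h : ℝ) * c g - Q| ≤ (Q + C * P - h * c g) + C * P := by
      intro g hg
      have := h1 g (Finset.mem_filter.1 hg).2
      have h5 : (h : ℝ) * c g ≤ Q + C * P := by exact_mod_cast this
      have h6 : (0 : ℝ) ≤ C * P := by positivity
      rw [abs_le]; constructor <;> linarith
    refine (Finset.sum_le_sum e1).trans ?_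
    rw [Finset.sum_add_distrib, Finset.sum_sub_distrib, Finset.sum_const, Finset.sum_const, ← hcard,
      ← Finset.mul_sum]
    have h7 : (Q : ℝ) ≤ ∑ g ∈ S, (c g : ℝ) + (Fintype.card G * C : ℕ) + C0 := by
      have : Q ≤ ∑ g ∈ S, c g + Fintype.card G * C + C0 := by omega
      exact_mod_cast this
    have h8 := mul_le_mul_of_nonneg_left h7 (Nat.cast_nonneg (α := ℝ) h)
    simp only [nsmul_eq_mul]
    nlinarith
  have hmain : (h : ℝ) * (∑ g ∈ S, χ g * c g).re ≥ -(2 * h * C * P + h * ((Fintype.card G * C : ℕ) + C0)) := by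
    have e : (h : ℂ) * ∑ g ∈ S, χ g * c g = (Q : ℂ) * ∑ g ∈ S, χ g + ∑ g ∈ S, χ g * (h * c g - Q) := by
      rw [Finset.mul_sum, Finset.mul_sum, ← Finset.sum_add_distrib]
      refine Finset.sum_congr rfl fun g _ => by ring
    have e2 := congrArg Complex.re e
    rw [Complex.add_re, ← Complex.ofReal_natCast h, ← Complex.ofReal_natCast Q, Complex.re_ofReal_mul,
      Complex.re_ofReal_mul] at e2
    rw [e2]
    have : ‖∑ g ∈ S, χ g * ((h : ℝ) * (c g : ℂ) - (Q : ℝ))‖ ≤ ∑ g ∈ S, |(h : ℝ) * c g - Q| := by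
      refine (norm_sum_le _ _).trans (Finset.sum_le_sum fun g _ => ?_)
      rw [norm_mul, char_norm, one_mul]
      rw [← Real.norm_eq_abs, ← Complex.norm_real]
      push_cast; rfl
    have h4 := Complex.abs_re_le_norm (∑ g ∈ S, χ g * ((h : ℝ) * (c g : ℂ) - (Q : ℝ)))
    have h5 := neg_abs_le (∑ g ∈ S, χ g * ((h : ℝ) * (c g : ℂ) - (Q : ℝ))).re
    have h6 : (0 : ℝ) ≤ Q * (∑ g ∈ S, χ g).re := by positivity
    linarith
  have hmain2 : (∑ g ∈ S, χ g * c g).re ≥ -(2 * C * P + ((Fintype.card G * C : ℕ) + C0)) := by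
    have hp : (0 : ℝ) < h := by exact_mod_cast hpos
    by_contra hcon
    push Not at hcon
    nlinarith
  rw [hsplit, Complex.add_re]
  have hP' : (1 : ℝ) ≤ P := by exact_mod_cast hP
  have hX : (0 : ℝ) ≤ 2 * (Fintype.card G * C : ℕ) + C0 := by positivity
  have := mul_le_mul_of_nonneg_left hP' hX
  push_cast at *
  nlinarith

section Tw
variable {R ι : Type*} [CommRing R] [Algebra F2 R] [Fintype ι] (bR : Module.Basis ι F2 R)
variable (c0 c1 : R)
variable {Ω : Type*} [Field Ω] [IsAlgClosed Ω] [Algebra F2 Ω] [CharP Ω 2]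

theorem weil_core [Finite R] [Fintype Rˣ] (a0 : Ω) (d : ℕ) (hd : 1 ≤ d) (ha0 : a0 ^ (2 ^ d) = a0) (g0 : Rˣ)
    (hg0 : NM bR c0 c1 Ω a0 d = BS bR Ω (g0 : R)) (C0 : ℕ)
    (hC0 : ∀ k, 1 ≤ k → 2 ^ k ≤ ∑ g : Rˣ, cnt bR c0 c1 Ω k (g : R) + C0) :
    ∃ (E C n0 : ℕ), 1 ≤ E ∧ ∀ n, n0 ≤ n → ∀ χ : Rˣ →* ℂ,
      -(C : ℝ) * 2 ^ (E * n) ≤ (∑ g : Rˣ, χ g * cnt bR c0 c1 Ω (E * (2 * n)) (g : R)).re := by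
  obtain ⟨H, E, C, n0, hE, h⟩ := weil_group bR c0 c1 a0 d hd ha0 g0 hg0
  refine ⟨E, 2 * C + 2 * Fintype.card Rˣ * C + C0, n0 + 1, hE, fun n hn χ => ?_⟩
  obtain ⟨h1, h2⟩ := h n (by omega)
  have := group_arith H (fun g => cnt bR c0 c1 Ω (E * (2 * n)) (g : R)) (2 ^ (E * (2 * n))) (2 ^ (E * n)) C C0
    Nat.one_le_two_pow h1 h2 (hC0 _ (Nat.mul_pos hE (by omega))) χ
  push_cast at this ⊢
  exact this

end Tw
end S8

namespace S8

lemma exists_esymm (A : ℕ → ℂ) (D : ℕ) (hA0 : A 0 = 1) (hA : ∀ n, D < n → A n = 0) :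
    ∃ m : Multiset ℂ, Multiset.card m = D ∧ ∀ n, m.esymm n = A n := by
  let P : ℂ[X] := ∑ n ∈ Finset.range (D + 1), C (A n) * X ^ (D - n)
  have hcoeff : ∀ n, n ≤ D → P.coeff (D - n) = A n := by
    intro n hn
    simp only [P, finsetSum_coeff, coeff_C_mul_X_pow]
    rw [Finset.sum_eq_single n]
    · simp
    · intro b hb hne
      have := Finset.mem_range.1 hb
      rw [if_neg (by omega)]
    · intro h; exact absurd (Finset.mem_range.2 (by omega)) h
  have hdeg : P.natDegree ≤ D := by
    refine natDegree_sum_le_of_forall_le _ _ fun n _ => ?_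
    exact (natDegree_C_mul_X_pow_le _ _).trans (by omega)
  have hlead : P.coeff D = 1 := by
    have := hcoeff 0 (Nat.zero_le _)
    rwa [Nat.sub_zero, hA0] at this
  have hnd : P.natDegree = D := natDegree_eq_of_le_of_coeff_ne_zero hdeg (by rw [hlead]; exact one_ne_zero)
  have hmonic : P.Monic := by rw [Monic, leadingCoeff, hnd, hlead]
  have hs : P.Splits := IsAlgClosed.splits P
  have hroots : P = (P.roots.map (fun a => X - C a)).prod := hs.eq_prod_roots_of_monic hmonic
  have hcard : Multiset.card P.roots = D := by rw [← hs.natDegree_eq_card_roots, hnd]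
  let m := P.roots.map (fun a => -a)
  have hm : Multiset.card m = D := by simp [m, hcard]
  have hP : P = (m.map (fun a => X + C a)).prod := by
    conv_lhs => rw [hroots]
    simp [m, Multiset.map_map, sub_eq_add_neg]
  refine ⟨m, hm, fun n => ?_⟩
  by_cases hn : n ≤ D
  · have := Multiset.prod_X_add_C_coeff m (k := D - n) (by omega)
    rw [← hP, hcoeff n hn, hm] at this
    rw [this]; congr 1; omega
  · rw [hA n (by omega), Multiset.esymm, Multiset.powersetCard_eq_empty n (by omega)]
    simp

lemma newton (A ψ : ℕ → ℂ) (D : ℕ) (hA0 : A 0 = 1) (hA : ∀ n, D < n → A n = 0)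
    (hrec : ∀ n : ℕ, 1 ≤ n → (n : ℂ) * A n = ∑ p ∈ Finset.HasAntidiagonal.antidiagonal n with p.1 < n, A p.1 * ψ p.2) :
    ∃ (σ : Type) (_ : Fintype σ) (α : σ → ℂ), Fintype.card σ = D ∧ ∀ k, 1 ≤ k → ψ k = - ∑ i, α i ^ k := by
  obtain ⟨m, hm, hm2⟩ := exists_esymm A D hA0 hA
  refine ⟨m, inferInstance, fun i => -(i.1), by simpa using hm, ?_⟩
  have hN : ∀ n : ℕ, (n : ℂ) * A n = ∑ p ∈ Finset.HasAntidiagonal.antidiagonal n with p.1 < n,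
      A p.1 * ((-1) ^ (p.2 + 1) * ∑ i : m, (i.1) ^ p.2) := by
    intro n
    have h := congrArg (MvPolynomial.aeval (fun i : m => (i.1 : ℂ))) (MvPolynomial.mul_esymm_eq_sum m ℂ n)
    have he : ∀ j, MvPolynomial.aeval (fun i : m => (i.1 : ℂ)) (MvPolynomial.esymm m ℂ j) = A j := by
      intro j
      rw [MvPolynomial.aeval_esymm_eq_multiset_esymm, Multiset.map_univ_coe, hm2]
    simp only [map_mul, map_natCast, he, map_sum, map_pow, map_neg, map_one, MvPolynomial.psum,
      MvPolynomial.aeval_X] at h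
    rw [h, Finset.mul_sum]
    refine Finset.sum_congr rfl fun p hp => ?_
    have h1 := Finset.HasAntidiagonal.mem_antidiagonal.1 (Finset.mem_filter.1 hp).1
    rw [← h1]
    have : ((-1 : ℂ)) ^ (p.1 + p.2 + 1) = (-1) ^ p.1 * (-1) ^ (p.2 + 1) := by rw [← pow_add]; ring
    rw [this]
    have h2 : ((-1 : ℂ)) ^ p.1 * (-1) ^ p.1 = 1 := by rw [← mul_pow]; simp
    linear_combination (A p.1 * (-1) ^ (p.2 + 1) * ∑ i : m, (i.1) ^ p.2) * h2
  have key : ∀ k, 1 ≤ k → ψ k = (-1) ^ (k + 1) * ∑ i : m, (i.1) ^ k := by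
    intro k
    induction k using Nat.strong_induction_on with
    | _ k ih =>
      intro hk
      have h1 := hrec k hk
      rw [hN k] at h1
      have hmem : ((0, k) : ℕ × ℕ) ∈ (Finset.HasAntidiagonal.antidiagonal k).filter (fun p => p.1 < k) := by
        simp; omega
      rw [← Finset.add_sum_erase _ _ hmem, ← Finset.add_sum_erase _ _ hmem] at h1
      have h2 : ∑ x ∈ ((Finset.HasAntidiagonal.antidiagonal k).filter (fun p => p.1 < k)).erase (0, k),
          A x.1 * ((-1) ^ (x.2 + 1) * ∑ i : m, (i.1) ^ x.2) =
          ∑ x ∈ ((Finset.HasAntidiagonal.antidiagonal k).filter (fun p => p.1 < k)).erase (0, k), A x.1 * ψ x.2 := by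
        refine Finset.sum_congr rfl fun p hp => ?_
        rw [Finset.mem_erase, Finset.mem_filter, Finset.HasAntidiagonal.mem_antidiagonal] at hp
        obtain ⟨h3, h4, h5⟩ := hp
        have : p.1 ≠ 0 := by
          intro h6; apply h3; ext <;> simp <;> omega
        rw [ih p.2 (by omega) (by omega)]
      rw [h2] at h1
      have h3 := add_right_cancel h1
      rw [hA0] at h3
      simpa using h3.symm
  intro k hk
  rw [key k hk, pow_succ, Finset.mul_sum, ← Finset.sum_neg_distrib]
  refine Finset.sum_congr rfl fun i _ => ?_
  rw [neg_pow (i.1 : ℂ) k]; ring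

lemma near_one {σ : Type} [Fintype σ] (z : σ → ℂ) (hz : ∀ i, ‖z i‖ = 1) (n0 : ℕ) :
    ∃ n, n0 ≤ n ∧ ∀ i, (1 / 2 : ℝ) ≤ (z i ^ n).re := by
  have hcpt : IsCompact (Metric.closedBall (0 : σ → ℂ) 1) := isCompact_closedBall _ _
  let u : ℕ → (σ → ℂ) := fun j i => z i ^ ((n0 + 1) * j)
  have hu : ∀ j, u j ∈ Metric.closedBall (0 : σ → ℂ) 1 := by
    intro j
    rw [mem_closedBall_zero_iff, pi_norm_le_iff_of_nonneg zero_le_one]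
    intro i
    simp [u, hz]
  obtain ⟨a, -, φ, hφ, hlim⟩ := hcpt.tendsto_subseq hu
  have hc := hlim.cauchySeq
  rw [Metric.cauchySeq_iff'] at hc
  obtain ⟨N, hN⟩ := hc (1 / 2) (by norm_num)
  have h1 := hN (N + 1) (by omega)
  have hlt : φ N < φ (N + 1) := hφ (Nat.lt_succ_self N)
  refine ⟨(n0 + 1) * (φ (N + 1) - φ N), ?_, fun i => ?_⟩
  · have : 1 ≤ φ (N + 1) - φ N := by omega
    nlinarith
  · have h2 := (dist_le_pi_dist _ _ i).trans_lt h1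
    simp only [Function.comp, u] at h2
    have e : (n0 + 1) * φ (N + 1) = (n0 + 1) * (φ (N + 1) - φ N) + (n0 + 1) * φ N := by
      rw [← mul_add]; congr 1; omega
    set w := z i ^ ((n0 + 1) * (φ (N + 1) - φ N)) with hw
    have h3 : ‖w - 1‖ < 1 / 2 := by
      rw [dist_eq_norm, e, pow_add, ← sub_one_mul, norm_mul, norm_pow, hz] at h2
      simpa using h2
    have h4 := Complex.abs_re_le_norm (w - 1)
    have h5 := neg_abs_le (w - 1).re
    simp at h5
    have h6 : (w - 1).re = w.re - 1 := by simp
    rw [h6] at h4 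
    linarith

lemma pow_near {σ : Type} [Fintype σ] (β : σ → ℂ) (n0 : ℕ) :
    ∃ n, n0 ≤ n ∧ ∀ i, (1 / 2 : ℝ) * ‖β i‖ ^ n ≤ (β i ^ n).re := by
  obtain ⟨n, hn, h⟩ := near_one (fun i => if β i = 0 then 1 else β i / ‖β i‖) (fun i => by
    by_cases hi : β i = 0
    · simp [hi]
    · simp [hi]) (n0 + 1)
  refine ⟨n, by omega, fun i => ?_⟩
  by_cases hi : β i = 0
  · have : n ≠ 0 := by omega
    simp [hi, this]
  · have h1 := h i
    simp only [if_neg hi] at h1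
    have e : β i ^ n = ((‖β i‖ ^ n : ℝ) : ℂ) * (β i / ‖β i‖) ^ n := by
      have : (‖β i‖ : ℂ) ≠ 0 := by simpa using hi
      rw [div_pow]; push_cast; field_simp
    rw [e, Complex.re_ofReal_mul]
    have : 0 ≤ ‖β i‖ ^ n := by positivity
    nlinarith

lemma root_bound {σ : Type} [Fintype σ] (β : σ → ℂ) (C B : ℝ) (hB : 1 ≤ B) (n0 : ℕ)
    (h : ∀ n, n0 ≤ n → (∑ i, β i ^ n).re ≤ C * B ^ n) (i : σ) : ‖β i‖ ≤ B := by
  by_contra hcon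
  push Not at hcon
  have hr : 1 < ‖β i‖ / B := by rwa [one_lt_div (by linarith)]
  obtain ⟨n1, hn1⟩ := pow_unbounded_of_one_lt (2 * C) hr
  obtain ⟨n, hn, hb⟩ := pow_near β (max n0 n1)
  have h1 := h n (le_trans (le_max_left _ _) hn)
  rw [Complex.re_sum] at h1
  have h2 : ∑ j, (1 / 2 : ℝ) * ‖β j‖ ^ n ≤ ∑ j, (β j ^ n).re := Finset.sum_le_sum fun j _ => hb j
  have h3 : (1 / 2 : ℝ) * ‖β i‖ ^ n ≤ ∑ j, (1 / 2 : ℝ) * ‖β j‖ ^ n :=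
    Finset.single_le_sum (f := fun j => (1 / 2 : ℝ) * ‖β j‖ ^ n) (fun j _ => by positivity) (Finset.mem_univ i)
  have h4 : (‖β i‖ / B) ^ n1 ≤ (‖β i‖ / B) ^ n := pow_le_pow_right₀ hr.le (le_trans (le_max_right _ _) hn)
  have h5 : 2 * C < (‖β i‖ / B) ^ n := by linarith
  rw [div_pow, lt_div_iff₀ (by positivity)] at h5
  linarith

theorem rh_analytic (A ψ : ℕ → ℂ) (D : ℕ) (hA0 : A 0 = 1) (hA : ∀ n, D < n → A n = 0)
    (hrec : ∀ n : ℕ, 1 ≤ n → (n : ℂ) * A n = ∑ p ∈ Finset.HasAntidiagonal.antidiagonal n with p.1 < n, A p.1 * ψ p.2)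
    (E C n0 : ℕ) (hE : 1 ≤ E) (hpos : ∀ n, n0 ≤ n → -(C : ℝ) * 2 ^ (E * n) ≤ (ψ (E * (2 * n))).re) :
    ∀ k, 1 ≤ k → ‖ψ k‖ ^ 2 ≤ (D : ℝ) ^ 2 * 2 ^ k := by
  obtain ⟨σ, _, α, hcard, hα⟩ := newton A ψ D hA0 hA hrec
  have hb : ∀ i, ‖α i‖ ^ 2 ≤ 2 := by
    intro i
    have := root_bound (fun i => α i ^ (E * 2)) C ((2 : ℝ) ^ E) (one_le_pow₀ (by norm_num)) (n0 + 1) (by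
      intro n hn
      have h1 := hpos n (by omega)
      rw [hα _ (Nat.mul_pos hE (by omega))] at h1
      have e : ∑ i, (α i ^ (E * 2)) ^ n = ∑ i, α i ^ (E * (2 * n)) := by
        refine Finset.sum_congr rfl fun i _ => ?_
        rw [← pow_mul, mul_assoc]
      simp only [e]
      rw [Complex.neg_re] at h1
      rw [← pow_mul]
      linarith) i
    simp only [norm_pow] at this
    rw [mul_comm, pow_mul] at this
    exact (pow_le_pow_iff_left₀ (by positivity) (by norm_num) (by omega)).1 this
  intro k hk
  rw [hα k hk, norm_neg]
  have h1 : ‖∑ i, α i ^ k‖ ≤ ∑ i : σ, Real.sqrt (2 ^ k) := by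
    refine (norm_sum_le _ _).trans (Finset.sum_le_sum fun i _ => ?_)
    rw [norm_pow]
    apply Real.le_sqrt_of_sq_le
    rw [← pow_mul, mul_comm, pow_mul]
    exact pow_le_pow_left₀ (by positivity) (hb i) k
  rw [Finset.sum_const, Finset.card_univ, hcard, nsmul_eq_mul] at h1
  calc _ ≤ (D * Real.sqrt (2 ^ k)) ^ 2 := pow_le_pow_left₀ (norm_nonneg _) h1 2
    _ = _ := by rw [mul_pow, Real.sq_sqrt (by positivity)]

end S8

namespace S8

abbrev Om := AlgebraicClosure F2

def dg (a : Om) : ℕ := (minpoly F2 a).natDegree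
def Na (a : Om) (k : ℕ) : F2[X] := (minpoly F2 a) ^ (k / dg a)
def Dn (n : ℕ) : Finset F2[X] := (GN (n + 1)).filter (fun f => f.degree = (n : ℕ))

lemma mem_GN (n : ℕ) (f : F2[X]) : f ∈ GN n ↔ f.degree < (n : ℕ) := by
  simp [GN]

lemma mem_Dn (n : ℕ) (f : F2[X]) : f ∈ Dn n ↔ f.degree = (n : ℕ) := by
  simp only [Dn, Finset.mem_filter, mem_GN]
  constructor
  · exact fun h => h.2
  · intro h; refine ⟨?_, h⟩; rw [h]; exact_mod_cast Nat.lt_succ_self n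

lemma int_a (a : Om) : IsIntegral F2 a := Algebra.IsIntegral.isIntegral a

lemma dg_pos (a : Om) : 1 ≤ dg a := minpoly.natDegree_pos (int_a a)

lemma pow_eq_iff (a : Om) (k : ℕ) : a ^ (2 ^ k) = a ↔ dg a ∣ k := by
  have h := (minpoly.irreducible (int_a a)).natDegree_dvd_iff_dvd_X_pow_card_pow_sub_X (n := k)
  rw [dg, h, minpoly.dvd_iff]
  simp [sub_eq_zero]

lemma F2_monic {f : F2[X]} (hf : f ≠ 0) : f.Monic := by
  have h := leadingCoeff_ne_zero.2 hf
  rw [Monic]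
  generalize f.leadingCoeff = c at h
  revert h; revert c; decide

lemma natDegree_Na (a : Om) (k : ℕ) (h : dg a ∣ k) : (Na a k).natDegree = k := by
  rw [Na, natDegree_pow, ← dg, Nat.div_mul_cancel h]

lemma Na_monic (a : Om) (k : ℕ) : (Na a k).Monic := (minpoly.monic (int_a a)).pow _

lemma mem_Dn' (n : ℕ) (f : F2[X]) : f ∈ Dn n ↔ f ≠ 0 ∧ f.natDegree = n := by
  rw [mem_Dn]
  constructor
  · intro h
    have : f ≠ 0 := by rintro rfl; simp at h
    exact ⟨this, natDegree_eq_of_degree_eq_some h⟩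
  · rintro ⟨h, rfl⟩; exact degree_eq_natDegree h

lemma rootMult_eq (a : Om) (f : F2[X]) (hf : f ≠ 0) :
    ∃ v, rootMultiplicity a (f.map (algebraMap F2 Om)) = v ∧ ∀ j, minpoly F2 a ^ j ∣ f ↔ j ≤ v := by
  have hirr := minpoly.irreducible (int_a a)
  have hfin : FiniteMultiplicity (minpoly F2 a) f := finiteMultiplicity_of_degree_pos_of_monic
    (degree_pos_of_irreducible hirr) (minpoly.monic (int_a a)) hf
  refine ⟨multiplicity (minpoly F2 a) f, ?_, fun j => ?_⟩
  · obtain ⟨g, hg, hng⟩ := hfin.exists_eq_pow_mul_and_not_dvd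
    have hg0 : g ≠ 0 := by rintro rfl; exact hng (dvd_zero _)
    have hinj : Function.Injective (algebraMap F2 Om) := (algebraMap F2 Om).injective
    conv_lhs => rw [hg]
    have hp0 : (minpoly F2 a).map (algebraMap F2 Om) ≠ 0 := by
      rw [Ne, Polynomial.map_eq_zero]; exact hirr.ne_zero
    have hgm : g.map (algebraMap F2 Om) ≠ 0 := by rwa [Ne, Polynomial.map_eq_zero]
    rw [Polynomial.map_mul, Polynomial.map_pow, rootMultiplicity_mul (mul_ne_zero (pow_ne_zero _ hp0) hgm)]
    have h1 : rootMultiplicity a ((minpoly F2 a).map (algebraMap F2 Om)) = 1 := by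
      apply le_antisymm
      · exact rootMultiplicity_le_one_of_separable (PerfectField.separable_of_irreducible hirr).map a
      · rw [Nat.succ_le_iff, rootMultiplicity_pos hp0, IsRoot, eval_map_algebraMap, minpoly.aeval]
    have h2 : rootMultiplicity a (g.map (algebraMap F2 Om)) = 0 := by
      apply rootMultiplicity_eq_zero
      rw [IsRoot, eval_map_algebraMap, ← minpoly.dvd_iff]
      exact hng
    rw [h2, add_zero]
    generalize multiplicity (minpoly F2 a) f = v
    have : ∀ v, rootMultiplicity a ((minpoly F2 a).map (algebraMap F2 Om) ^ v) = v := by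
      intro v
      rw [← count_roots, roots_pow, Multiset.count_nsmul, count_roots, h1, mul_one]
    exact this v
  · exact hfin.pow_dvd_iff_le_multiplicity

lemma count_identity (f : F2[X]) (n : ℕ) (hf : f ∈ Dn n) :
    ∑ k ∈ Finset.Icc 1 n, ((Ek Om k).filter (fun a => Na a k ∣ f)).card = n := by
  obtain ⟨hf0, hn⟩ := (mem_Dn' n f).1 hf
  set fm := f.map (algebraMap F2 Om) with hfm
  have hfm0 : fm ≠ 0 := by rwa [hfm, Ne, Polynomial.map_eq_zero]
  have h1 : n = ∑ a ∈ fm.roots.toFinset, rootMultiplicity a fm := by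
    have h := (IsAlgClosed.splits fm).natDegree_eq_card_roots
    rw [hfm, natDegree_map, ← hfm, hn] at h
    rw [h, ← Multiset.toFinset_sum_count_eq]
    simp
  conv_rhs => rw [h1]
  have h2 : ∀ k ∈ Finset.Icc 1 n, ((Ek Om k).filter (fun a => Na a k ∣ f)).card =
      ∑ a ∈ fm.roots.toFinset, if dg a ∣ k ∧ Na a k ∣ f then 1 else 0 := by
    intro k hk
    have hk := Finset.mem_Icc.1 hk
    rw [← Finset.card_filter]
    congr 1
    ext a
    simp only [Finset.mem_filter, mem_Ek hk.1, pow_eq_iff, Multiset.mem_toFinset, mem_roots hfm0]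
    constructor
    · rintro ⟨h3, h4⟩
      refine ⟨?_, h3, h4⟩
      rw [IsRoot, hfm, eval_map_algebraMap, ← minpoly.dvd_iff]
      refine dvd_trans (dvd_pow_self _ ?_) h4
      have := Nat.div_pos (Nat.le_of_dvd (by omega) h3) (dg_pos a)
      omega
    · rintro ⟨_, h3, h4⟩; exact ⟨h3, h4⟩
  rw [Finset.sum_congr rfl h2, Finset.sum_comm]
  refine Finset.sum_congr rfl fun a ha => ?_
  obtain ⟨v, hv, hv2⟩ := rootMult_eq a f hf0
  rw [hv, ← Finset.card_filter]
  have : (Finset.Icc 1 n).filter (fun k => dg a ∣ k ∧ Na a k ∣ f) =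
      (Finset.Icc 1 v).image (fun j => dg a * j) := by
    ext k
    simp only [Finset.mem_filter, Finset.mem_Icc, Finset.mem_image]
    have hd := dg_pos a
    constructor
    · rintro ⟨⟨h3, h4⟩, ⟨j, rfl⟩, h6⟩
      refine ⟨j, ⟨?_, ?_⟩, rfl⟩
      · rcases Nat.eq_zero_or_pos j with h | h
        · subst h; omega
        · exact h
      · rw [Na, Nat.mul_div_cancel_left _ hd] at h6
        exact (hv2 j).1 h6
    · rintro ⟨j, ⟨h3, h4⟩, rfl⟩
      have h5 := (hv2 j).2 h4
      refine ⟨⟨Nat.mul_pos hd h3, ?_⟩, ⟨j, rfl⟩, ?_⟩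
      · have := natDegree_le_of_dvd h5 hf0
        rw [natDegree_pow, hn, ← dg] at this
        linarith [mul_comm j (dg a)]
      · rwa [Na, Nat.mul_div_cancel_left _ hd]
  rw [this, Finset.card_image_of_injective _ (fun i j h => Nat.eq_of_mul_eq_mul_left (dg_pos a) h)]
  simp

lemma sum_mul_dvd (F : F2[X] → ℂ) (hFm : ∀ f g, f ≠ 0 → g ≠ 0 → F (f * g) = F f * F g)
    (g : F2[X]) (k n : ℕ) (hg : g ∈ Dn k) (hk : k ≤ n) :
    ∑ f ∈ (Dn n).filter (fun f => g ∣ f), F f = F g * ∑ h ∈ Dn (n - k), F h := by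
  obtain ⟨hg0, hgk⟩ := (mem_Dn' k g).1 hg
  rw [Finset.mul_sum]
  symm
  refine Finset.sum_bij (fun h _ => g * h) ?_ ?_ ?_ ?_
  · intro h hh
    obtain ⟨hh0, hhk⟩ := (mem_Dn' _ h).1 hh
    simp only [Finset.mem_filter, mem_Dn']
    refine ⟨⟨mul_ne_zero hg0 hh0, ?_⟩, Dvd.intro _ rfl⟩
    rw [natDegree_mul hg0 hh0]; omega
  · intro a _ b _ h; exact mul_left_cancel₀ hg0 h
  · intro f hf
    simp only [Finset.mem_filter, mem_Dn'] at hf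
    obtain ⟨⟨hf0, hfn⟩, h, rfl⟩ := hf
    have hh0 : h ≠ 0 := right_ne_zero_of_mul hf0
    refine ⟨h, ?_, rfl⟩
    rw [mem_Dn']
    rw [natDegree_mul hg0 hh0] at hfn
    exact ⟨hh0, by omega⟩
  · intro h hh
    rw [hFm _ _ hg0 ((mem_Dn' _ h).1 hh).1]

theorem rec_identity (F : F2[X] → ℂ) (hFm : ∀ f g, f ≠ 0 → g ≠ 0 → F (f * g) = F f * F g) (n : ℕ) :
    (n : ℂ) * ∑ f ∈ Dn n, F f = ∑ p ∈ Finset.HasAntidiagonal.antidiagonal n with p.1 < n,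
      (∑ f ∈ Dn p.1, F f) * ∑ a ∈ Ek Om p.2, F (Na a p.2) := by
  have h1 : (n : ℂ) * ∑ f ∈ Dn n, F f = ∑ k ∈ Finset.Icc 1 n, (∑ f ∈ Dn (n - k), F f) * ∑ a ∈ Ek Om k, F (Na a k) := by
    calc (n : ℂ) * ∑ f ∈ Dn n, F f = ∑ f ∈ Dn n, ∑ k ∈ Finset.Icc 1 n, ∑ a ∈ Ek Om k, if Na a k ∣ f then F f else 0 := by
          rw [Finset.mul_sum]
          refine Finset.sum_congr rfl fun f hf => ?_
          conv_lhs => rw [← count_identity f n hf]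
          push_cast
          rw [Finset.sum_mul]
          refine Finset.sum_congr rfl fun k _ => ?_
          rw [← Finset.sum_filter, Finset.sum_const, nsmul_eq_mul]
      _ = _ := by
          rw [Finset.sum_comm]
          refine Finset.sum_congr rfl fun k hk => ?_
          have hk := Finset.mem_Icc.1 hk
          rw [Finset.sum_comm, Finset.mul_sum]
          refine Finset.sum_congr rfl fun a ha => ?_
          rw [← Finset.sum_filter, sum_mul_dvd F hFm (Na a k) k n _ hk.2, mul_comm]
          rw [mem_Dn']
          rw [mem_Ek hk.1, pow_eq_iff] at ha
          exact ⟨(Na_monic a k).ne_zero, natDegree_Na a k ha⟩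
  rw [h1]
  refine Finset.sum_bij (fun k _ => (n - k, k)) ?_ ?_ ?_ ?_
  · intro k hk
    have hk := Finset.mem_Icc.1 hk
    simp; omega
  · intro a _ b _ h; exact (Prod.mk.inj h).2
  · rintro ⟨i, j⟩ h
    simp at h
    exact ⟨j, by simp; omega, by ext <;> simp; omega⟩
  · intro k hk; rfl

/-- conjugates -/
lemma minpoly_prod (a : Om) :
    (minpoly F2 a).map (algebraMap F2 Om) = ∏ i ∈ Finset.range (dg a), (X + C (a ^ (2 ^ i))) := by
  have hirr := minpoly.irreducible (int_a a)
  have hinj : Set.InjOn (fun i => a ^ (2 ^ i)) (Finset.range (dg a) : Set ℕ) := by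
    have key : ∀ i j, i < j → j < dg a → a ^ (2 ^ i) ≠ a ^ (2 ^ j) := by
      intro i j hij hj h
      have e : a ^ 2 ^ j = (a ^ 2 ^ (j - i)) ^ 2 ^ i := by
        rw [← pow_mul, ← pow_add]; congr 2; omega
      rw [e, ← iterateFrobenius_def, ← iterateFrobenius_def] at h
      have h2 := (iterateFrobenius Om 2 i).injective h
      have h3 := (pow_eq_iff a (j - i)).1 h2.symm
      have := Nat.le_of_dvd (by omega) h3
      omega
    intro i hi j hj h
    simp at hi hj
    rcases lt_trichotomy i j with h1 | h1 | h1
    · exact absurd h (key i j h1 hj)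
    · exact h1
    · exact absurd h.symm (key j i h1 hi)
  have hroot : ∀ i, ((minpoly F2 a).map (algebraMap F2 Om)).eval (a ^ 2 ^ i) = 0 := by
    intro i
    rw [eval_map_algebraMap]
    have := congrArg (iterateFrobenius Om 2 i) (minpoly.aeval F2 a)
    rw [map_zero, aeval_def, hom_eval₂, iterateFrobenius_def] at this
    rw [aeval_def, ← this]
    congr 1
    exact Subsingleton.elim _ _
  have e : ∏ i ∈ Finset.range (dg a), (X + C (a ^ (2 ^ i))) =
      ∏ b ∈ (Finset.range (dg a)).image (fun i => a ^ (2 ^ i)), (X - C b) := by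
    rw [Finset.prod_image hinj]
    refine Finset.prod_congr rfl fun i _ => ?_
    rw [CharTwo.sub_eq_add]
  have hdvd : ∏ i ∈ Finset.range (dg a), (X + C (a ^ (2 ^ i))) ∣ (minpoly F2 a).map (algebraMap F2 Om) := by
    rw [e]
    refine Finset.prod_dvd_of_coprime (fun b _ c _ hbc => pairwise_coprime_X_sub_C Function.injective_id hbc) ?_
    intro b hb
    obtain ⟨i, _, rfl⟩ := Finset.mem_image.1 hb
    exact dvd_iff_isRoot.2 (hroot i)
  have hm : (∏ i ∈ Finset.range (dg a), (X + C (a ^ (2 ^ i)))).Monic :=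
    monic_prod_of_monic _ _ fun i _ => monic_X_add_C _
  refine eq_of_monic_of_dvd_of_natDegree_le hm ((minpoly.monic (int_a a)).map _) hdvd ?_
  rw [natDegree_map, natDegree_prod_of_monic _ _ fun i _ => monic_X_add_C _]
  simp only [natDegree_X_add_C]
  simp [dg]

end S8

namespace S8

def Hm {S M : Type*} [CommRing S] [Ring M] [Algebra S M] (M0 M1 : M) (d : ℕ) (p : S[X]) : M :=
  ∑ j ∈ Finset.range (d + 1), p.coeff j • (M0 ^ j * M1 ^ (d - j))

lemma Hm_step {S M : Type*} [CommRing S] [Ring M] [Algebra S M] (M0 M1 : M) (hc : Commute M0 M1)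
    (d : ℕ) (p : S[X]) (hp : p.natDegree ≤ d) (a : S) :
    Hm M0 M1 (d + 1) ((X + C a) * p) = (M0 + a • M1) * Hm M0 M1 d p := by
  have h1 : ∑ j ∈ Finset.range (d + 1 + 1), (X * p).coeff j • (M0 ^ j * M1 ^ (d + 1 - j)) =
      M0 * Hm M0 M1 d p := by
    rw [Finset.sum_range_succ']
    simp only [coeff_X_mul, coeff_X_mul_zero, zero_smul, add_zero, Hm, Finset.mul_sum]
    refine Finset.sum_congr rfl fun j _ => ?_
    rw [mul_smul_comm, ← mul_assoc, ← pow_succ', Nat.add_sub_add_right]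
  have h2 : ∑ j ∈ Finset.range (d + 1 + 1), (C a * p).coeff j • (M0 ^ j * M1 ^ (d + 1 - j)) =
      (a • M1) * Hm M0 M1 d p := by
    rw [Finset.sum_range_succ]
    have : p.coeff (d + 1) = 0 := coeff_eq_zero_of_natDegree_lt (by omega)
    simp only [coeff_C_mul, this, mul_zero, zero_smul, add_zero, Hm, Finset.mul_sum]
    refine Finset.sum_congr rfl fun j hj => ?_
    have hj := Finset.mem_range.1 hj
    have e : d + 1 - j = (d - j) + 1 := by omega
    rw [e, pow_succ', ← mul_assoc, ((hc.pow_left j).eq), mul_smul_comm, smul_mul_assoc, smul_smul,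
      mul_assoc, mul_comm a]
  rw [add_mul M0, ← h1, ← h2, Hm, ← Finset.sum_add_distrib]
  refine Finset.sum_congr rfl fun j _ => ?_
  rw [add_mul, coeff_add, add_smul]

section
variable {R ι : Type*} [CommRing R] [Algebra F2 R] [Fintype ι] (bR : Module.Basis ι F2 R)
  (c0 c1 : R)

lemma NM_Hm (S : Type*) [CommRing S] [Nontrivial S] [Algebra F2 S] (a : S) (k : ℕ) :
    NM bR c0 c1 S a k = Hm (BS bR S c0) (BS bR S c1) k (∏ i ∈ Finset.range k, (X + C (a ^ (2 ^ i)))) := by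
  induction k with
  | zero => simp [NM, Hm]
  | succ k ih =>
    rw [NM, ih, Finset.prod_range_succ, mul_comm (∏ i ∈ Finset.range k, _) _]
    rw [Hm_step]
    · exact (Commute.all c0 c1).map (BS bR S)
    · rw [natDegree_prod_of_monic _ _ fun i _ => monic_X_add_C _]
      simp only [natDegree_X_add_C]
      simp

lemma BS_Hm (S : Type*) [CommRing S] [Nontrivial S] [Algebra F2 S] (k : ℕ) (p : F2[X]) :
    BS bR S (Hm c0 c1 k p) = Hm (BS bR S c0) (BS bR S c1) k (p.map (algebraMap F2 S)) := by
  rw [Hm, Hm, map_sum]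
  refine Finset.sum_congr rfl fun j _ => ?_
  have hc : ∀ c : F2, c = 0 ∨ c = 1 := by decide
  rw [coeff_map]
  rcases hc (p.coeff j) with h | h <;> simp [h]

lemma BS_inj (S : Type*) [CommRing S] [Nontrivial S] [Algebra F2 S] : Function.Injective (BS bR S) := by
  intro x y h
  apply Algebra.leftMulMatrix_injective bR
  have hinj : Function.Injective (algebraMap F2 S) := (algebraMap F2 S).injective
  ext i j
  have := congrFun (congrFun h i) j
  exact hinj this

end

abbrev RR (s : F2[X]) (l : ℕ) := AdjoinRoot s × AdjoinRoot (X ^ (l + 1) : F2[X])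

def pii (s : F2[X]) (l : ℕ) (f : F2[X]) : RR s l :=
  (AdjoinRoot.mk s f, AdjoinRoot.mk (X ^ (l + 1) : F2[X]) f.reverse)

def c0 (s : F2[X]) (l : ℕ) : RR s l := (AdjoinRoot.root s, 1)
def c1 (s : F2[X]) (l : ℕ) : RR s l := (1, AdjoinRoot.root (X ^ (l + 1) : F2[X]))

lemma pii_mul (s : F2[X]) (l : ℕ) (f g : F2[X]) : pii s l (f * g) = pii s l f * pii s l g := by
  simp [pii, reverse_mul_of_domain]

lemma pii_one (s : F2[X]) (l : ℕ) : pii s l 1 = 1 := by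
  have : (1 : F2[X]).reverse = 1 := by rw [← C_1, reverse_C]
  simp [pii, this]

lemma pii_pow (s : F2[X]) (l : ℕ) (f : F2[X]) (n : ℕ) : pii s l (f ^ n) = pii s l f ^ n := by
  induction n with
  | zero => simp [pii_one]
  | succ n ih => rw [pow_succ, pii_mul, ih]; exact (pow_succ _ _).symm

lemma pii_Hm (s : F2[X]) (l : ℕ) (f : F2[X]) : pii s l f = Hm (c0 s l) (c1 s l) f.natDegree f := by
  rw [Hm]
  apply Prod.ext
  · rw [Prod.fst_sum, pii]
    simp only [c0, c1, Prod.smul_fst, Prod.fst_mul, Prod.pow_fst, one_pow, mul_one]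
    rw [← AdjoinRoot.aeval_eq, aeval_eq_sum_range]
  · rw [Prod.snd_sum, pii]
    simp only [c0, c1, Prod.smul_snd, Prod.snd_mul, Prod.pow_snd, one_pow, one_mul]
    rw [← AdjoinRoot.aeval_eq, aeval_eq_sum_range' (n := f.natDegree + 1)
      (Nat.lt_succ_of_le (reverse_natDegree_le f)), ← Finset.sum_range_reflect]
    refine Finset.sum_congr rfl fun j hj => ?_
    have hj := Finset.mem_range.1 hj
    have e : f.natDegree + 1 - 1 - j = f.natDegree - j := by omega
    rw [e, coeff_reverse, revAt_le (by omega)]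
    congr 2; omega

lemma NM_pii (s : F2[X]) (l : ℕ) {ι : Type*} [Fintype ι] (bR : Module.Basis ι F2 (RR s l))
    (a : Om) (k : ℕ) (hk : dg a ∣ k) :
    NM bR (c0 s l) (c1 s l) Om a k = BS bR Om (pii s l (Na a k)) := by
  have h1 : NM bR (c0 s l) (c1 s l) Om a (dg a) = BS bR Om (pii s l (minpoly F2 a)) := by
    rw [NM_Hm, pii_Hm, BS_Hm, minpoly_prod]; rfl
  have h2 := NM_mul bR (c0 s l) (c1 s l) a (dg a) _ ((pow_eq_iff a _).2 dvd_rfl) h1 (k / dg a)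
  rw [Nat.mul_div_cancel' hk, ← pii_pow] at h2
  exact h2

lemma isUnit_mk (s f : F2[X]) : IsUnit (AdjoinRoot.mk s f) ↔ IsCoprime f s := by
  constructor
  · intro h
    obtain ⟨b, hb⟩ := h.exists_left_inv
    obtain ⟨g, rfl⟩ := AdjoinRoot.mk_surjective b
    rw [← map_mul, ← map_one (AdjoinRoot.mk s), AdjoinRoot.mk_eq_mk] at hb
    obtain ⟨c, hc⟩ := hb
    exact ⟨g, -c, by linear_combination hc⟩
  · rintro ⟨a, b, h⟩
    have := congrArg (AdjoinRoot.mk s) h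
    simp at this
    exact IsUnit.of_mul_eq_one_right _ this

lemma isUnit_pii (s : F2[X]) (l : ℕ) (f : F2[X]) (hf : f ≠ 0) : IsUnit (pii s l f) ↔ IsCoprime f s := by
  rw [Prod.isUnit_iff, pii, isUnit_mk, isUnit_mk, and_iff_left]
  apply IsCoprime.pow_right
  refine IsCoprime.symm ?_
  rw [Irreducible.coprime_iff_not_dvd irreducible_X, X_dvd_iff, coeff_zero_reverse, leadingCoeff_eq_zero]
  exact hf

lemma finite_adj (s : F2[X]) (hs : s ≠ 0) : Module.Finite F2 (AdjoinRoot s) :=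
  (AdjoinRoot.powerBasis hs).finite

lemma finite_RR (s : F2[X]) (hs : s ≠ 0) (l : ℕ) : Module.Finite F2 (RR s l) := by
  haveI := finite_adj s hs
  haveI := finite_adj (X ^ (l + 1) : F2[X]) (pow_ne_zero _ X_ne_zero)
  infer_instance

lemma nonunit_card (s : F2[X]) (hs : s ≠ 0) (l k : ℕ) [Fintype (RR s l)] (hk : 1 ≤ k) :
    ((Ek Om k).filter (fun a => ¬ IsUnit (pii s l (Na a k)))).card ≤ s.natDegree := by
  have hs' : s.map (algebraMap F2 Om) ≠ 0 := by rwa [Ne, Polynomial.map_eq_zero]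
  have : (Ek Om k).filter (fun a => ¬ IsUnit (pii s l (Na a k))) ⊆ (s.map (algebraMap F2 Om)).roots.toFinset := by
    intro a ha
    rw [Finset.mem_filter, isUnit_pii _ _ _ (Na_monic a k).ne_zero] at ha
    rw [Multiset.mem_toFinset, mem_roots hs', IsRoot, eval_map_algebraMap, ← minpoly.dvd_iff]
    by_contra hcon
    apply ha.2
    exact (((minpoly.irreducible (int_a a)).coprime_iff_not_dvd).2 hcon).pow_left
  calc _ ≤ _ := Finset.card_le_card this
    _ ≤ _ := Multiset.toFinset_card_le _
    _ ≤ _ := card_roots' _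
    _ = _ := natDegree_map _

lemma psi_cnt (s : F2[X]) (l : ℕ) [Fintype (RR s l)] {ι : Type*} [Fintype ι] (bR : Module.Basis ι F2 (RR s l))
    (k : ℕ) (hk : 1 ≤ k) (g : RR s l) :
    cnt bR (c0 s l) (c1 s l) Om k g = ((Ek Om k).filter (fun a => pii s l (Na a k) = g)).card := by
  rw [cnt]
  congr 1
  refine Finset.filter_congr fun a ha => ?_
  rw [mem_Ek hk, pow_eq_iff] at ha
  rw [NM_pii s l bR a k ha, (BS_inj bR Om).eq_iff]

lemma sum_units {R : Type*} [CommRing R] [Fintype R] [Fintype Rˣ] {A : Type*} [AddCommMonoid A] (F : R → A) (hF : ∀ r, ¬ IsUnit r → F r = 0) :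
    ∑ g : Rˣ, F g = ∑ r, F r := by
  rw [← Finset.sum_filter_add_sum_filter_not Finset.univ (fun r : R => IsUnit r) F]
  rw [Finset.sum_eq_zero (s := Finset.univ.filter (fun r : R => ¬ IsUnit r))
    (fun r hr => hF r (Finset.mem_filter.1 hr).2), add_zero]
  refine Finset.sum_bij (fun g _ => (g : R)) ?_ ?_ ?_ ?_
  · intro g _; simp
  · intro a _ b _ h; exact Units.ext h
  · intro r hr
    obtain ⟨u, hu⟩ := (Finset.mem_filter.1 hr).2
    exact ⟨u, Finset.mem_univ _, hu⟩
  · intro g _; rfl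

theorem psi_lower (s : F2[X]) (hs : s ≠ 0) (l : ℕ) [Fintype (RR s l)] :
    ∃ (E C n0 : ℕ), 1 ≤ E ∧ ∀ n, n0 ≤ n → ∀ χ : MulChar (RR s l) ℂ,
      -(C : ℝ) * 2 ^ (E * n) ≤ (∑ a ∈ Ek Om (E * (2 * n)), χ (pii s l (Na a (E * (2 * n))))).re := by
  haveI := finite_RR s hs l
  let bR := Module.finBasis F2 (RR s l)
  have hC0 : ∀ k, 1 ≤ k → 2 ^ k ≤ ∑ g : (RR s l)ˣ, cnt bR (c0 s l) (c1 s l) Om k (g : RR s l) + s.natDegree := by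
    intro k hk
    rw [← card_Ek (Ω := Om) hk]
    have h1 := Finset.card_filter_add_card_filter_not (s := Ek Om k) (fun a => IsUnit (pii s l (Na a k)))
    have h2 := nonunit_card s hs l k hk
    have h3 : ((Ek Om k).filter (fun a => IsUnit (pii s l (Na a k)))).card =
        ∑ g : (RR s l)ˣ, cnt bR (c0 s l) (c1 s l) Om k (g : RR s l) := by
      rw [Finset.card_eq_sum_card_fiberwise (f := fun a => pii s l (Na a k)) (t := Finset.univ) (by intro x _; simp)]
      rw [← sum_units]
      · refine Finset.sum_congr rfl fun g _ => ?_
        rw [psi_cnt s l bR k hk, Finset.filter_filter]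
        congr 1
        refine Finset.filter_congr fun a ha => ?_
        constructor
        · exact fun h => h.2
        · intro h; exact ⟨by rw [h]; exact g.isUnit, h⟩
      · intro r hr
        rw [Finset.card_eq_zero, Finset.filter_eq_empty_iff]
        intro a ha h
        exact hr (h ▸ (Finset.mem_filter.1 ha).2)
    omega
  obtain ⟨a0, g0, ha0, hg0⟩ : ∃ (a0 : Om) (g0 : (RR s l)ˣ), a0 ^ (2 ^ (s.natDegree + 1)) = a0 ∧
      NM bR (c0 s l) (c1 s l) Om a0 (s.natDegree + 1) = BS bR Om (g0 : RR s l) := by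
    have h1 := hC0 (s.natDegree + 1) (by omega)
    have h2 : s.natDegree + 1 < 2 ^ (s.natDegree + 1) := Nat.lt_two_pow_self
    have h3 : ∑ g : (RR s l)ˣ, cnt bR (c0 s l) (c1 s l) Om (s.natDegree + 1) (g : RR s l) ≠ 0 := by omega
    obtain ⟨g, _, hg⟩ := Finset.exists_ne_zero_of_sum_ne_zero h3
    rw [cnt] at hg
    obtain ⟨a, ha⟩ := Finset.card_pos.1 (Nat.pos_of_ne_zero hg)
    rw [Finset.mem_filter, mem_Ek (by omega)] at ha
    exact ⟨a, g, ha.1, ha.2⟩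
  obtain ⟨E, C, n0, hE, h⟩ := weil_core bR (c0 s l) (c1 s l) a0 (s.natDegree + 1) (by omega) ha0 g0 hg0 s.natDegree hC0
  refine ⟨E, C, n0 + 1, hE, fun n hn χ => ?_⟩
  have h1 := h n (by omega) (χ.toMonoidHom.comp (Units.coeHom _))
  refine h1.trans (le_of_eq ?_)
  congr 1
  have hk : 1 ≤ E * (2 * n) := Nat.mul_pos hE (by omega)
  have h2 := sum_units (fun r : RR s l => χ r * (cnt bR (c0 s l) (c1 s l) Om (E * (2 * n)) r : ℂ))
    (fun r hr => by rw [χ.map_nonunit hr, zero_mul])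
  refine Eq.trans h2 ?_
  rw [← Finset.sum_fiberwise (Ek Om (E * (2 * n))) (fun a => pii s l (Na a (E * (2 * n))))]
  refine Finset.sum_congr rfl fun r _ => ?_
  rw [psi_cnt s l bR _ hk, Finset.sum_congr rfl (fun a ha => by rw [(Finset.mem_filter.1 ha).2] : ∀ a ∈ _, _ = χ r),
    Finset.sum_const, nsmul_eq_mul, mul_comm]

end S8

namespace S8

lemma F2_cases (c : F2) : c = 0 ∨ c = 1 := by revert c; decide

lemma reverse_Dn {n : ℕ} {f : F2[X]} (hf : f ∈ Dn n) : f.reverse = reflect n f := by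
  rw [mem_Dn'] at hf
  rw [reverse, hf.2]

lemma mk_X_eq (l : ℕ) (f g : F2[X]) (h : ∀ i, i < l + 1 → f.coeff i = g.coeff i) :
    AdjoinRoot.mk (X ^ (l + 1) : F2[X]) f = AdjoinRoot.mk (X ^ (l + 1) : F2[X]) g := by
  rw [AdjoinRoot.mk_eq_mk, X_pow_dvd_iff]
  intro d hd
  rw [coeff_sub, h d hd, sub_self]

lemma lift_exists (s : F2[X]) (hs : s ≠ 0) (l n : ℕ) (hn : s.natDegree + l + 1 ≤ n) (r : RR s l) (hr : IsUnit r) :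
    ∃ f ∈ Dn n, pii s l f = r := by
  obtain ⟨u, v⟩ := r
  obtain ⟨p, rfl⟩ := AdjoinRoot.mk_surjective u
  obtain ⟨w, rfl⟩ := AdjoinRoot.mk_surjective v
  have hw : w.coeff 0 = 1 := by
    have h := (Prod.isUnit_iff.1 hr).2
    rw [isUnit_mk] at h
    have h2 : IsCoprime w X := h.of_isCoprime_of_dvd_right (dvd_pow_self _ (by omega))
    rcases F2_cases (w.coeff 0) with h3 | h3
    · exfalso
      have := X_dvd_iff.2 h3
      exact irreducible_X.not_isUnit (h2.symm.isUnit_of_dvd' dvd_rfl this)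
    · exact h3
  have hXm : (X ^ (l + 1) : F2[X]).Monic := monic_X_pow _
  set wr : F2[X] := ∑ i ∈ Finset.range (l + 1), C (w.coeff i) * X ^ i with hwr
  have hwc : ∀ i, wr.coeff i = if i < l + 1 then w.coeff i else 0 := by
    intro i
    simp only [hwr, finsetSum_coeff, coeff_C_mul_X_pow]
    simp [Finset.sum_ite_eq]
  set h2 := (p - reflect n wr) %ₘ s with hh2
  have hsm := F2_monic hs
  have hdeg : h2.degree < s.degree := degree_modByMonic_lt _ hsm
  have hc2 : ∀ i, s.natDegree ≤ i → h2.coeff i = 0 := by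
    intro i hi
    apply coeff_eq_zero_of_degree_lt
    refine hdeg.trans_le ?_
    rw [degree_eq_natDegree hs]; exact_mod_cast hi
  have hfD : reflect n wr + h2 ∈ Dn n := by
    rw [mem_Dn]
    refine degree_eq_of_le_of_coeff_ne_zero ?_ ?_
    · rw [degree_le_iff_coeff_zero]
      intro i hi
      have hi : n < i := by exact_mod_cast hi
      rw [coeff_add, coeff_reflect, hc2 i (by omega), add_zero, hwc]
      have : revAt n i = i := revAt_eq_self_of_lt hi
      rw [this, if_neg (by omega)]
    · rw [coeff_add, coeff_reflect, hc2 n (by omega), revAt_le le_rfl, hwc]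
      simp [hw]
  refine ⟨_, hfD, ?_⟩
  rw [pii, reverse_Dn hfD]
  apply Prod.ext
  · simp only
    rw [AdjoinRoot.mk_eq_mk, hh2, modByMonic_eq_sub_mul_div]
    exact ⟨-((p - reflect n wr) /ₘ s), by ring⟩
  · simp only
    apply mk_X_eq
    intro i hi
    rw [coeff_reflect, coeff_add, coeff_reflect, revAt_invol, hwc, if_pos hi, revAt_le (by omega), hc2 _ (by omega),
      add_zero]

lemma fiber_card (s : F2[X]) (l n : ℕ) (f0 : F2[X]) (hf0 : f0 ∈ Dn n) :
    ((Dn n).filter (fun f => pii s l f = pii s l f0)).card =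
      ((GN n).filter (fun h => AdjoinRoot.mk s h = 0 ∧ AdjoinRoot.mk (X ^ (l + 1) : F2[X]) (reflect n h) = 0)).card := by
  symm
  refine Finset.card_bij (fun h _ => f0 + h) ?_ ?_ ?_
  · intro h hh
    rw [Finset.mem_filter, mem_GN] at hh
    have hD : f0 + h ∈ Dn n := by
      rw [mem_Dn] at hf0 ⊢
      rw [degree_add_eq_left_of_degree_lt (by rw [hf0]; exact hh.1), hf0]
    rw [Finset.mem_filter]
    refine ⟨hD, ?_⟩
    rw [pii, pii, reverse_Dn hD, reverse_Dn hf0, reflect_add, map_add, map_add, hh.2.1, hh.2.2, add_zero, add_zero]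
  · intro a _ b _ h; exact add_left_cancel h
  · intro f hf
    rw [Finset.mem_filter] at hf
    refine ⟨f - f0, ?_, by ring⟩
    obtain ⟨h1, h2⟩ := hf
    rw [pii, pii, reverse_Dn h1, reverse_Dn hf0] at h2
    obtain ⟨h3, h4⟩ := Prod.mk.inj h2
    rw [Finset.mem_filter, mem_GN, reflect_sub, map_sub, map_sub, h3, h4, sub_self, sub_self]
    refine ⟨?_, rfl, rfl⟩
    have e1 := (mem_Dn n f).1 h1
    have e2 := (mem_Dn n f0).1 hf0
    have := degree_sub_lt (p := f) (q := f0) (by rw [e1, e2]) ((mem_Dn' n f).1 h1).1 (by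
      rw [(F2_monic ((mem_Dn' n f).1 h1).1).leadingCoeff, (F2_monic ((mem_Dn' n f0).1 hf0).1).leadingCoeff])
    rwa [e1] at this

lemma A_vanish (s : F2[X]) (hs : s ≠ 0) (l n : ℕ) (hn : s.natDegree + l + 1 ≤ n) [Fintype (RR s l)]
    (χ : MulChar (RR s l) ℂ) (hχ : χ ≠ 1) : ∑ f ∈ Dn n, χ (pii s l f) = 0 := by
  set K := ((GN n).filter (fun h => AdjoinRoot.mk s h = 0 ∧ AdjoinRoot.mk (X ^ (l + 1) : F2[X]) (reflect n h) = 0)).card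
  rw [← Finset.sum_fiberwise (Dn n) (fun f => pii s l f)]
  have : ∀ r ∈ (Finset.univ : Finset (RR s l)), ∑ f ∈ (Dn n).filter (fun f => pii s l f = r), χ (pii s l f) = K * χ r := by
    intro r _
    rw [Finset.sum_congr rfl (fun a ha => by rw [(Finset.mem_filter.1 ha).2] : ∀ a ∈ _, _ = χ r),
      Finset.sum_const, nsmul_eq_mul]
    by_cases hr : IsUnit r
    · obtain ⟨f0, hf0, rfl⟩ := lift_exists s hs l n hn r hr
      rw [fiber_card s l n f0 hf0]
    · rw [χ.map_nonunit hr, mul_zero, mul_zero]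
  rw [Finset.sum_congr rfl this, ← Finset.mul_sum, MulChar.sum_eq_zero_of_ne_one hχ, mul_zero]

lemma Dn_zero : Dn 0 = {1} := by
  ext f
  rw [mem_Dn, Finset.mem_singleton]
  constructor
  · intro h
    have h1 : f ≠ 0 := by rintro rfl; simp at h
    exact eq_one_of_monic_natDegree_zero (F2_monic h1) (natDegree_eq_of_degree_eq_some h)
  · rintro rfl; simp

theorem weil (s : F2[X]) (hs : s ≠ 0) (l : ℕ) [Fintype (RR s l)] (χ : MulChar (RR s l) ℂ) (hχ : χ ≠ 1)
    (k : ℕ) (hk : 1 ≤ k) :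
    ‖∑ a ∈ Ek Om k, χ (pii s l (Na a k))‖ ^ 2 ≤ ((s.natDegree + l : ℕ) : ℝ) ^ 2 * 2 ^ k := by
  obtain ⟨E, C, n0, hE, h⟩ := psi_lower s hs l
  refine rh_analytic (fun n => ∑ f ∈ Dn n, χ (pii s l f)) (fun k => ∑ a ∈ Ek Om k, χ (pii s l (Na a k)))
    (s.natDegree + l) ?_ ?_ ?_ E C n0 hE (fun n hn => h n hn χ) k hk
  · simp [Dn_zero, pii_one]
  · intro n hn; exact A_vanish s hs l n (by omega) χ hχ
  · intro n _
    exact rec_identity (fun f => χ (pii s l f)) (fun f g _ _ => by simp only [pii_mul, map_mul]) n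

end S8

namespace S8

lemma parseval_eq {α : Type*} [AddCommGroup α] [Fintype α] (c : α → ℝ) :
    ∑ ψ : AddChar α ℂ, ‖∑ a, ψ a * c a‖ ^ 2 = Fintype.card α * ∑ a, c a ^ 2 := by
  have h : ∑ ψ : AddChar α ℂ, ((∑ a, ψ a * c a) * (starRingEnd ℂ) (∑ b, ψ b * c b)) =
      Fintype.card α * ∑ a, (c a : ℂ) ^ 2 := by
    calc _ = ∑ ψ : AddChar α ℂ, ∑ a, ∑ b, (c a * c b : ℂ) * ψ (a - b) := by
          refine Finset.sum_congr rfl fun ψ _ => ?_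
          rw [map_sum, Finset.sum_mul_sum]
          refine Finset.sum_congr rfl fun a _ => Finset.sum_congr rfl fun b _ => ?_
          rw [map_mul, Complex.conj_ofReal, ← AddChar.map_neg_eq_conj, sub_eq_add_neg, AddChar.map_add_eq_mul]
          ring
      _ = ∑ a, ∑ b, (c a * c b : ℂ) * ∑ ψ : AddChar α ℂ, ψ (a - b) := by
          rw [Finset.sum_comm]
          refine Finset.sum_congr rfl fun a _ => ?_
          rw [Finset.sum_comm]
          refine Finset.sum_congr rfl fun b _ => ?_
          rw [Finset.mul_sum]
      _ = _ := by
          rw [Finset.mul_sum]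
          refine Finset.sum_congr rfl fun a _ => ?_
          rw [Finset.sum_eq_single a]
          · rw [sub_self, AddChar.sum_apply_eq_ite, if_pos rfl]; ring
          · intro b _ hb
            rw [AddChar.sum_apply_eq_ite, if_neg (sub_ne_zero.2 hb.symm), mul_zero]
          · simp
  have h2 : ((∑ ψ : AddChar α ℂ, ‖∑ a, ψ a * c a‖ ^ 2 : ℝ) : ℂ) = ((Fintype.card α * ∑ a, c a ^ 2 : ℝ) : ℂ) := by
    push_cast
    rw [← h]
    refine Finset.sum_congr rfl fun ψ _ => ?_
    rw [Complex.mul_conj']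
  exact_mod_cast h2

lemma variance {α : Type*} [AddCommGroup α] [Fintype α] (c : α → ℝ) (B : ℝ) (hB : 0 ≤ B)
    (h : ∀ ψ : AddChar α ℂ, ψ ≠ 0 → ‖∑ a, ψ a * c a‖ ^ 2 ≤ B) :
    ∑ a, (c a - (∑ b, c b) / Fintype.card α) ^ 2 ≤ B := by
  have hcard : (0 : ℝ) < Fintype.card α := by exact_mod_cast Fintype.card_pos
  set m := (∑ b, c b) / Fintype.card α with hm
  have h1 := parseval_eq (fun a => c a - m)
  have h2 : ∀ ψ : AddChar α ℂ, ‖∑ a, ψ a * ((c a - m : ℝ) : ℂ)‖ ^ 2 ≤ B := by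
    intro ψ
    by_cases hψ : ψ = 0
    · have : ∑ a, ψ a * ((c a - m : ℝ) : ℂ) = 0 := by
        subst hψ
        simp only [AddChar.zero_apply, one_mul]
        rw [← Complex.ofReal_sum, Finset.sum_sub_distrib, Finset.sum_const, Finset.card_univ, nsmul_eq_mul, hm,
          mul_div_cancel₀ _ hcard.ne', sub_self, Complex.ofReal_zero]
      rw [this]; simpa using hB
    · have : ∑ a, ψ a * ((c a - m : ℝ) : ℂ) = ∑ a, ψ a * c a := by
        push_cast
        simp only [mul_sub, Finset.sum_sub_distrib]
        rw [← Finset.sum_mul, AddChar.sum_eq_zero_iff_ne_zero.2 hψ, zero_mul, sub_zero]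
      rw [this]; exact h ψ hψ
  have h3 : ∑ ψ : AddChar α ℂ, ‖∑ a, ψ a * ((c a - m : ℝ) : ℂ)‖ ^ 2 ≤ ∑ ψ : AddChar α ℂ, B :=
    Finset.sum_le_sum fun ψ _ => h2 ψ
  rw [h1, Finset.sum_const, Finset.card_univ, AddChar.card_eq, nsmul_eq_mul] at h3
  exact le_of_mul_le_mul_left h3 hcard

def toMC {R : Type*} [CommRing R] (ψ : AddChar (Additive Rˣ) ℂ) : MulChar R ℂ :=
  MulChar.ofUnitHom (MonoidHom.toHomUnits
    ({ toFun := fun g => ψ (Additive.ofMul g)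
       map_one' := by simp
       map_mul' := fun a b => by rw [ofMul_mul, AddChar.map_add_eq_mul] } : Rˣ →* ℂ))

lemma toMC_coe {R : Type*} [CommRing R] (ψ : AddChar (Additive Rˣ) ℂ) (g : Rˣ) :
    toMC ψ (g : R) = ψ (Additive.ofMul g) := by
  rw [toMC, MulChar.ofUnitHom_coe]; rfl

lemma toMC_ne {R : Type*} [CommRing R] (ψ : AddChar (Additive Rˣ) ℂ) (h : ψ ≠ 0) : toMC ψ ≠ 1 := by
  intro h1
  apply h
  ext g
  have := toMC_coe ψ g.toMul
  rw [h1, MulChar.one_apply_coe] at this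
  exact this.symm

/-- number of a with image g -/
def TT (s : F2[X]) (l n : ℕ) (g : RR s l) : ℕ := ((Ek Om n).filter (fun a => pii s l (Na a n) = g)).card

lemma sum_TT (s : F2[X]) (l n : ℕ) [Fintype (RR s l)] (F : RR s l → ℂ) (hF : ∀ r, ¬ IsUnit r → F r = 0) :
    ∑ g : (RR s l)ˣ, F g * TT s l n g = ∑ a ∈ Ek Om n, F (pii s l (Na a n)) := by
  rw [sum_units (fun r : RR s l => F r * (TT s l n r : ℂ)) (fun r hr => by rw [hF r hr, zero_mul])]
  rw [← Finset.sum_fiberwise (Ek Om n) (fun a => pii s l (Na a n))]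
  refine Finset.sum_congr rfl fun r _ => ?_
  rw [TT, Finset.sum_congr rfl (fun a ha => by rw [(Finset.mem_filter.1 ha).2] : ∀ a ∈ _, _ = F r),
    Finset.sum_const, nsmul_eq_mul, mul_comm]

theorem variance_TT (s : F2[X]) (hs : s ≠ 0) (l : ℕ) [Fintype (RR s l)] (n : ℕ) (hn : 1 ≤ n) :
    ∑ g : (RR s l)ˣ, ((TT s l n g : ℝ) - (∑ h : (RR s l)ˣ, (TT s l n h : ℝ)) / Fintype.card (RR s l)ˣ) ^ 2 ≤
      ((s.natDegree + l : ℕ) : ℝ) ^ 2 * 2 ^ n := by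
  have := variance (α := Additive (RR s l)ˣ) (fun g => (TT s l n (g.toMul : RR s l) : ℝ))
    (((s.natDegree + l : ℕ) : ℝ) ^ 2 * 2 ^ n) (by positivity) ?_
  · have e1 : ∑ b : Additive (RR s l)ˣ, (TT s l n ((Additive.toMul b : (RR s l)ˣ) : RR s l) : ℝ) =
        ∑ h : (RR s l)ˣ, (TT s l n h : ℝ) := Fintype.sum_equiv Additive.toMul _ _ fun g => rfl
    rw [Fintype.card_congr (Additive.toMul (α := (RR s l)ˣ)), e1] at this
    refine le_trans (le_of_eq ?_) this
    exact (Fintype.sum_equiv Additive.toMul _ _ fun g => rfl).symm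
  · intro ψ hψ
    have h1 := weil s hs l (toMC ψ) (toMC_ne ψ hψ) n hn
    rw [← sum_TT s l n (fun r => toMC ψ r) (fun r hr => (toMC ψ).map_nonunit hr)] at h1
    refine le_trans (le_of_eq ?_) h1
    congr 2
    refine Fintype.sum_equiv Additive.toMul _ _ fun g => ?_
    rw [toMC_coe]; rfl

theorem equidist (s : F2[X]) (hs : s ≠ 0) (l : ℕ) [Fintype (RR s l)] (n : ℕ) (hn : 1 ≤ n)
    (w : RR s l → ℝ) (hw : ∀ r, |w r| ≤ 1) :
    |∑ g : (RR s l)ˣ, w g * TT s l n g - (∑ h : (RR s l)ˣ, (TT s l n h : ℝ)) / Fintype.card (RR s l)ˣ * ∑ g : (RR s l)ˣ, w g|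
      ≤ Real.sqrt (Fintype.card (RR s l)ˣ) * ((s.natDegree + l : ℕ) * Real.sqrt (2 ^ n)) := by
  set m := (∑ h : (RR s l)ˣ, (TT s l n h : ℝ)) / Fintype.card (RR s l)ˣ with hm
  have hv := variance_TT s hs l n hn
  rw [← hm] at hv
  have e : ∑ g : (RR s l)ˣ, w g * TT s l n g - m * ∑ g : (RR s l)ˣ, w g =
      ∑ g : (RR s l)ˣ, w g * ((TT s l n g : ℝ) - m) := by
    rw [Finset.mul_sum, ← Finset.sum_sub_distrib]
    exact Finset.sum_congr rfl fun g _ => by ring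
  rw [e]
  apply abs_le_of_sq_le_sq _ (by positivity)
  have hcs := Finset.sum_mul_sq_le_sq_mul_sq Finset.univ (fun g : (RR s l)ˣ => w g) (fun g => (TT s l n g : ℝ) - m)
  refine hcs.trans ?_
  rw [mul_pow, mul_pow, Real.sq_sqrt (by positivity), Real.sq_sqrt (by positivity)]
  refine mul_le_mul ?_ hv (Finset.sum_nonneg fun _ _ => sq_nonneg _) (by positivity)
  calc ∑ g : (RR s l)ˣ, w g ^ 2 ≤ ∑ g : (RR s l)ˣ, (1 : ℝ) := Finset.sum_le_sum fun g _ => by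
        rw [← sq_abs]; exact pow_le_one₀ (abs_nonneg _) (hw g)
    _ = _ := by simp

end S8

namespace S8

lemma prime_slice (n : ℕ) (hn : 1 ≤ n) (W : F2[X] → ℝ) :
    ∑ f ∈ (Dn n).filter (fun f => Irreducible f), (n : ℝ) * W f =
      ∑ a ∈ (Ek Om n).filter (fun a => dg a = n), W (Na a n) := by
  have hmap : ∀ a ∈ (Ek Om n).filter (fun a => dg a = n), minpoly F2 a ∈ (Dn n).filter (fun f => Irreducible f) := by
    intro a ha
    rw [Finset.mem_filter] at ha ⊢
    rw [mem_Dn']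
    exact ⟨⟨(minpoly.monic (int_a a)).ne_zero, ha.2⟩, minpoly.irreducible (int_a a)⟩
  rw [← Finset.sum_fiberwise_of_maps_to hmap]
  refine Finset.sum_congr rfl fun P hP => ?_
  rw [Finset.mem_filter, mem_Dn'] at hP
  obtain ⟨⟨hP0, hPn⟩, hPi⟩ := hP
  have h1 : ∀ a ∈ ((Ek Om n).filter (fun a => dg a = n)).filter (fun a => minpoly F2 a = P), W (Na a n) = W P := by
    intro a ha
    rw [Finset.mem_filter, Finset.mem_filter] at ha
    rw [Na, ha.1.2, Nat.div_self hn, pow_one, ha.2]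
  rw [Finset.sum_congr rfl h1, Finset.sum_const, nsmul_eq_mul]
  congr 2
  have h2 : ((Ek Om n).filter (fun a => dg a = n)).filter (fun a => minpoly F2 a = P) = (P.map (algebraMap F2 Om)).roots.toFinset := by
    ext a
    have hPm : P.map (algebraMap F2 Om) ≠ 0 := by rwa [Ne, Polynomial.map_eq_zero]
    rw [Finset.mem_filter, Finset.mem_filter, mem_Ek hn, pow_eq_iff, Multiset.mem_toFinset, mem_roots hPm, IsRoot,
      eval_map_algebraMap]
    constructor
    · rintro ⟨_, h⟩; rw [← h, minpoly.aeval]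
    · intro h
      have := minpoly.eq_of_irreducible_of_monic hPi h (F2_monic hP0)
      refine ⟨?_, this.symm⟩
      rw [dg, ← this, hPn]; exact ⟨dvd_rfl, rfl⟩
  rw [h2, Multiset.toFinset_card_of_nodup (nodup_roots (PerfectField.separable_of_irreducible hPi).map),
    ← (IsAlgClosed.splits _).natDegree_eq_card_roots, natDegree_map, hPn]

lemma small_card (n : ℕ) (hn : 1 ≤ n) : ((Ek Om n).filter (fun a => dg a ≠ n)).card ≤ 2 * 2 ^ (n / 2) := by
  have h1 : (Ek Om n).filter (fun a => dg a ≠ n) ⊆ (Finset.Icc 1 (n / 2)).biUnion (fun j => Ek Om j) := by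
    intro a ha
    rw [Finset.mem_filter, mem_Ek hn, pow_eq_iff] at ha
    obtain ⟨⟨c, hc⟩, h2⟩ := ha
    rw [Finset.mem_biUnion]
    refine ⟨dg a, ?_, ?_⟩
    · rw [Finset.mem_Icc]
      refine ⟨dg_pos a, ?_⟩
      have : 2 ≤ c := by
        rcases c with _ | _ | c
        · omega
        · omega
        · omega
      rw [Nat.le_div_iff_mul_le (by norm_num)]
      calc dg a * 2 ≤ dg a * c := Nat.mul_le_mul_left _ this
        _ = n := hc.symm
    · rw [mem_Ek (dg_pos a), pow_eq_iff]
  have h3 : ∀ M, ∑ j ∈ Finset.Icc 1 M, 2 ^ j ≤ 2 * 2 ^ M := by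
    intro M
    induction M with
    | zero => simp
    | succ M ih =>
      rw [Finset.sum_Icc_succ_top (by omega), pow_succ]; omega
  calc _ ≤ _ := Finset.card_le_card h1
    _ ≤ ∑ j ∈ Finset.Icc 1 (n / 2), (Ek Om j).card := Finset.card_biUnion_le
    _ = ∑ j ∈ Finset.Icc 1 (n / 2), 2 ^ j := Finset.sum_congr rfl fun j hj => card_Ek (Finset.mem_Icc.1 hj).1
    _ ≤ _ := h3 _

lemma sum_TT_real (s : F2[X]) (l n : ℕ) [Fintype (RR s l)] (F : RR s l → ℝ) :
    ∑ g : (RR s l)ˣ, F g * TT s l n g = ∑ a ∈ (Ek Om n).filter (fun a => IsUnit (pii s l (Na a n))), F (pii s l (Na a n)) := by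
  have h : ∑ g : (RR s l)ˣ, F g * TT s l n g =
      ∑ g : (RR s l)ˣ, (fun r : RR s l => if IsUnit r then F r * (TT s l n r : ℝ) else 0) (g : RR s l) := by
    refine Finset.sum_congr rfl fun g _ => ?_
    simp only [g.isUnit, if_true]
  rw [h, sum_units (fun r : RR s l => if IsUnit r then F r * (TT s l n r : ℝ) else 0) (fun r hr => by simp only [hr, if_false])]
  rw [Finset.sum_filter, ← Finset.sum_fiberwise (Ek Om n) (fun a => pii s l (Na a n))]
  refine Finset.sum_congr rfl fun r _ => ?_
  have h1 : ∀ a ∈ (Ek Om n).filter (fun a => pii s l (Na a n) = r), (if IsUnit (pii s l (Na a n)) then F (pii s l (Na a n)) else 0) = if IsUnit r then F r else 0 := by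
    intro a ha
    rw [(Finset.mem_filter.1 ha).2]
  rw [Finset.sum_congr rfl h1, Finset.sum_const, nsmul_eq_mul]
  by_cases hr : IsUnit r
  · simp only [hr, if_true]; rw [TT, mul_comm]
  · simp only [hr, if_false]; rw [mul_zero]

theorem prime_equidist (s : F2[X]) (hs : s ≠ 0) (l : ℕ) [Fintype (RR s l)] (n : ℕ) (hn : 1 ≤ n)
    (w : RR s l → ℝ) (hw : ∀ r, |w r| ≤ 1) :
    |∑ f ∈ (Dn n).filter (fun f => Irreducible f), (n : ℝ) * w (pii s l f) - 2 ^ n / Fintype.card (RR s l)ˣ * ∑ g : (RR s l)ˣ, w g|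
      ≤ 2 * s.natDegree + 2 * 2 ^ (n / 2) +
        Real.sqrt (Fintype.card (RR s l)ˣ) * ((s.natDegree + l : ℕ) * Real.sqrt (2 ^ n)) := by
  have hcard : (0 : ℝ) < Fintype.card (RR s l)ˣ := by exact_mod_cast Fintype.card_pos
  have habs : ∀ (A : Finset Om), |∑ a ∈ A, w (pii s l (Na a n))| ≤ A.card := by
    intro A
    refine (Finset.abs_sum_le_sum_abs _ _).trans ?_
    refine (Finset.sum_le_sum fun a _ => hw _).trans ?_
    simp
  rw [prime_slice n hn (fun f => w (pii s l f))]
  have h1 := Finset.sum_filter_add_sum_filter_not (Ek Om n) (fun a => dg a = n) (fun a => w (pii s l (Na a n)))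
  have h2 := Finset.sum_filter_add_sum_filter_not (Ek Om n) (fun a => IsUnit (pii s l (Na a n))) (fun a => w (pii s l (Na a n)))
  have h3 := habs ((Ek Om n).filter (fun a => ¬ dg a = n))
  have h4 := habs ((Ek Om n).filter (fun a => ¬ IsUnit (pii s l (Na a n))))
  have h5 : (((Ek Om n).filter (fun a => ¬ dg a = n)).card : ℝ) ≤ 2 * 2 ^ (n / 2) := by exact_mod_cast small_card n hn
  have h6 : (((Ek Om n).filter (fun a => ¬ IsUnit (pii s l (Na a n)))).card : ℝ) ≤ s.natDegree := by
    exact_mod_cast nonunit_card s hs l n hn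
  have h7 := equidist s hs l n hn w hw
  rw [sum_TT_real] at h7
  set τ := ∑ h : (RR s l)ˣ, (TT s l n h : ℝ) with hτ
  have h8 : τ = ((Ek Om n).filter (fun a => IsUnit (pii s l (Na a n)))).card := by
    have := sum_TT_real s l n (fun _ => 1)
    simp only [one_mul] at this
    rw [hτ, this]; simp
  have h9 : |τ - 2 ^ n| ≤ s.natDegree := by
    have e := Finset.card_filter_add_card_filter_not (s := Ek Om n) (fun a => IsUnit (pii s l (Na a n)))
    rw [card_Ek hn] at e
    have e2 : (((Ek Om n).filter (fun a => IsUnit (pii s l (Na a n)))).card : ℝ) + (((Ek Om n).filter (fun a => ¬ IsUnit (pii s l (Na a n)))).card : ℝ) = 2 ^ n := by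
      exact_mod_cast e
    rw [h8, ← e2, abs_le]
    constructor <;> linarith [Nat.cast_nonneg (α := ℝ) ((Ek Om n).filter (fun a => ¬ IsUnit (pii s l (Na a n)))).card]
  have h10 : |∑ g : (RR s l)ˣ, w g| ≤ Fintype.card (RR s l)ˣ := by
    refine (Finset.abs_sum_le_sum_abs _ _).trans ?_
    refine (Finset.sum_le_sum fun a _ => hw _).trans ?_
    simp
  set G : ℝ := ((Fintype.card (RR s l)ˣ : ℕ) : ℝ)
  set SW := ∑ g : (RR s l)ˣ, w g
  have h11 : |τ / G * SW - 2 ^ n / G * SW| ≤ s.natDegree := by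
    have : τ / G * SW - 2 ^ n / G * SW = (τ - 2 ^ n) * (SW / G) := by ring
    rw [this, abs_mul]
    have h12 : |SW / G| ≤ 1 := by rw [abs_div, abs_of_pos hcard]; exact div_le_one_of_le₀ h10 hcard.le
    calc _ ≤ (s.natDegree : ℝ) * 1 := mul_le_mul h9 h12 (abs_nonneg _) (Nat.cast_nonneg _)
      _ = _ := mul_one _
  rw [abs_le] at *
  constructor <;> linarith

end S8

namespace S8

lemma sub_mem_GN {n : ℕ} {f g : F2[X]} (hf : f ∈ GN n) (hg : g ∈ GN n) : f - g ∈ GN n := by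
  rw [mem_GN] at *
  exact (degree_sub_le f g).trans_lt (max_lt hf hg)

lemma add_mem_GN {n : ℕ} {f g : F2[X]} (hf : f ∈ GN n) (hg : g ∈ GN n) : f + g ∈ GN n := by
  rw [mem_GN] at *
  exact (degree_add_le f g).trans_lt (max_lt hf hg)

lemma zero_mem_GN (n : ℕ) : (0 : F2[X]) ∈ GN n := by
  rw [mem_GN, degree_zero]; exact WithBot.bot_lt_coe _

lemma GN_mono {m n : ℕ} (h : m ≤ n) : GN m ⊆ GN n := by
  intro f hf
  rw [mem_GN] at *
  exact hf.trans_le (by exact_mod_cast h)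

lemma mod_mem_GN (s : F2[X]) (hs : s ≠ 0) (f : F2[X]) : f %ₘ s ∈ GN s.natDegree := by
  rw [mem_GN, ← degree_eq_natDegree hs]
  exact degree_modByMonic_lt f (F2_monic hs)

lemma dvd_GN_zero (s : F2[X]) (f : F2[X]) (hf : f ∈ GN s.natDegree) (h : s ∣ f) : f = 0 := by
  by_contra hne
  rw [mem_GN] at hf
  have h2 := natDegree_le_of_dvd h hne
  rw [degree_eq_natDegree hne] at hf
  have : f.natDegree < s.natDegree := by exact_mod_cast hf
  omega

lemma mk_inj_GN (s : F2[X]) (f g : F2[X]) (hf : f ∈ GN s.natDegree) (hg : g ∈ GN s.natDegree)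
    (h : AdjoinRoot.mk s f = AdjoinRoot.mk s g) : f = g := by
  rw [AdjoinRoot.mk_eq_mk] at h
  exact sub_eq_zero.1 (dvd_GN_zero s _ (sub_mem_GN hf hg) h)

lemma mk_mod (s : F2[X]) (hs : s ≠ 0) (f : F2[X]) : AdjoinRoot.mk s (f %ₘ s) = AdjoinRoot.mk s f := by
  rw [AdjoinRoot.mk_eq_mk, modByMonic_eq_sub_mul_div f s]
  exact ⟨-(f /ₘ s), by ring⟩

lemma mk_surj_GN (s : F2[X]) (hs : s ≠ 0) (r : AdjoinRoot s) : ∃ f ∈ GN s.natDegree, AdjoinRoot.mk s f = r := by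
  obtain ⟨f, rfl⟩ := AdjoinRoot.mk_surjective r
  exact ⟨_, mod_mem_GN s hs f, mk_mod s hs f⟩

lemma natDegree_Xl (l : ℕ) : (X ^ (l + 1) : F2[X]).natDegree = l + 1 := natDegree_X_pow _
lemma Xl_ne (l : ℕ) : (X ^ (l + 1) : F2[X]) ≠ 0 := pow_ne_zero _ X_ne_zero

lemma sum_RR (s : F2[X]) (hs : s ≠ 0) (l : ℕ) [Fintype (RR s l)] (F : RR s l → ℝ) :
    ∑ r, F r = ∑ p ∈ GN s.natDegree ×ˢ GN (X ^ (l + 1) : F2[X]).natDegree,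
      F (AdjoinRoot.mk s p.1, AdjoinRoot.mk (X ^ (l + 1) : F2[X]) p.2) := by
  symm
  refine Finset.sum_bij (fun p _ => (AdjoinRoot.mk s p.1, AdjoinRoot.mk (X ^ (l + 1) : F2[X]) p.2)) ?_ ?_ ?_ ?_
  · intros; exact Finset.mem_univ _
  · rintro ⟨a, b⟩ h ⟨a', b'⟩ h' he
    rw [Finset.mem_product] at h h'
    rw [Prod.mk.injEq] at he
    exact Prod.ext (mk_inj_GN _ _ _ h.1 h'.1 he.1) (mk_inj_GN _ _ _ h.2 h'.2 he.2)
  · rintro ⟨a, b⟩ _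
    obtain ⟨f, hf, rfl⟩ := mk_surj_GN s hs a
    obtain ⟨g, hg, rfl⟩ := mk_surj_GN _ (Xl_ne l) b
    exact ⟨(f, g), Finset.mem_product.2 ⟨hf, hg⟩, rfl⟩
  · intros; rfl

lemma sum_RR_units (s : F2[X]) (hs : s ≠ 0) (l : ℕ) [Fintype (RR s l)] (A : AdjoinRoot s → ℝ)
    (B : AdjoinRoot (X ^ (l + 1) : F2[X]) → ℝ) :
    ∑ g : (RR s l)ˣ, A (g : RR s l).1 * B (g : RR s l).2 =
      (∑ t ∈ residues s, A (AdjoinRoot.mk s t)) * ∑ v ∈ residues (X ^ (l + 1)), B (AdjoinRoot.mk _ v) := by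
  have h : ∑ g : (RR s l)ˣ, A (g : RR s l).1 * B (g : RR s l).2 =
      ∑ g : (RR s l)ˣ, (fun r : RR s l => if IsUnit r then A r.1 * B r.2 else 0) (g : RR s l) := by
    refine Finset.sum_congr rfl fun g _ => ?_
    simp only [g.isUnit, if_true]
  rw [h, sum_units (fun r : RR s l => if IsUnit r then A r.1 * B r.2 else 0) (fun r hr => by simp only [hr, if_false])]
  rw [sum_RR s hs, Finset.sum_product, residues, residues, Finset.sum_mul_sum, Finset.sum_filter]
  refine Finset.sum_congr rfl fun a _ => ?_
  rw [Finset.sum_filter]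
  by_cases ha : IsCoprime a s
  · rw [if_pos ha]
    refine Finset.sum_congr rfl fun b _ => ?_
    simp only [Prod.isUnit_iff, isUnit_mk, ha, true_and]
  · rw [if_neg ha]
    refine Finset.sum_eq_zero fun b _ => ?_
    simp only [Prod.isUnit_iff, isUnit_mk, ha, false_and, if_false]

lemma Dn_eq_map (n : ℕ) : Dn n = (GN n).map (addRightEmbedding (X ^ n : F2[X])) := by
  ext f
  rw [mem_Dn, Finset.mem_map]
  constructor
  · intro h
    refine ⟨f - X ^ n, ?_, by simp⟩
    have hf : f ≠ 0 := by rintro rfl; simp at h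
    rw [mem_GN, ← h]
    refine degree_sub_lt (by rw [h, degree_X_pow]) hf ?_
    rw [(F2_monic hf).leadingCoeff, leadingCoeff_X_pow]
  · rintro ⟨g, hg, rfl⟩
    rw [mem_GN] at hg
    rw [addRightEmbedding_apply, degree_add_eq_right_of_degree_lt, degree_X_pow]
    rwa [degree_X_pow]

lemma sum_Dn {A : Type*} [AddCommMonoid A] (n : ℕ) (F : F2[X] → A) : ∑ f ∈ Dn n, F f = ∑ f ∈ GN n, F (f + X ^ n) := by
  rw [Dn_eq_map, Finset.sum_map]; rfl

lemma GN_succ (n : ℕ) : GN (n + 1) = GN n ∪ Dn n := by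
  ext f
  rw [Finset.mem_union, mem_GN, mem_GN, mem_Dn]
  by_cases hf : f = 0
  · subst hf; simp only [degree_zero]; simp
  rw [degree_eq_natDegree hf]
  norm_cast
  omega

lemma GN_disj (n : ℕ) : Disjoint (GN n) (Dn n) := by
  rw [Finset.disjoint_left]
  intro f hf hf'
  rw [mem_GN] at hf
  rw [mem_Dn] at hf'
  exact absurd hf' hf.ne

lemma sum_GN_succ {A : Type*} [AddCommMonoid A] (n : ℕ) (F : F2[X] → A) :
    ∑ f ∈ GN (n + 1), F f = ∑ f ∈ GN n, F f + ∑ f ∈ Dn n, F f := by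
  rw [GN_succ, Finset.sum_union (GN_disj n)]

lemma GN_zero : GN 0 = {0} := by
  ext f
  rw [mem_GN, Finset.mem_singleton]
  constructor
  · intro h
    by_contra hf
    rw [degree_eq_natDegree hf] at h
    norm_cast at h
  · rintro rfl; rw [degree_zero]; exact WithBot.bot_lt_coe _

lemma card_GN (n : ℕ) : (GN n).card = 2 ^ n := by
  induction n with
  | zero => simp [GN_zero]
  | succ n ih =>
    rw [GN_succ, Finset.card_union_of_disjoint (GN_disj n), Dn_eq_map, Finset.card_map, ih, pow_succ]; omega

/-- the sign of an element of the field with two elements -/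
def sgn (c : F2) : ℝ := (-1) ^ c.val

@[simp] lemma sgn_zero : sgn 0 = 1 := by simp [sgn]
@[simp] lemma sgn_one : sgn 1 = -1 := by simp [sgn, ZMod.val_one]
lemma sgn_add (a b : F2) : sgn (a + b) = sgn a * sgn b := by
  rcases F2_cases a with rfl | rfl <;> rcases F2_cases b with rfl | rfl
  · simp
  · simp
  · simp
  · have : (1 : F2) + 1 = 0 := by decide
    rw [this]; simp
lemma abs_sgn (a : F2) : |sgn a| = 1 := by
  rcases F2_cases a with rfl | rfl <;> simp

abbrev Lin := F2[X] →ₗ[F2] F2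

def Zr (L : Lin) (n : ℕ) : Prop := ∀ f ∈ GN n, L f = 0

lemma Zr_succ (L : Lin) (n : ℕ) : Zr L (n + 1) ↔ Zr L n ∧ L (X ^ n) = 0 := by
  constructor
  · intro h
    refine ⟨fun f hf => h f (GN_mono (Nat.le_succ n) hf), h _ ?_⟩
    rw [mem_GN, degree_X_pow]; exact_mod_cast Nat.lt_succ_self n
  · rintro ⟨h1, h2⟩ f hf
    rw [GN_succ, Finset.mem_union, Dn_eq_map, Finset.mem_map] at hf
    rcases hf with hf | ⟨g, hg, rfl⟩
    · exact h1 f hf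
    · show L (g + X ^ n) = 0; rw [map_add, h1 g hg, h2, add_zero]

lemma Zr_iff (L : Lin) (n : ℕ) : Zr L n ↔ ∀ i < n, L (X ^ i) = 0 := by
  induction n with
  | zero => simp [Zr, GN_zero]
  | succ n ih =>
    rw [Zr_succ, ih, Nat.forall_lt_succ_right]

lemma orth (L : Lin) (n : ℕ) : ∑ f ∈ GN n, sgn (L f) = if Zr L n then 2 ^ n else 0 := by
  induction n with
  | zero => simp [GN_zero, Zr]
  | succ n ih =>
    rw [sum_GN_succ, sum_Dn]
    simp only [map_add, sgn_add]
    rw [← Finset.sum_mul, ih, Zr_succ]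
    by_cases h : Zr L n
    · rcases F2_cases (L (X ^ n)) with h2 | h2 <;> simp [h, h2]; ring
    · simp [h]

lemma residues_X (l : ℕ) : residues (X ^ (l + 1) : F2[X]) = (GN l).image (fun h => 1 + X * h) := by
  ext v
  rw [residues, Finset.mem_filter, natDegree_Xl, Finset.mem_image]
  have e : IsCoprime v (X ^ (l + 1) : F2[X]) ↔ v.coeff 0 = 1 := by
    rw [IsCoprime.pow_right_iff (Nat.succ_pos l), isCoprime_comm, Irreducible.coprime_iff_not_dvd irreducible_X, X_dvd_iff]
    rcases F2_cases (v.coeff 0) with h | h <;> simp [h]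
  rw [e]
  constructor
  · rintro ⟨h1, h2⟩
    refine ⟨v.divX, ?_, ?_⟩
    · rw [mem_GN] at h1 ⊢
      rw [degree_lt_iff_coeff_zero] at h1 ⊢
      intro m hm
      rw [coeff_divX]; exact h1 _ (by omega)
    · have := divX_mul_X_add v
      rw [h2, C_1] at this
      rw [mul_comm, add_comm]; exact this
  · rintro ⟨h, hh, rfl⟩
    refine ⟨?_, by simp⟩
    rw [mem_GN] at hh ⊢
    rw [degree_lt_iff_coeff_zero] at hh ⊢
    intro m hm
    obtain ⟨k, rfl⟩ : ∃ k, m = k + 1 := ⟨m - 1, by omega⟩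
    rw [coeff_add, coeff_X_mul, hh k (by omega), coeff_one]; simp

lemma sum_residues_X (l : ℕ) (F : F2[X] → ℝ) : ∑ v ∈ residues (X ^ (l + 1) : F2[X]), F v = ∑ h ∈ GN l, F (1 + X * h) := by
  rw [residues_X, Finset.sum_image]
  intro a _ b _ h
  exact mul_left_cancel₀ X_ne_zero (add_left_cancel h)

lemma card_RR_units (s : F2[X]) (hs : s ≠ 0) (l : ℕ) [Fintype (RR s l)] :
    (Fintype.card (RR s l)ˣ : ℝ) = phi s * 2 ^ l := by
  have h := sum_RR_units s hs l (fun _ => 1) (fun _ => 1)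
  rw [sum_residues_X] at h
  simp only [mul_one, Finset.sum_const, nsmul_eq_mul, card_GN] at h
  rw [Finset.card_univ] at h
  rw [h]; simp [phi, residues]

lemma phi_le (s : F2[X]) : phi s ≤ 2 ^ s.natDegree := by
  rw [← card_GN]; exact Finset.card_filter_le _ _

theorem prime_char (s : F2[X]) (hs : s ≠ 0) (l n : ℕ) (hn : 1 ≤ n) (L1 L3 : Lin)
    (h1 : ∀ q, L1 (s * q) = 0) (h3 : ∀ q, L3 (X ^ (l + 1) * q) = 0) :
    |∑ f ∈ (Dn n).filter (fun f => Irreducible f), (n : ℝ) * (sgn (L1 f) * sgn (L3 f.reverse))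
      - 2 ^ n / (phi s * 2 ^ l) * ((∑ t ∈ residues s, sgn (L1 t)) * ∑ h ∈ GN l, sgn (L3 (1 + X * h)))|
      ≤ 2 * s.natDegree + 2 * 2 ^ (n / 2) +
        Real.sqrt (2 ^ (s.natDegree + l)) * ((s.natDegree + l : ℕ) * Real.sqrt (2 ^ n)) := by
  haveI := finite_RR s hs l
  haveI : Finite (RR s l) := Module.finite_of_finite F2
  letI : Fintype (RR s l) := Fintype.ofFinite _
  have key : ∀ (u : F2[X]) (L : Lin), (∀ q, L (u * q) = 0) → ∃ A : AdjoinRoot u → ℝ, (∀ f, A (AdjoinRoot.mk u f) = sgn (L f)) ∧ ∀ r, |A r| = 1 := by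
    intro u L hL
    refine ⟨fun r => sgn (L (Function.surjInv AdjoinRoot.mk_surjective r)), fun f => ?_, fun r => abs_sgn _⟩
    have h := Function.surjInv_eq (AdjoinRoot.mk_surjective (g := u)) (AdjoinRoot.mk u f)
    rw [AdjoinRoot.mk_eq_mk] at h
    obtain ⟨q, hq⟩ := h
    have := hL q
    rw [← hq, map_sub, sub_eq_zero] at this
    simp only [this]
  obtain ⟨A, hA, hA1⟩ := key s L1 h1
  obtain ⟨B, hB, hB1⟩ := key _ L3 h3
  have h := prime_equidist s hs l n hn (fun r => A r.1 * B r.2) (fun r => by rw [abs_mul, hA1, hB1, one_mul])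
  rw [sum_RR_units s hs l A B, card_RR_units s hs] at h
  simp only [pii, hA, hB] at h
  rw [sum_residues_X] at h
  refine h.trans ?_
  have : (phi s : ℝ) * 2 ^ l ≤ 2 ^ (s.natDegree + l) := by
    rw [pow_add]
    have := phi_le s
    gcongr
    exact_mod_cast this
  gcongr

end S8

namespace S8

/-- the set of prime divisors -/
def PD (s : F2[X]) : Finset F2[X] := (GN (s.natDegree + 1)).filter (fun r => Irreducible r ∧ r ∣ s)

lemma mem_PD (s : F2[X]) (hs : s ≠ 0) (r : F2[X]) : r ∈ PD s ↔ Irreducible r ∧ r ∣ s := by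
  rw [PD, Finset.mem_filter, and_iff_right_iff_imp]
  rintro ⟨h1, h2⟩
  rw [mem_GN, degree_eq_natDegree h1.ne_zero]
  exact_mod_cast Nat.lt_succ_of_le (natDegree_le_of_dvd h2 hs)

lemma coprime_irr {r q : F2[X]} (hr : Irreducible r) (hq : Irreducible q) (h : r ≠ q) : IsCoprime r q := by
  rw [Irreducible.coprime_iff_not_dvd hr]
  intro hd
  have := (hr.associated_of_dvd hq hd)
  exact h (eq_of_monic_of_associated (F2_monic hr.ne_zero) (F2_monic hq.ne_zero) this)

lemma PD_pairwise (s : F2[X]) (hs : s ≠ 0) (D : Finset F2[X]) (hD : D ⊆ PD s) :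
    (D : Set F2[X]).Pairwise (fun a b => IsCoprime a b) := by
  intro a ha b hb hab
  exact coprime_irr ((mem_PD s hs a).1 (hD ha)).1 ((mem_PD s hs b).1 (hD hb)).1 hab

lemma prod_dvd_iff (s : F2[X]) (hs : s ≠ 0) (D : Finset F2[X]) (hD : D ⊆ PD s) (u : F2[X]) :
    (∏ r ∈ D, r) ∣ u ↔ ∀ r ∈ D, r ∣ u := by
  constructor
  · intro h r hr
    exact (Finset.dvd_prod_of_mem (fun r : F2[X] => r) hr).trans h
  · intro h
    exact Finset.prod_dvd_of_coprime (PD_pairwise s hs D hD) h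

lemma prod_ne (s : F2[X]) (hs : s ≠ 0) (D : Finset F2[X]) (hD : D ⊆ PD s) : (∏ r ∈ D, r) ≠ 0 := by
  rw [Finset.prod_ne_zero_iff]
  intro r hr
  exact ((mem_PD s hs r).1 (hD hr)).1.ne_zero

lemma prod_dvd_s (s : F2[X]) (hs : s ≠ 0) (D : Finset F2[X]) (hD : D ⊆ PD s) : (∏ r ∈ D, r) ∣ s :=
  (prod_dvd_iff s hs D hD s).2 fun r hr => ((mem_PD s hs r).1 (hD hr)).2

lemma coprime_iff (s : F2[X]) (hs : s ≠ 0) (u : F2[X]) : IsCoprime u s ↔ ∀ r ∈ PD s, ¬ r ∣ u := by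
  constructor
  · intro h r hr hru
    obtain ⟨h1, h2⟩ := (mem_PD s hs r).1 hr
    exact h1.not_isUnit (h.isUnit_of_dvd' hru h2)
  · intro h
    refine isCoprime_of_irreducible_dvd (fun hh => hs hh.2) fun z hz hzu hzs => h z ((mem_PD s hs z).2 ⟨hz, hzs⟩) hzu

lemma sum_dvd (m : ℕ) (d : F2[X]) (hd : d ≠ 0) (hdm : d.natDegree ≤ m) (F : F2[X] → ℝ) :
    ∑ u ∈ (GN m).filter (fun u => d ∣ u), F u = ∑ q ∈ GN (m - d.natDegree), F (d * q) := by
  symm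
  refine Finset.sum_bij (fun q _ => d * q) ?_ ?_ ?_ ?_
  · intro q hq
    rw [Finset.mem_filter]
    refine ⟨?_, dvd_mul_right _ _⟩
    by_cases h0 : q = 0
    · rw [h0, mul_zero]; exact zero_mem_GN _
    rw [mem_GN, degree_eq_natDegree h0] at hq
    rw [mem_GN, degree_eq_natDegree (mul_ne_zero hd h0), natDegree_mul hd h0]
    norm_cast at hq ⊢
    omega
  · intro a _ b _ h
    exact mul_left_cancel₀ hd h
  · intro u hu
    obtain ⟨hu, q, rfl⟩ := Finset.mem_filter.1 hu
    refine ⟨q, ?_, rfl⟩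
    by_cases h0 : q = 0
    · rw [h0]; exact zero_mem_GN _
    rw [mem_GN, degree_eq_natDegree (mul_ne_zero hd h0), natDegree_mul hd h0] at hu
    rw [mem_GN, degree_eq_natDegree h0]
    norm_cast at hu ⊢
    omega
  · intros; rfl

lemma incl_excl (s : F2[X]) (hs : s ≠ 0) (F : F2[X] → ℝ) :
    ∑ u ∈ residues s, F u = ∑ D ∈ (PD s).powerset, (-1) ^ D.card *
      ∑ q ∈ GN (s.natDegree - (∏ r ∈ D, r).natDegree), F ((∏ r ∈ D, r) * q) := by
  have h1 : ∀ u, (if IsCoprime u s then F u else 0) = ∑ D ∈ (PD s).powerset, (-1) ^ D.card * (if (∏ r ∈ D, r) ∣ u then F u else 0) := by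
    intro u
    have h2 : (if IsCoprime u s then (1 : ℝ) else 0) = ∏ r ∈ PD s, (-(if r ∣ u then (1 : ℝ) else 0) + 1) := by
      rw [coprime_iff s hs]
      split_ifs with h
      · symm
        refine Finset.prod_eq_one fun r hr => ?_
        rw [if_neg (h r hr)]; simp
      · push Not at h
        obtain ⟨r, hr, hru⟩ := h
        symm
        refine Finset.prod_eq_zero hr ?_
        rw [if_pos hru]; simp
    have h3 : (if IsCoprime u s then F u else 0) = (if IsCoprime u s then (1 : ℝ) else 0) * F u := by
      split_ifs <;> simp
    rw [h3, h2, Finset.prod_add, Finset.sum_mul]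
    refine Finset.sum_congr rfl fun D hD => ?_
    have hD := Finset.mem_powerset.1 hD
    rw [Finset.prod_const_one, mul_one, Finset.prod_neg, mul_assoc]
    congr 1
    rw [prod_dvd_iff s hs D hD, Finset.prod_ite_zero, Finset.prod_const_one]
    split_ifs <;> simp
  rw [residues, Finset.sum_filter]
  simp only [h1]
  rw [Finset.sum_comm]
  refine Finset.sum_congr rfl fun D hD => ?_
  have hD := Finset.mem_powerset.1 hD
  rw [← Finset.mul_sum, ← Finset.sum_filter, sum_dvd _ _ (prod_ne s hs D hD) (natDegree_le_of_dvd (prod_dvd_s s hs D hD) hs)]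

lemma F2_unit {e : F2[X]} (h : IsUnit e) : e = 1 := by
  exact (F2_monic h.ne_zero).eq_one_of_isUnit h

lemma prod_PD (s : F2[X]) (hs : s ≠ 0) (hsq : Squarefree s) : ∏ r ∈ PD s, r = s := by
  obtain ⟨e, he⟩ := prod_dvd_s s hs (PD s) subset_rfl
  have hu : IsUnit e := by
    by_contra hu
    have he0 : e ≠ 0 := by rintro rfl; rw [mul_zero] at he; exact hs he
    obtain ⟨r, hr, hre⟩ := WfDvdMonoid.exists_irreducible_factor hu he0
    have hrs : r ∣ s := he ▸ hre.mul_left _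
    have hrP : r ∣ ∏ r ∈ PD s, r := Finset.dvd_prod_of_mem _ ((mem_PD s hs r).2 ⟨hr, hrs⟩)
    exact hr.not_isUnit (hsq r (he ▸ mul_dvd_mul hrP hre))
  rw [F2_unit hu, mul_one] at he
  exact he.symm

lemma sum_eq_mu (s : F2[X]) (hs : s ≠ 0) :
    ∑ D ∈ (PD s).powerset, (-1 : ℝ) ^ D.card * (if (∏ r ∈ D, r) = s then 1 else 0) = mu s := by
  have hD : ∀ D ⊆ PD s, ∏ r ∈ D, r = s → D = PD s ∧ Squarefree s := by
    intro D hD h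
    refine ⟨Finset.Subset.antisymm hD ?_, ?_⟩
    · intro r hr
      obtain ⟨h1, h2⟩ := (mem_PD s hs r).1 hr
      rw [← h] at h2
      obtain ⟨q, hq, hrq⟩ := (h1.prime.dvd_finset_prod_iff _).1 h2
      by_contra hn
      have hne : r ≠ q := by rintro rfl; exact hn hq
      have := coprime_irr h1 ((mem_PD s hs q).1 (hD hq)).1 hne
      rw [Irreducible.coprime_iff_not_dvd h1] at this
      exact this hrq
    · rw [← h]
      refine Finset.squarefree_prod_of_pairwise_isCoprime ?_ ?_
      · intro a ha b hb hab
        exact (PD_pairwise s hs D hD ha hb hab).isRelPrime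
      · intro i hi
        exact ((mem_PD s hs i).1 (hD hi)).1.squarefree
  by_cases hsq : Squarefree s
  · rw [Finset.sum_eq_single (PD s)]
    · rw [if_pos (prod_PD s hs hsq), mu, if_pos hsq]
      simp [omegaP, PD]
    · intro D hD' hne
      rw [if_neg, mul_zero]
      intro h
      exact hne (hD D (Finset.mem_powerset.1 hD') h).1
    · intro h; exact absurd (Finset.mem_powerset.2 subset_rfl) h
  · rw [mu, if_neg hsq, Int.cast_zero]
    refine Finset.sum_eq_zero fun D hD' => ?_
    rw [if_neg, mul_zero]
    intro h
    exact hsq (hD D (Finset.mem_powerset.1 hD') h).2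

/-- functional composed with multiplication -/
def mulL (L : Lin) (g : F2[X]) : Lin := L.comp (LinearMap.mulLeft F2 g)

@[simp] lemma mulL_apply (L : Lin) (g f : F2[X]) : mulL L g f = L (g * f) := rfl

theorem ramanujan (s : F2[X]) (hs : s ≠ 0) (L : Lin) (h1 : ∀ q, L (s * q) = 0)
    (h2 : ∀ t ∈ GN s.natDegree, t ≠ 0 → ∃ q, L (t * q) ≠ 0) :
    ∑ t ∈ residues s, sgn (L t) = mu s := by
  rw [incl_excl s hs, ← sum_eq_mu s hs]
  refine Finset.sum_congr rfl fun D hD => ?_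
  have hD := Finset.mem_powerset.1 hD
  have hd0 := prod_ne s hs D hD
  have hds := prod_dvd_s s hs D hD
  set d := ∏ r ∈ D, r
  congr 1
  have := orth (mulL L d) (s.natDegree - d.natDegree)
  simp only [mulL_apply] at this
  rw [this]
  by_cases hd : d = s
  · rw [if_pos hd, hd, Nat.sub_self, if_pos]
    · simp
    · intro f hf
      rw [GN_zero, Finset.mem_singleton] at hf
      rw [hf, map_zero]
  · rw [if_neg hd, if_neg]
    intro hZ
    obtain ⟨e, he⟩ := hds
    have he0 : e ≠ 0 := by rintro rfl; rw [mul_zero] at he; exact hs he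
    have hdeg : s.natDegree = d.natDegree + e.natDegree := by rw [he, natDegree_mul hd0 he0]
    have hepos : 0 < e.natDegree := by
      rw [Nat.pos_iff_ne_zero]
      intro h0
      rw [eq_one_of_monic_natDegree_zero (F2_monic he0) h0, mul_one] at he
      exact hd he.symm
    obtain ⟨q, hq⟩ := h2 d (by rw [mem_GN, degree_eq_natDegree hd0]; exact_mod_cast (by omega)) hd0
    apply hq
    have hm := mod_mem_GN e he0 q
    have := hZ (q %ₘ e) (by rw [show s.natDegree - d.natDegree = e.natDegree by omega]; exact hm)
    rw [mulL_apply, modByMonic_eq_sub_mul_div, mul_sub, ← mul_assoc, ← he, map_sub, h1, sub_zero] at this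
    exact this

lemma phi_eq (s : F2[X]) (hs : s ≠ 0) : (phi s : ℝ) = 2 ^ s.natDegree * ∏ r ∈ PD s, (1 - 1 / 2 ^ r.natDegree) := by
  have h := incl_excl s hs (fun _ => 1)
  simp only [Finset.sum_const, nsmul_eq_mul, mul_one, card_GN] at h
  rw [phi]; rw [residues] at h; rw [h]
  have : ∀ r : F2[X], (1 - 1 / 2 ^ r.natDegree : ℝ) = -(1 / 2 ^ r.natDegree) + 1 := fun r => by ring
  simp only [this]
  rw [Finset.prod_add, Finset.mul_sum]
  refine Finset.sum_congr rfl fun D hD => ?_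
  have hD := Finset.mem_powerset.1 hD
  have hle := natDegree_le_of_dvd (prod_dvd_s s hs D hD) hs
  have hdeg : (∏ r ∈ D, r).natDegree = ∑ r ∈ D, r.natDegree :=
    natDegree_prod _ _ fun r hr => ((mem_PD s hs r).1 (hD hr)).1.ne_zero
  rw [Finset.prod_const_one, mul_one, Finset.prod_neg]
  simp only [one_div, Finset.prod_inv_distrib, Finset.prod_pow_eq_pow_sum]
  rw [← hdeg]
  push_cast
  rw [pow_sub₀ _ (by norm_num) hle]; ring

lemma phi_ge (s : F2[X]) (hs : s ≠ 0) : (2 : ℝ) ^ s.natDegree ≤ phi s * 2 ^ omegaP s := by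
  rw [phi_eq s hs, mul_assoc]
  have h : (1 / 2 : ℝ) ^ (PD s).card ≤ ∏ r ∈ PD s, (1 - 1 / 2 ^ r.natDegree : ℝ) := by
    rw [← Finset.prod_const]
    refine Finset.prod_le_prod (fun _ _ => by norm_num) fun r hr => ?_
    have hd : 1 ≤ r.natDegree := ((mem_PD s hs r).1 hr).1.natDegree_pos
    have : (2 : ℝ) ^ 1 ≤ 2 ^ r.natDegree := pow_le_pow_right₀ (by norm_num) hd
    have h2 : 1 / (2 : ℝ) ^ r.natDegree ≤ 1 / 2 ^ 1 := one_div_le_one_div_of_le (by norm_num) this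
    linarith
  have hw : omegaP s = (PD s).card := rfl
  rw [hw]
  have h2 : (1 : ℝ) ≤ (∏ r ∈ PD s, (1 - 1 / 2 ^ r.natDegree : ℝ)) * 2 ^ (PD s).card := by
    calc (1 : ℝ) = (1 / 2 : ℝ) ^ (PD s).card * 2 ^ (PD s).card := by rw [← mul_pow]; norm_num
      _ ≤ _ := by gcongr
  nlinarith [pow_pos (show (0 : ℝ) < 2 by norm_num) s.natDegree]

lemma phi_pos (s : F2[X]) (hs : s ≠ 0) : (0 : ℝ) < phi s := by
  have h := phi_ge s hs
  by_contra h0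
  have h1 : (phi s : ℝ) = 0 := le_antisymm (not_lt.1 h0) (Nat.cast_nonneg _)
  rw [h1, zero_mul] at h
  exact absurd h (not_le.2 (by positivity))

lemma abs_mu (s : F2[X]) : |(mu s : ℝ)| ≤ 1 := by
  rw [mu]; split_ifs <;> simp

lemma abs_alphaA (s : F2[X]) (hs : s ≠ 0) : |alphaA s| ≤ 2 ^ omegaP s / 2 ^ s.natDegree := by
  rw [alphaA, abs_div, abs_of_pos (phi_pos s hs)]
  rw [div_le_div_iff₀ (phi_pos s hs) (by positivity)]
  calc _ ≤ 1 * (2 : ℝ) ^ s.natDegree := by gcongr; exact abs_mu s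
    _ ≤ _ := by rw [one_mul, mul_comm]; exact phi_ge s hs

lemma abs_alphaA' (s : F2[X]) (hs : s ≠ 0) : |alphaA s| ≤ 1 := by
  rw [alphaA, abs_div, abs_of_pos (phi_pos s hs)]
  rw [div_le_one (phi_pos s hs)]
  refine (abs_mu s).trans ?_
  have := phi_pos s hs
  exact_mod_cast this

lemma omega_le (s : F2[X]) (hs : s ≠ 0) (D : ℕ) : D * omegaP s ≤ D * 2 ^ (D + 1) + s.natDegree := by
  have hw : omegaP s = (PD s).card := rfl
  rw [hw, ← Finset.card_filter_add_card_filter_not (s := PD s) (fun r => r.natDegree ≤ D), mul_add]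
  refine add_le_add ?_ ?_
  · refine Nat.mul_le_mul_left _ ?_
    rw [← card_GN]
    refine Finset.card_le_card fun r hr => ?_
    obtain ⟨h1, h2⟩ := Finset.mem_filter.1 hr
    rw [mem_GN, degree_eq_natDegree ((mem_PD s hs r).1 h1).1.ne_zero]
    exact_mod_cast Nat.lt_succ_of_le h2
  · set E := (PD s).filter (fun r => ¬ r.natDegree ≤ D) with hE
    have hEs : E ⊆ PD s := Finset.filter_subset _ _
    have hdeg : (∏ r ∈ E, r).natDegree = ∑ r ∈ E, r.natDegree :=
      natDegree_prod _ _ fun r hr => ((mem_PD s hs r).1 (hEs hr)).1.ne_zero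
    calc D * E.card = ∑ r ∈ E, D := by rw [Finset.sum_const, smul_eq_mul, mul_comm]
      _ ≤ ∑ r ∈ E, r.natDegree := Finset.sum_le_sum fun r hr => by
          have := (Finset.mem_filter.1 hr).2; omega
      _ = (∏ r ∈ E, r).natDegree := hdeg.symm
      _ ≤ _ := natDegree_le_of_dvd (prod_dvd_s s hs E hEs) hs

lemma alphaB_nonneg (s : F2[X]) : 0 ≤ alphaB s := by
  rw [alphaB]; split_ifs
  · exact Finset.prod_nonneg fun r _ => by positivity
  · exact le_rfl

lemma alphaB_phi (s : F2[X]) (hs : s ≠ 0) : alphaB s * phi s ≤ 3 ^ omegaP s := by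
  rw [alphaB]
  split_ifs with h
  · have e : (2 : ℝ) ^ s.natDegree = ∏ r ∈ PD s, 2 ^ r.natDegree := by
      rw [Finset.prod_pow_eq_pow_sum]
      congr 1
      conv_lhs => rw [← prod_PD s hs h]
      exact natDegree_prod _ _ fun r hr => ((mem_PD s hs r).1 hr).1.ne_zero
    calc _ ≤ (∏ r ∈ PD s, (3 : ℝ) / ((2 : ℝ) ^ r.natDegree + 3)) * 2 ^ s.natDegree := by
          refine mul_le_mul_of_nonneg_left ?_ (Finset.prod_nonneg fun r _ => by positivity)
          exact_mod_cast phi_le s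
      _ = ∏ r ∈ PD s, (3 : ℝ) / ((2 : ℝ) ^ r.natDegree + 3) * 2 ^ r.natDegree := by
          rw [e, Finset.prod_mul_distrib]
      _ ≤ ∏ r ∈ PD s, (3 : ℝ) := by
          refine Finset.prod_le_prod (fun r _ => by positivity) fun r _ => ?_
          rw [div_mul_eq_mul_div, div_le_iff₀ (by positivity)]
          nlinarith [pow_pos (show (0 : ℝ) < 2 by norm_num) r.natDegree]
      _ = _ := by rw [Finset.prod_const]; rfl
  · rw [zero_mul]; positivity

end S8

namespace S8

lemma natDegree_lt_of_GN {n : ℕ} {f : F2[X]} (hf : f ∈ GN n) (h0 : f ≠ 0) : f.natDegree < n := by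
  rw [mem_GN, degree_eq_natDegree h0] at hf
  exact_mod_cast hf

lemma GN_of_natDegree_lt {n : ℕ} {f : F2[X]} (h : f ≠ 0 → f.natDegree < n) : f ∈ GN n := by
  by_cases h0 : f = 0
  · rw [h0]; exact zero_mem_GN n
  · rw [mem_GN, degree_eq_natDegree h0]
    exact_mod_cast h h0

lemma mul_mem_GN {m n : ℕ} {f g : F2[X]} (hf : f ∈ GN m) (hg : g ∈ GN n) : f * g ∈ GN (m + n) := by
  refine GN_of_natDegree_lt fun h => ?_
  have h1 := left_ne_zero_of_mul h
  have h2 := right_ne_zero_of_mul h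
  rw [natDegree_mul h1 h2]
  have := natDegree_lt_of_GN hf h1
  have := natDegree_lt_of_GN hg h2
  omega

lemma X_mem_GN {i n : ℕ} (h : i < n) : (X ^ i : F2[X]) ∈ GN n :=
  GN_of_natDegree_lt fun _ => by rw [natDegree_X_pow]; exact h

lemma dirichlet (L : Lin) (M : ℕ) : ∃ s : F2[X], s ≠ 0 ∧ s.natDegree ≤ M ∧ Zr (mulL L s) M := by
  have hc : (Finset.univ : Finset (Fin M → F2)).card < (GN (M + 1)).card := by
    rw [card_GN, Finset.card_univ, Fintype.card_fun, ZMod.card, Fintype.card_fin]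
    exact Nat.pow_lt_pow_right (by norm_num) (Nat.lt_succ_self M)
  obtain ⟨f, hf, g, hg, hne, he⟩ := Finset.exists_ne_map_eq_of_card_lt_of_maps_to hc
    (f := fun f => fun i : Fin M => L (f * X ^ (i : ℕ))) (fun _ _ => Finset.mem_coe.2 (Finset.mem_univ _))
  have h0 : f - g ≠ 0 := sub_ne_zero.2 hne
  refine ⟨f - g, h0, Nat.lt_succ_iff.1 (natDegree_lt_of_GN (sub_mem_GN hf hg) h0), ?_⟩
  rw [Zr_iff]
  intro i hi
  have := congrFun he ⟨i, hi⟩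
  simp only at this
  rw [mulL_apply, sub_mul, map_sub, this, sub_self]

theorem approx (L : Lin) (M : ℕ) : ∃ (s : F2[X]) (L1 : Lin), s ≠ 0 ∧ s.natDegree ≤ M ∧
    (∀ q, L1 (s * q) = 0) ∧ (∀ t ∈ GN s.natDegree, t ≠ 0 → ∃ q, L1 (t * q) ≠ 0) ∧
    Zr (L - L1) (s.natDegree + M) ∧ (∀ t ∈ GN s.natDegree, t ≠ 0 → ∃ q ∈ GN M, L (t * q) ≠ 0) := by
  have hex : ∃ m : ℕ, ∃ s : F2[X], s ≠ 0 ∧ s.natDegree = m ∧ s.natDegree ≤ M ∧ Zr (mulL L s) M := by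
    obtain ⟨s, h0, h1, h2⟩ := dirichlet L M
    exact ⟨_, s, h0, rfl, h1, h2⟩
  obtain ⟨s, h0, hm, h1, h2⟩ := Nat.find_spec hex
  have hmin : ∀ t ∈ GN s.natDegree, t ≠ 0 → ∃ q ∈ GN M, L (t * q) ≠ 0 := by
    intro t ht ht0
    by_contra hcon
    push Not at hcon
    have hlt := natDegree_lt_of_GN ht ht0
    refine Nat.find_min hex (m := t.natDegree) (by omega) ⟨t, ht0, rfl, by omega, ?_⟩
    intro f hf
    exact hcon f hf
  have hag : Zr (L - L.comp (modByMonicHom s)) (s.natDegree + M) := by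
    intro f hf
    rw [LinearMap.sub_apply, LinearMap.comp_apply, modByMonicHom_apply, ← map_sub]
    have e : f - f %ₘ s = s * (f /ₘ s) := by
      rw [modByMonic_eq_sub_mul_div]; ring
    rw [e]
    refine h2 _ (GN_of_natDegree_lt fun hne => ?_)
    rw [natDegree_divByMonic _ (F2_monic h0)]
    have hf0 : f ≠ 0 := by rintro rfl; rw [zero_divByMonic] at hne; exact hne rfl
    have hdeg : s.natDegree ≤ f.natDegree := by
      by_contra hlt
      apply hne
      rw [divByMonic_eq_zero_iff (F2_monic h0)]
      rw [degree_eq_natDegree h0, degree_eq_natDegree hf0]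
      exact_mod_cast not_le.1 hlt
    have := natDegree_lt_of_GN hf hf0
    omega
  refine ⟨s, L.comp (modByMonicHom s), h0, h1, ?_, ?_, hag, hmin⟩
  · intro q
    rw [LinearMap.comp_apply, modByMonicHom_apply, mul_comm, mul_self_modByMonic (F2_monic h0), map_zero]
  · intro t ht ht0
    obtain ⟨q, hq, hne⟩ := hmin t ht ht0
    refine ⟨q, ?_⟩
    have := hag (t * q) (mul_mem_GN ht hq)
    rw [LinearMap.sub_apply, sub_eq_zero] at this
    rwa [← this]

lemma lin_expand (L : Lin) (n : ℕ) (f : F2[X]) (hf : f ∈ GN n) :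
    L f = ∑ i ∈ Finset.range n, f.coeff i * L (X ^ i) := by
  conv_lhs => rw [as_sum_range' f (n + 1) (Nat.lt_succ_of_le (by
    by_cases h0 : f = 0
    · simp [h0]
    · exact (natDegree_lt_of_GN hf h0).le))]
  rw [map_sum, Finset.sum_range_succ]
  have : f.coeff n = 0 := by
    rw [mem_GN] at hf
    exact coeff_eq_zero_of_degree_lt hf
  rw [this, monomial_zero_right, map_zero, add_zero]
  refine Finset.sum_congr rfl fun i _ => ?_
  rw [← C_mul_X_pow_eq_monomial, ← smul_eq_C_mul, map_smul, smul_eq_mul]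

def L3f (L2 : Lin) (n l : ℕ) : Lin := ∑ j ∈ Finset.range (l + 1), (L2 (X ^ (n - j))) • lcoeff F2 j

lemma L3f_apply (L2 : Lin) (n l : ℕ) (v : F2[X]) :
    L3f L2 n l v = ∑ j ∈ Finset.range (l + 1), v.coeff j * L2 (X ^ (n - j)) := by
  rw [L3f, LinearMap.sum_apply]
  refine Finset.sum_congr rfl fun j _ => ?_
  rw [LinearMap.smul_apply, lcoeff_apply, smul_eq_mul, mul_comm]

lemma L3f_X (L2 : Lin) (n l k : ℕ) (hk : k ≤ l) : L3f L2 n l (X ^ k) = L2 (X ^ (n - k)) := by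
  rw [L3f_apply, Finset.sum_eq_single k]
  · simp
  · intro j _ hj
    rw [coeff_X_pow, if_neg hj, zero_mul]
  · intro h; exact absurd (Finset.mem_range.2 (by omega)) h

lemma L3f_reverse (L2 : Lin) (n l B : ℕ) (hl : l ≤ n) (hB : n < l + B + 1) (hZ : Zr L2 B) (f : F2[X]) (hf : f ∈ Dn n) :
    L3f L2 n l f.reverse = L2 f := by
  have hf' : f ∈ GN (n + 1) := by rw [GN_succ]; exact Finset.mem_union_right _ hf
  rw [lin_expand L2 (n + 1) f hf', L3f_apply, ← Finset.sum_range_reflect (fun i => f.coeff i * L2 (X ^ i))]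
  have h1 : ∀ j ∈ Finset.range (n + 1), f.coeff (n + 1 - 1 - j) * L2 (X ^ (n + 1 - 1 - j)) = f.reverse.coeff j * L2 (X ^ (n - j)) := by
    intro j hj
    have hj := Finset.mem_range.1 hj
    rw [reverse_Dn hf, coeff_reflect, revAt_le (by omega)]
    rfl
  rw [Finset.sum_congr rfl h1]
  refine Finset.sum_subset (fun j hj => Finset.mem_range.2 (by have := Finset.mem_range.1 hj; omega)) ?_
  intro j hj hj'
  rw [Finset.mem_range] at hj hj'
  rw [(Zr_iff L2 B).1 hZ (n - j) (by omega), mul_zero]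

theorem slice (L : Lin) (M n : ℕ) (hn : 1 ≤ n) (hnM : n ≤ 2 * M) (s : F2[X]) (L1 : Lin) (hs : s ≠ 0) (hm : s.natDegree ≤ M)
    (h1 : ∀ q, L1 (s * q) = 0) (h2 : ∀ t ∈ GN s.natDegree, t ≠ 0 → ∃ q, L1 (t * q) ≠ 0)
    (hag : Zr (L - L1) (s.natDegree + M)) :
    |∑ f ∈ Dn n, LambdaP f * sgn (L f) - 2 ^ n * alphaA s * (if Zr (L - L1) n then sgn ((L - L1) (X ^ n)) else 0)|
      ≤ 2 * M + 2 * 2 ^ M + Real.sqrt (2 ^ M) * (M * 2 ^ M) := by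
  set L2 := L - L1 with hL2
  set l := n - (s.natDegree + M) with hl
  have h3 : ∀ q, L3f L2 n l (X ^ (l + 1) * q) = 0 := by
    intro q
    rw [L3f_apply]
    refine Finset.sum_eq_zero fun j hj => ?_
    rw [coeff_X_pow_mul', if_neg (by have := Finset.mem_range.1 hj; omega), zero_mul]
  have hp := prime_char s hs l n hn L1 (L3f L2 n l) h1 h3
  rw [ramanujan s hs L1 h1 h2] at hp
  have e1 : ∑ f ∈ (Dn n).filter (fun f => Irreducible f), (n : ℝ) * (sgn (L1 f) * sgn (L3f L2 n l f.reverse)) =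
      ∑ f ∈ Dn n, LambdaP f * sgn (L f) := by
    rw [Finset.sum_filter]
    refine Finset.sum_congr rfl fun f hf => ?_
    rw [LambdaP]
    by_cases hi : Irreducible f
    · rw [if_pos hi, if_pos hi, ((mem_Dn' n f).1 hf).2, L3f_reverse L2 n l (s.natDegree + M) (by omega) (by omega) hag f hf, ← sgn_add]
      congr 2
      rw [hL2, LinearMap.sub_apply]; ring
    · rw [if_neg hi, if_neg hi, zero_mul]
  have e2 : ∑ h ∈ GN l, sgn (L3f L2 n l (1 + X * h)) = 2 ^ l * (if Zr L2 n then sgn (L2 (X ^ n)) else 0) := by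
    have e3 : Zr (mulL (L3f L2 n l) X) l ↔ Zr L2 n := by
      rw [Zr_iff, Zr_iff]
      constructor
      · intro h i hi
        by_cases hi2 : i < s.natDegree + M
        · exact (Zr_iff _ _).1 hag i hi2
        · have := h (n - i - 1) (by omega)
          rw [mulL_apply, ← pow_succ', L3f_X _ _ _ _ (by omega)] at this
          rwa [show n - (n - i - 1 + 1) = i by omega] at this
      · intro h i hi
        rw [mulL_apply, ← pow_succ', L3f_X _ _ _ _ (by omega)]
        exact h _ (by omega)
    have e4 := orth (mulL (L3f L2 n l) X) l
    simp only [mulL_apply] at e4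
    have e5 := L3f_X L2 n l 0 (Nat.zero_le _)
    rw [pow_zero, Nat.sub_zero] at e5
    simp only [map_add, sgn_add]
    rw [← Finset.mul_sum, e4, e5]
    by_cases hZ : Zr L2 n
    · rw [if_pos (e3.2 hZ), if_pos hZ, mul_comm]
    · rw [if_neg (fun h => hZ (e3.1 h)), if_neg hZ]; ring
  rw [e1, e2] at hp
  have e6 : (2 : ℝ) ^ n / (phi s * 2 ^ l) * (mu s * (2 ^ l * (if Zr L2 n then sgn (L2 (X ^ n)) else 0))) =
      2 ^ n * alphaA s * (if Zr L2 n then sgn (L2 (X ^ n)) else 0) := by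
    rw [alphaA]
    have := phi_pos s hs
    field_simp
  rw [e6] at hp
  refine hp.trans ?_
  have hml : s.natDegree + l ≤ M := by omega
  have g1 : (s.natDegree : ℝ) ≤ M := by exact_mod_cast hm
  have g2 : (2 : ℝ) ^ (n / 2) ≤ 2 ^ M := pow_le_pow_right₀ (by norm_num) (by omega)
  have g3 : Real.sqrt (2 ^ (s.natDegree + l)) ≤ Real.sqrt (2 ^ M) :=
    Real.sqrt_le_sqrt (pow_le_pow_right₀ (by norm_num) hml)
  have g4 : ((s.natDegree + l : ℕ) : ℝ) ≤ M := by exact_mod_cast hml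
  have g5 : Real.sqrt (2 ^ n) ≤ 2 ^ M := by
    rw [Real.sqrt_le_left (by positivity), ← pow_mul]
    exact pow_le_pow_right₀ (by norm_num) (by omega)
  gcongr

def SZ (L : Lin) (n : ℕ) : ℝ := if Zr L n then 2 ^ n else 0

lemma SZ_succ (L : Lin) (n : ℕ) : SZ L (n + 1) = SZ L n + 2 ^ n * (if Zr L n then sgn (L (X ^ n)) else 0) := by
  rw [SZ, SZ, Zr_succ]
  by_cases h : Zr L n
  · rcases F2_cases (L (X ^ n)) with h2 | h2 <;> simp [h, h2]; ring
  · simp [h]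

theorem prime_sum (L : Lin) (M N : ℕ) (hN : 1 ≤ N) (hNM : N ≤ 2 * M + 1) (s : F2[X]) (L1 : Lin) (hs : s ≠ 0) (hm : s.natDegree ≤ M)
    (h1 : ∀ q, L1 (s * q) = 0) (h2 : ∀ t ∈ GN s.natDegree, t ≠ 0 → ∃ q, L1 (t * q) ≠ 0)
    (hag : Zr (L - L1) (s.natDegree + M)) :
    |∑ f ∈ GN N, LambdaP f * sgn (L f) - alphaA s * SZ (L - L1) N|
      ≤ 2 + N * (2 * M + 2 * 2 ^ M + Real.sqrt (2 ^ M) * (M * 2 ^ M)) := by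
  set E : ℝ := 2 * M + 2 * 2 ^ M + Real.sqrt (2 ^ M) * (M * 2 ^ M) with hE
  have hE0 : 0 ≤ E := by positivity
  have key : ∀ n : ℕ, 1 ≤ n → n ≤ 2 * M + 1 →
      |∑ f ∈ GN n, LambdaP f * sgn (L f) - alphaA s * (SZ (L - L1) n - SZ (L - L1) 1)| ≤ n * E := by
    intro n hn
    induction n, hn using Nat.le_induction with
    | base =>
      intro _
      rw [sum_GN_succ, GN_zero, Dn_zero]
      have a0 : LambdaP 0 = 0 := by simp [LambdaP]
      have a1 : LambdaP 1 = 0 := by simp [LambdaP]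
      simp [a0, a1, hE0]
    | succ n hn ih =>
      intro hle
      have ih := ih (by omega)
      have hsl := slice L M n hn (by omega) s L1 hs hm h1 h2 hag
      rw [sum_GN_succ, SZ_succ]
      rw [← hE] at hsl
      rw [abs_le] at *
      push_cast
      constructor <;> nlinarith
  have h := key N hN hNM
  have hS : |alphaA s * SZ (L - L1) 1| ≤ 2 := by
    rw [abs_mul]
    have : |SZ (L - L1) 1| ≤ 2 := by rw [SZ]; split_ifs <;> norm_num
    calc _ ≤ 1 * (2 : ℝ) := mul_le_mul (abs_alphaA' s hs) this (abs_nonneg _) (by norm_num)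
      _ = 2 := by norm_num
  rw [abs_le] at *
  constructor <;> nlinarith

end S8

namespace S8

def TK : Kinf := HahnSeries.single (-1 : ℤ) (1 : F2)

lemma polyToK_eq (f : F2[X]) : polyToK f = eval₂ (algebraMap F2 Kinf) TK f := by
  rw [eval₂_eq_sum, Polynomial.sum_def, polyToK]
  refine Finset.sum_congr rfl fun i _ => ?_
  rw [TK, HahnSeries.single_pow, one_pow]
  rcases F2_cases (f.coeff i) with h | h
  · rw [h, (algebraMap F2 Kinf).map_zero, zero_mul, HahnSeries.single_eq_zero]
  · rw [h, (algebraMap F2 Kinf).map_one, one_mul]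
    congr 2
    simp

lemma polyToK_add (f g : F2[X]) : polyToK (f + g) = polyToK f + polyToK g := by
  simp only [polyToK_eq, eval₂_add]

lemma polyToK_mul (f g : F2[X]) : polyToK (f * g) = polyToK f * polyToK g := by
  simp only [polyToK_eq, eval₂_mul]

lemma polyToK_zero : polyToK 0 = 0 := by
  simp only [polyToK_eq, eval₂_zero]

lemma polyToK_one : polyToK 1 = 1 := by
  simp only [polyToK_eq, eval₂_one]

lemma coeff_polyToK (f : F2[X]) (n : ℤ) : (polyToK f).coeff n = if n ≤ 0 then f.coeff (-n).toNat else 0 := by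
  rw [polyToK, HahnSeries.coeff_sum]
  simp only [HahnSeries.coeff_single]
  split_ifs with h
  · rw [Finset.sum_eq_single (-n).toNat]
    · rw [if_pos (by omega)]
    · intro b _ hb
      rw [if_neg (by omega)]
    · intro hb
      rw [notMem_support_iff.1 hb, ite_self]
  · refine Finset.sum_eq_zero fun i _ => ?_
    rw [if_neg (by omega)]

lemma polyToK_inj {f g : F2[X]} (h : polyToK f = polyToK g) : f = g := by
  ext i
  have h2 := congrArg (fun a : Kinf => a.coeff (-(i : ℤ))) h
  simp only [coeff_polyToK] at h2
  simpa using h2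

lemma polyToK_ne {f : F2[X]} (h : f ≠ 0) : polyToK f ≠ 0 := by
  intro h0
  rw [← polyToK_zero] at h0
  exact h (polyToK_inj h0)

def lamK (θ : Kinf) : Lin where
  toFun f := (polyToK f * θ).coeff 1
  map_add' f g := by rw [polyToK_add, add_mul, HahnSeries.coeff_add]
  map_smul' c f := by
    rcases F2_cases c with rfl | rfl
    · rw [zero_smul, polyToK_zero]; simp
    · rw [one_smul]; simp

lemma lamK_apply (θ : Kinf) (f : F2[X]) : lamK θ f = (polyToK f * θ).coeff 1 := rfl

lemma eKr_eq (θ : Kinf) (f : F2[X]) : eKr (polyToK f * θ) = sgn (lamK θ f) := rfl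

lemma lamK_add (θ η : Kinf) : lamK (θ + η) = lamK θ + lamK η := by
  ext f
  simp [lamK_apply, mul_add]

lemma poly_of_zero (θ : Kinf) (h : ∀ q, lamK θ q = 0) : ∃ g, θ = polyToK g := by
  have h1 : ∀ n : ℤ, 1 ≤ n → θ.coeff n = 0 := by
    intro n hn
    have := h (X ^ (n - 1).toNat)
    rw [lamK_apply, polyToK_eq, eval₂_X_pow, TK, HahnSeries.single_pow, one_pow] at this
    have e := HahnSeries.coeff_single_mul_add (r := (1 : F2)) (x := θ) (a := n) (b := (n - 1).toNat • (-1 : ℤ))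
    rw [one_mul] at e
    rw [← e, ← this]
    congr 1
    simp
    omega
  set K := (-θ.order).toNat + 1 with hK
  refine ⟨∑ i ∈ Finset.range K, monomial i (θ.coeff (-(i : ℤ))), ?_⟩
  ext n
  rw [coeff_polyToK]
  split_ifs with hn
  · rw [finset_sum_coeff]
    simp only [coeff_monomial]
    rw [Finset.sum_ite_eq']
    split_ifs with hr
    · congr 1; omega
    · rw [Finset.mem_range] at hr
      apply HahnSeries.coeff_eq_zero_of_lt_order
      omega
  · exact h1 n (by omega)

lemma ratK_mul (t s q : F2[X]) : polyToK q * ratK t s = ratK (t * q) s := by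
  rw [ratK, ratK, polyToK_mul]; ring

lemma rat_kill (s t q : F2[X]) (hs : s ≠ 0) (h : s ∣ t * q) : lamK (ratK t s) q = 0 := by
  obtain ⟨e, he⟩ := h
  rw [lamK_apply, ratK_mul, he, ratK, polyToK_mul, mul_comm (polyToK s), mul_assoc, mul_inv_cancel₀ (polyToK_ne hs), mul_one, coeff_polyToK]
  norm_num

lemma rat_nondeg (s t : F2[X]) (hs : s ≠ 0) (h : ∀ q, lamK (ratK t s) q = 0) : s ∣ t := by
  obtain ⟨g, hg⟩ := poly_of_zero _ h
  refine ⟨g, ?_⟩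
  apply polyToK_inj
  rw [polyToK_mul, ← hg, ratK, mul_comm, mul_assoc, inv_mul_cancel₀ (polyToK_ne hs), mul_one]

lemma lamK_mul (t s u q : F2[X]) : lamK (ratK t s) (u * q) = lamK (ratK (t * u) s) q := by
  rw [lamK_apply, lamK_apply, polyToK_mul, mul_comm (polyToK u), mul_assoc, ratK_mul]

lemma lin_ext (L L' : Lin) (u : F2[X]) (hu : u ≠ 0) (h1 : ∀ q, L (u * q) = 0) (h2 : ∀ q, L' (u * q) = 0)
    (h : ∀ f ∈ GN u.natDegree, L f = L' f) : L = L' := by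
  apply LinearMap.ext
  intro f
  have e : f = f %ₘ u + u * (f /ₘ u) := (modByMonic_add_div f u).symm
  rw [e, map_add, map_add, h1, h2, h _ (mod_mem_GN u hu f)]

lemma rat_inj (s t t' : F2[X]) (hs : s ≠ 0) (ht : t ∈ GN s.natDegree) (ht' : t' ∈ GN s.natDegree)
    (h : lamK (ratK t s) = lamK (ratK t' s)) : t = t' := by
  have e : ratK (t - t') s = ratK t s - ratK t' s := by
    have : polyToK (t - t') = polyToK t - polyToK t' := by
      rw [eq_sub_iff_add_eq, ← polyToK_add, sub_add_cancel]
    rw [ratK, ratK, ratK, this, sub_mul]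
  have hd : s ∣ t - t' := by
    apply rat_nondeg s _ hs
    intro q
    have h2 := LinearMap.congr_fun h q
    rw [lamK_apply, lamK_apply] at h2
    rw [lamK_apply, e, mul_sub, HahnSeries.coeff_sub, h2, sub_self]
  exact sub_eq_zero.1 (dvd_GN_zero s _ (sub_mem_GN ht ht') hd)

lemma rat_exists (s : F2[X]) (hs : s ≠ 0) (L1 : Lin) (h1 : ∀ q, L1 (s * q) = 0)
    (h2 : ∀ t ∈ GN s.natDegree, t ≠ 0 → ∃ q, L1 (t * q) ≠ 0) : ∃ t ∈ residues s, lamK (ratK t s) = L1 := by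
  have hk : ∀ t q, lamK (ratK t s) (s * q) = 0 := fun t q => rat_kill s t _ hs ⟨t * q, by ring⟩
  have hag : ∀ L L' : Lin, (∀ i : Fin s.natDegree, L (X ^ (i : ℕ)) = L' (X ^ (i : ℕ))) → ∀ f ∈ GN s.natDegree, L f = L' f := by
    intro L L' h
    have : Zr (L - L') s.natDegree := by
      rw [Zr_iff]
      intro i hi
      rw [LinearMap.sub_apply, h ⟨i, hi⟩, sub_self]
    intro f hf
    have := this f hf
    rwa [LinearMap.sub_apply, sub_eq_zero] at this
  let F : F2[X] → (Fin s.natDegree → F2) := fun t i => lamK (ratK t s) (X ^ (i : ℕ))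
  have hinj : Set.InjOn F (GN s.natDegree : Set F2[X]) := by
    intro t ht t' ht' h
    exact rat_inj s t t' hs ht ht' (lin_ext _ _ s hs (hk t) (hk t') (hag _ _ fun i => congrFun h i))
  have hsurj := Finset.surjOn_of_injOn_of_card_le (s := GN s.natDegree) (t := (Finset.univ : Finset (Fin s.natDegree → F2)))
    F (fun _ _ => Finset.mem_coe.2 (Finset.mem_univ _)) hinj (by simp [card_GN])
  obtain ⟨t, ht, hFt⟩ := hsurj (Finset.mem_coe.2 (Finset.mem_univ (fun i : Fin s.natDegree => L1 (X ^ (i : ℕ)))))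
  have hL : lamK (ratK t s) = L1 := lin_ext _ _ s hs (hk t) h1 (hag _ _ fun i => congrFun hFt i)
  refine ⟨t, ?_, hL⟩
  rw [residues, Finset.mem_filter]
  refine ⟨ht, ?_⟩
  rw [coprime_iff s hs]
  intro r hr hrt
  obtain ⟨hi, e, he⟩ := (mem_PD s hs r).1 hr
  obtain ⟨t', ht'⟩ := hrt
  have he0 : e ≠ 0 := by rintro rfl; rw [mul_zero] at he; exact hs he
  have hdeg : s.natDegree = r.natDegree + e.natDegree := by rw [he, natDegree_mul hi.ne_zero he0]
  have := hi.natDegree_pos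
  obtain ⟨q, hq⟩ := h2 e (GN_of_natDegree_lt fun _ => by omega) he0
  apply hq
  rw [← hL]
  refine rat_kill s t _ hs ⟨t' * q, ?_⟩
  rw [ht', he]; ring

lemma residues_zero : residues 0 = ∅ := by
  rw [residues]
  ext t
  simp only [Finset.mem_filter, natDegree_zero, GN_zero, Finset.mem_singleton]
  simp only [Finset.notMem_empty, iff_false]
  rintro ⟨rfl, h⟩
  simp [IsCoprime] at h

theorem lambda_sum (L : Lin) (N R M : ℕ) (hRM : R + M ≤ N) (hR : R ≤ M) (s : F2[X]) (L1 : Lin) (hs : s ≠ 0) 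
    (h1 : ∀ q, L1 (s * q) = 0) (h2 : ∀ t ∈ GN s.natDegree, t ≠ 0 → ∃ q, L1 (t * q) ≠ 0)
    (hag : Zr (L - L1) (s.natDegree + M)) (hmin : ∀ t ∈ GN s.natDegree, t ≠ 0 → ∃ q ∈ GN M, L (t * q) ≠ 0) :
    ∑ f ∈ GN N, LambdaM R f * sgn (L f) = if s.natDegree < R then alphaA s * SZ (L - L1) N else 0 := by
  have claimA : ∀ s' ∈ GN R, ∀ t ∈ residues s', Zr (lamK (ratK t s') + L) N →
      s' = s ∧ lamK (ratK t s') = L1 ∧ Zr (L - L1) N := by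
    intro s' hs'R t ht hZ
    have hs' : s' ≠ 0 := by rintro rfl; rw [residues_zero] at ht; simp at ht
    have hcop : IsCoprime t s' := (Finset.mem_filter.1 ht).2
    have hdeg' := natDegree_lt_of_GN hs'R hs'
    set L' := lamK (ratK t s') with hL'
    have hk : ∀ q, L' (s' * q) = 0 := fun q => rat_kill s' t _ hs' ⟨t * q, by ring⟩
    have heq : ∀ f ∈ GN N, L f = L' f := by
      intro f hf
      have h := hZ f hf
      rw [LinearMap.add_apply] at h
      rcases F2_cases (L f) with h3 | h3 <;> rcases F2_cases (L' f) with h4 | h4 <;> rw [h3, h4] at h ⊢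
      · simp at h
      · simp at h
    have hle : s.natDegree ≤ s'.natDegree := by
      by_contra hlt
      obtain ⟨q, hq, hne⟩ := hmin s' (GN_of_natDegree_lt fun _ => by omega) hs'
      apply hne
      rw [heq, hk]
      exact GN_mono hRM (mul_mem_GN hs'R hq)
    have hLL : L' = L1 := by
      refine lin_ext L' L1 (s * s') (mul_ne_zero hs hs') ?_ ?_ ?_
      · intro q; rw [mul_comm s, mul_assoc]; exact hk _
      · intro q; rw [mul_assoc]; exact h1 _
      · intro f hf
        rw [natDegree_mul hs hs'] at hf
        rw [← heq f (GN_mono (by omega) hf)]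
        have := hag f (GN_mono (by omega) hf)
        rwa [LinearMap.sub_apply, sub_eq_zero] at this
    have hdvd : s' ∣ s := by
      have : s' ∣ t * s := by
        apply rat_nondeg s' _ hs'
        intro q
        rw [← lamK_mul, ← hL', hLL, h1]
      exact hcop.symm.dvd_of_dvd_mul_left this
    refine ⟨?_, hLL, ?_⟩
    · obtain ⟨e, he⟩ := hdvd
      have he0 : e ≠ 0 := by rintro rfl; rw [mul_zero] at he; exact hs he
      have hd : s.natDegree = s'.natDegree + e.natDegree := by rw [he, natDegree_mul hs' he0]
      rw [eq_one_of_monic_natDegree_zero (F2_monic he0) (by omega), mul_one] at he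
      exact he.symm
    · intro f hf
      rw [LinearMap.sub_apply, heq f hf, hLL, sub_self]
  have e1 : ∑ f ∈ GN N, LambdaM R f * sgn (L f) = ∑ s' ∈ GN R, alphaA s' * ∑ t ∈ residues s', SZ (lamK (ratK t s') + L) N := by
    have : ∀ f, LambdaM R f * sgn (L f) = ∑ s' ∈ GN R, ∑ t ∈ residues s', alphaA s' * sgn ((lamK (ratK t s') + L) f) := by
      intro f
      rw [LambdaM, Finset.sum_mul]
      refine Finset.sum_congr rfl fun s' _ => ?_
      rw [Finset.mul_sum, Finset.sum_mul]
      refine Finset.sum_congr rfl fun t _ => ?_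
      rw [eKr_eq, LinearMap.add_apply, sgn_add, mul_assoc]
    simp only [this]
    rw [Finset.sum_comm]
    refine Finset.sum_congr rfl fun s' _ => ?_
    rw [Finset.sum_comm, Finset.mul_sum]
    refine Finset.sum_congr rfl fun t _ => ?_
    rw [← Finset.mul_sum, orth, SZ]
  rw [e1]
  by_cases hmR : s.natDegree < R
  · rw [if_pos hmR]
    rw [Finset.sum_eq_single s]
    · congr 1
      obtain ⟨t, ht, htL⟩ := rat_exists s hs L1 h1 h2
      rw [Finset.sum_eq_single t]
      · have : Zr (lamK (ratK t s) + L) N ↔ Zr (L - L1) N := by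
          constructor
          · intro h; exact (claimA s (GN_of_natDegree_lt fun _ => hmR) t ht h).2.2
          · intro h f hf
            have := h f hf
            rw [LinearMap.sub_apply, sub_eq_zero] at this
            rw [LinearMap.add_apply, htL, this]
            exact CharTwo.add_self_eq_zero _
        rw [SZ, SZ, if_congr this rfl rfl]
      · intro t' ht' hne
        rw [SZ, if_neg]
        intro hZ
        have := (claimA s (GN_of_natDegree_lt fun _ => hmR) t' ht' hZ).2.1
        exact hne (rat_inj s t' t hs (Finset.mem_filter.1 ht').1 (Finset.mem_filter.1 ht).1 (this.trans htL.symm))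
      · intro h; exact absurd ht h
    · intro s' hs' hne
      rw [Finset.sum_eq_zero, mul_zero]
      intro t ht
      rw [SZ, if_neg]
      intro hZ
      exact hne (claimA s' hs' t ht hZ).1
    · intro h; exact absurd (GN_of_natDegree_lt fun _ => hmR) h
  · rw [if_neg hmR]
    refine Finset.sum_eq_zero fun s' hs' => ?_
    rw [Finset.sum_eq_zero, mul_zero]
    intro t ht
    rw [SZ, if_neg]
    intro hZ
    have := (claimA s' hs' t ht hZ).1
    have hs0 : s' ≠ 0 := by rw [this]; exact hs
    have h3 := natDegree_lt_of_GN hs' hs0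
    rw [this] at h3
    exact hmR h3

end S8

namespace S8

lemma omega_le' (s : F2[X]) (hs : s ≠ 0) (D N : ℕ) (hD : 1 ≤ D) (h : s.natDegree ≤ N) :
    omegaP s ≤ 2 ^ (D + 1) + N / D := by
  have h1 := omega_le s hs D
  have h2 : (omegaP s - 2 ^ (D + 1)) ≤ N / D := by
    rw [Nat.le_div_iff_mul_le (by omega), Nat.sub_mul, mul_comm (omegaP s), mul_comm (2 ^ (D + 1))]
    omega
  omega

lemma shift_sum (N : ℕ) (hN : 1 ≤ N) (A : F2[X] → ℝ) (L : Lin) :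
    ∑ f ∈ GN N, A (f + 1) * sgn (L f) = sgn (L 1) * ∑ f ∈ GN N, A f * sgn (L f) := by
  have h1 : (1 : F2[X]) ∈ GN N := by
    have := X_mem_GN (i := 0) (n := N) (by omega)
    rwa [pow_zero] at this
  have h2 : ∀ f : F2[X], f + 1 + 1 = f := fun f => by
    rw [add_assoc, CharTwo.add_self_eq_zero, add_zero]
  rw [Finset.mul_sum]
  refine Finset.sum_bij' (fun f _ => f + 1) (fun f _ => f + 1) ?_ ?_ ?_ ?_ ?_
  · intro f hf; exact add_mem_GN hf h1
  · intro f hf; exact add_mem_GN hf h1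
  · intro f _; exact h2 f
  · intro f _; exact h2 f
  · intro f _
    have : sgn (L f) = sgn (L 1) * sgn (L (f + 1)) := by
      rw [← sgn_add, ← map_add, add_comm 1, h2]
    rw [this]; ring

def Bd (N W : ℕ) : ℝ :=
  2 + N * (2 * (N / 2 : ℕ) + 2 * 2 ^ (N / 2) + Real.sqrt (2 ^ (N / 2)) * ((N / 2 : ℕ) * 2 ^ (N / 2))) + 2 ^ (N - N / 4) * 2 ^ W

theorem sup_bound (N D : ℕ) (hN : 1 ≤ N) (hD : 1 ≤ D) (L : Lin) :
    |∑ f ∈ GN N, (LambdaP f - LambdaM (N / 4) f) * sgn (L f)| ≤ Bd N (2 ^ (D + 1) + N / D) := by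
  obtain ⟨s, L1, hs, hm, h1, h2, hag, hmin⟩ := approx L (N / 2)
  have hp := prime_sum L (N / 2) N hN (by omega) s L1 hs hm h1 h2 hag
  have hl := lambda_sum L N (N / 4) (N / 2) (by omega) (by omega) s L1 hs h1 h2 hag hmin
  simp only [sub_mul, Finset.sum_sub_distrib]
  rw [hl, Bd]
  have hpos : (0 : ℝ) ≤ 2 ^ (N - N / 4) * 2 ^ (2 ^ (D + 1) + N / D) := by positivity
  split_ifs with hlt
  · exact hp.trans (le_add_of_nonneg_right hpos)
  · have hmain : |alphaA s * SZ (L - L1) N| ≤ 2 ^ (N - N / 4) * 2 ^ (2 ^ (D + 1) + N / D) := by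
      have g1 := abs_alphaA s hs
      have g2 : |SZ (L - L1) N| ≤ 2 ^ N := by
        rw [SZ]; split_ifs
        · rw [abs_of_pos (by positivity)]
        · simp
      have g3 := omega_le' s hs D N hD (by omega)
      rw [abs_mul]
      calc _ ≤ (2 ^ omegaP s / 2 ^ s.natDegree) * 2 ^ N := mul_le_mul g1 g2 (abs_nonneg _) (by positivity)
        _ ≤ (2 ^ (2 ^ (D + 1) + N / D) / 2 ^ (N / 4)) * 2 ^ N := by
            gcongr
            · norm_num
            · norm_num
            · omega
        _ = _ := by
            rw [pow_sub₀ (2 : ℝ) (by norm_num) (show N / 4 ≤ N by omega)]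
            field_simp
    rw [sub_zero]
    calc _ = |(∑ f ∈ GN N, LambdaP f * sgn (L f) - alphaA s * SZ (L - L1) N) + alphaA s * SZ (L - L1) N| := by
          rw [sub_add_cancel]
      _ ≤ _ := (abs_add_le _ _).trans (add_le_add hp hmain)

theorem total_bound (N D : ℕ) (hN : 1 ≤ N) (hD : 1 ≤ D) (θ : Kinf) :
    |∑ f ∈ GN N, (Psi N (N / 8) f - Psi' N (N / 4) (N / 8) f) * eKr (polyToK f * θ)| ≤
      2 ^ (N / 8) * 3 ^ (2 ^ (D + 1) + N / D) * Bd N (2 ^ (D + 1) + N / D) := by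
  set W := 2 ^ (D + 1) + N / D with hW
  have hB0 : 0 ≤ Bd N W := (abs_nonneg _).trans (sup_bound N D hN hD 0)
  set A : F2[X] → ℝ := fun f => LambdaP f - LambdaM (N / 4) f with hA
  have e1 : ∑ f ∈ GN N, (Psi N (N / 8) f - Psi' N (N / 4) (N / 8) f) * eKr (polyToK f * θ) =
      ∑ s ∈ GN (N / 8), alphaB s * ∑ t ∈ residues s, ∑ f ∈ GN N, A (f + 1) * sgn ((lamK (ratK t s) + lamK θ) f) := by
    have : ∀ f ∈ GN N, (Psi N (N / 8) f - Psi' N (N / 4) (N / 8) f) * eKr (polyToK f * θ) =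
        ∑ s ∈ GN (N / 8), ∑ t ∈ residues s, alphaB s * (A (f + 1) * sgn ((lamK (ratK t s) + lamK θ) f)) := by
      intro f hf
      rw [Psi, Psi', if_pos hf, eKr_eq]
      have : (LambdaP (f + 1) * HM (N / 8) f * 1 - LambdaM (N / 4) (f + 1) * HM (N / 8) f * 1) * sgn (lamK θ f) =
        (A (f + 1) * sgn (lamK θ f)) * HM (N / 8) f := by simp only [hA]; ring
      rw [this, HM, Finset.mul_sum]
      refine Finset.sum_congr rfl fun s _ => ?_
      rw [Finset.mul_sum, Finset.mul_sum]
      refine Finset.sum_congr rfl fun t _ => ?_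
      rw [eKr_eq, LinearMap.add_apply, sgn_add]; ring
    rw [Finset.sum_congr rfl this, Finset.sum_comm]
    refine Finset.sum_congr rfl fun s _ => ?_
    rw [Finset.sum_comm, Finset.mul_sum]
    refine Finset.sum_congr rfl fun t _ => ?_
    rw [Finset.mul_sum]
  rw [e1]
  have hterm : ∀ s ∈ GN (N / 8), |alphaB s * ∑ t ∈ residues s, ∑ f ∈ GN N, A (f + 1) * sgn ((lamK (ratK t s) + lamK θ) f)| ≤ 3 ^ W * Bd N W := by
    intro s hs
    by_cases h0 : s = 0
    · rw [h0, residues_zero]; simp; positivity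
    rw [abs_mul, abs_of_nonneg (alphaB_nonneg s)]
    have h1 : |∑ t ∈ residues s, ∑ f ∈ GN N, A (f + 1) * sgn ((lamK (ratK t s) + lamK θ) f)| ≤ phi s * Bd N W := by
      refine (Finset.abs_sum_le_sum_abs _ _).trans ?_
      have : (phi s : ℝ) * Bd N W = ∑ t ∈ residues s, Bd N W := by
        rw [Finset.sum_const, nsmul_eq_mul]; rfl
      rw [this]
      refine Finset.sum_le_sum fun t _ => ?_
      rw [shift_sum N hN, abs_mul, abs_sgn, one_mul]
      exact sup_bound N D hN hD _
    calc _ ≤ alphaB s * (phi s * Bd N W) := mul_le_mul_of_nonneg_left h1 (alphaB_nonneg s)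
      _ = (alphaB s * phi s) * Bd N W := by ring
      _ ≤ 3 ^ omegaP s * Bd N W := mul_le_mul_of_nonneg_right (alphaB_phi s h0) hB0
      _ ≤ _ := by
        refine mul_le_mul_of_nonneg_right (pow_le_pow_right₀ (by norm_num) ?_) hB0
        exact omega_le' s h0 D N hD (by have := natDegree_lt_of_GN hs h0; omega)
  refine (Finset.abs_sum_le_sum_abs _ _).trans ((Finset.sum_le_sum hterm).trans ?_)
  rw [Finset.sum_const, card_GN, nsmul_eq_mul]
  push_cast
  rw [mul_assoc]

lemma pow2_rpow (n : ℕ) : (2 : ℝ) ^ n = (2 : ℝ) ^ (n : ℝ) := (Real.rpow_natCast 2 n).symm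

lemma Bd_le (N W : ℕ) (hN : 1 ≤ N) : Bd N W ≤ 9 * N ^ 2 * 2 ^ W * (2 : ℝ) ^ ((3 / 4 : ℝ) * N) := by
  set M := N / 2 with hM
  have hN' : (1 : ℝ) ≤ N := by exact_mod_cast hN
  have hMN : (M : ℝ) ≤ N / 2 := by
    have : (2 * M : ℕ) ≤ N := by omega
    have : (2 * M : ℝ) ≤ N := by exact_mod_cast this
    linarith
  have hM0 : (0 : ℝ) ≤ M := Nat.cast_nonneg _
  set T : ℝ := (2 : ℝ) ^ ((3 / 4 : ℝ) * N) with hT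
  have hT1 : 1 ≤ T := Real.one_le_rpow (by norm_num) (by positivity)
  have g1 : (2 : ℝ) ^ M ≤ T := by
    rw [pow2_rpow]; exact Real.rpow_le_rpow_of_exponent_le (by norm_num) (by linarith)
  have g2 : Real.sqrt (2 ^ M) * 2 ^ M ≤ T := by
    rw [Real.sqrt_eq_rpow, pow2_rpow, ← Real.rpow_mul (by norm_num), ← Real.rpow_add (by norm_num)]
    exact Real.rpow_le_rpow_of_exponent_le (by norm_num) (by linarith)
  have g3 : (2 : ℝ) ^ (N - N / 4) ≤ 2 * T := by
    have : (2 : ℝ) * T = (2 : ℝ) ^ ((3 / 4 : ℝ) * N + 1) := by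
      rw [Real.rpow_add (by norm_num), Real.rpow_one, mul_comm]
    rw [this, pow2_rpow]
    refine Real.rpow_le_rpow_of_exponent_le (by norm_num) ?_
    have : 4 * (N - N / 4) ≤ 3 * N + 4 := by omega
    have : (4 * (N - N / 4 : ℕ) : ℝ) ≤ 3 * N + 4 := by exact_mod_cast this
    linarith
  have g4 : (M : ℝ) ≤ T := le_trans (by exact_mod_cast (Nat.lt_two_pow_self (n := M)).le) g1
  have hW1 : (1 : ℝ) ≤ 2 ^ W := one_le_pow₀ (by norm_num)
  have hNN : (N : ℝ) ≤ N ^ 2 := by nlinarith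
  have hN2 : (1 : ℝ) ≤ N ^ 2 := by nlinarith
  rw [Bd, ← hM]
  have h5 : Real.sqrt (2 ^ M) * (M * 2 ^ M) ≤ N * T := by
    calc _ = M * (Real.sqrt (2 ^ M) * 2 ^ M) := by ring
      _ ≤ N * T := mul_le_mul (by linarith) g2 (by positivity) (by positivity)
  have h6 : (N : ℝ) * (2 * M + 2 * 2 ^ M + Real.sqrt (2 ^ M) * (M * 2 ^ M)) ≤ 5 * N ^ 2 * T := by
    calc _ ≤ (N : ℝ) * (4 * T + N * T) := by gcongr; linarith
      _ = 4 * N * T + N ^ 2 * T := by ring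
      _ ≤ 4 * N ^ 2 * T + N ^ 2 * T := by gcongr
      _ = _ := by ring
  have h7 : (2 : ℝ) ≤ 2 * N ^ 2 * T := by nlinarith
  have h8 : 7 * N ^ 2 * T ≤ 7 * N ^ 2 * T * 2 ^ W := le_mul_of_one_le_right (by positivity) hW1
  have h9 : (2 : ℝ) ^ (N - N / 4) * 2 ^ W ≤ 2 * N ^ 2 * T * 2 ^ W := by
    refine mul_le_mul_of_nonneg_right (g3.trans ?_) (by positivity)
    nlinarith
  nlinarith

theorem final (ε : ℝ) (hε : 0 < ε) :
    ∃ N₀ : ℕ, ∀ N : ℕ, N₀ ≤ N → ∀ θ : Kinf,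
      |∑ f ∈ GN N, (Psi N (N / 8) f - Psi' N (N / 4) (N / 8) f) * eKr (polyToK f * θ)| ≤
        (1 / 3) * (2 : ℝ) ^ ((N : ℝ) - (1 / 8 - ε) * (N : ℝ)) := by
  obtain ⟨D, hD⟩ := exists_nat_gt (6 / ε)
  have hD0 : (0 : ℝ) < D := lt_trans (by positivity) hD
  have hD1 : 1 ≤ D := by exact_mod_cast hD0
  have hDε : 3 / (D : ℝ) ≤ ε / 2 := by
    rw [div_lt_iff₀ hε] at hD
    rw [div_le_iff₀ hD0]; linarith
  set Cc : ℝ := 27 * 8 ^ (2 ^ (D + 1)) with hCc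
  have hC0 : 0 < Cc := by positivity
  have hr : 1 < (2 : ℝ) ^ (ε / 2) := Real.one_lt_rpow (by norm_num) (by positivity)
  have ht := tendsto_pow_const_div_const_pow_of_one_lt 2 hr
  have hev := ht.eventually (gt_mem_nhds (show (0 : ℝ) < 1 / Cc by positivity))
  obtain ⟨N₁, hN₁⟩ := Filter.eventually_atTop.1 hev
  refine ⟨max N₁ 1, fun N hN θ => ?_⟩
  have hN1 : 1 ≤ N := le_trans (le_max_right _ _) hN
  have hlim := hN₁ N (le_trans (le_max_left _ _) hN)
  rw [div_lt_div_iff₀ (by positivity) hC0, one_mul] at hlim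
  refine (total_bound N D hN1 hD1 θ).trans ?_
  set W := 2 ^ (D + 1) + N / D with hW
  have h8 : (2 : ℝ) ^ (N / 8) ≤ (2 : ℝ) ^ ((1 / 8 : ℝ) * N) := by
    rw [pow2_rpow]
    refine Real.rpow_le_rpow_of_exponent_le (by norm_num) ?_
    have := Nat.cast_div_le (α := ℝ) (m := N) (n := 8)
    push_cast at this
    linarith
  have h3 : (3 : ℝ) ^ W ≤ 4 ^ W := pow_le_pow_left₀ (by norm_num) (by norm_num) _
  have hB := Bd_le N W hN1
  have hB0 : 0 ≤ Bd N W := by rw [Bd]; positivity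
  have h8W : (8 : ℝ) ^ W ≤ 8 ^ (2 ^ (D + 1)) * (2 : ℝ) ^ ((ε / 2) * N) := by
    rw [hW, pow_add]
    refine mul_le_mul_of_nonneg_left ?_ (by positivity)
    have : (8 : ℝ) ^ (N / D) = (2 : ℝ) ^ (3 * ((N / D : ℕ) : ℝ)) := by
      rw [Real.rpow_mul (by norm_num), Real.rpow_natCast]; norm_num
    rw [this]
    refine Real.rpow_le_rpow_of_exponent_le (by norm_num) ?_
    have h1 := Nat.cast_div_le (α := ℝ) (m := N) (n := D)
    calc 3 * ((N / D : ℕ) : ℝ) ≤ 3 * ((N : ℝ) / D) := by gcongr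
      _ = 3 / D * N := by ring
      _ ≤ _ := by gcongr
  have hlim' : (N : ℝ) ^ 2 * Cc ≤ (2 : ℝ) ^ ((ε / 2) * N) := by
    rw [Real.rpow_mul (by norm_num), Real.rpow_natCast]; exact hlim.le
  set E : ℝ := (2 : ℝ) ^ ((ε / 2) * N) with hE
  have hE0 : 0 < E := Real.rpow_pos_of_pos (by norm_num) _
  set P : ℝ := (2 : ℝ) ^ ((1 / 8 : ℝ) * N) with hP
  set T : ℝ := (2 : ℝ) ^ ((3 / 4 : ℝ) * N) with hT
  have hP0 : 0 < P := Real.rpow_pos_of_pos (by norm_num) _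
  have hT0 : 0 < T := Real.rpow_pos_of_pos (by norm_num) _
  have hfin : (2 : ℝ) ^ ((N : ℝ) - (1 / 8 - ε) * (N : ℝ)) = P * T * E * E := by
    rw [hP, hT, hE, ← Real.rpow_add (by norm_num), ← Real.rpow_add (by norm_num), ← Real.rpow_add (by norm_num)]
    congr 1; ring
  rw [hfin]
  calc (2 : ℝ) ^ (N / 8) * 3 ^ W * Bd N W ≤ P * 4 ^ W * (9 * N ^ 2 * 2 ^ W * T) := by gcongr
    _ = P * T * (9 * N ^ 2) * 8 ^ W := by
        have : (8 : ℝ) ^ W = 4 ^ W * 2 ^ W := by rw [← mul_pow]; norm_num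
        rw [this]; ring
    _ ≤ P * T * (9 * N ^ 2) * (8 ^ (2 ^ (D + 1)) * E) := by gcongr
    _ = (1 / 3) * (P * T * (N ^ 2 * Cc) * E) := by rw [hCc]; ring
    _ ≤ (1 / 3) * (P * T * E * E) := by gcongr

end S8

/-- With `K = (1/8−ε)N`, `R = N/4`, `Q = N/8`: for all sufficiently large `N` and all
`θ ∈ T`, `|Σ_{f∈G_N} (Ψ(f) − Ψ′(f)) e(fθ)| ≤ (1/3)·2^{N−K}`. -/
theorem statement_8 (ε : ℝ) (hε : 0 < ε) :
    ∃ N₀ : ℕ, ∀ N : ℕ, N₀ ≤ N → ∀ θ : Kinf, InT θ →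
      |∑ f ∈ GN N, (Psi N (N / 8) f - Psi' N (N / 4) (N / 8) f) * eKr (polyToK f * θ)| ≤
        (1 / 3) * (2 : ℝ) ^ ((N : ℝ) - (1 / 8 - ε) * (N : ℝ)) := by
  obtain ⟨N₀, h⟩ := S8.final ε hε
  exact ⟨N₀, fun N hN θ _ => h N hN θ⟩
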